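/- arXiv:2010.00483 — 2 statements merged into one kernel-verified Lean document; each statement's English description precedes it below -/
import Mathlib

section
/- Quenched CLT along up-right paths with weights uniform on the simplex Δ_{(MN,=)}: Let M = ⌊ξN⌋ with ξ > 0 fixed, and let the weight vector w = (w_{i,j})_{(i,j)∈□_{N,M}} be uniformly distributed on Δ_{(MN,=)} = {x ∈ ℝ₊^{MN} : x_1 + ⋯ + x_{MN} = MN}. Let σ be chosen uniformly at random from all up-right paths from (1,1) to (N,M), independently of w. Then P_w-almost surely, the quenched law of (M+N−1)^{−1/2} Σ_{(i,j)∈σ} (w_{i,j} − E w_{i,j}) converges weakly to the standard Gaussian distribution N(0,1) as N → ∞. -/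
open MeasureTheory ProbabilityTheory Real Filter

/-- The grid `□_{N,M} = {(i,j) : 1 ≤ i ≤ N, 1 ≤ j ≤ M}`. -/
def box (N M : ℕ) : Finset (ℕ × ℕ) := Finset.Icc 1 N ×ˢ Finset.Icc 1 M

/-- `s` is the set of sites of an up-right path from `(1,1)` to `(N,M)`. -/
def IsUpRightPath (N M : ℕ) (s : Finset (ℕ × ℕ)) : Prop :=
  ∃ c : ℕ → ℕ × ℕ, c 0 = (1, 1) ∧ c (N + M - 2) = (N, M) ∧
    (∀ k, k < N + M - 2 →
      c (k + 1) = ((c k).1 + 1, (c k).2) ∨ c (k + 1) = ((c k).1, (c k).2 + 1)) ∧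
    s = (Finset.range (N + M - 1)).image c

open scoped Classical in
/-- All up-right paths from `(1,1)` to `(N,M)`, as sets of sites. -/
noncomputable def upRightPaths (N M : ℕ) : Finset (Finset (ℕ × ℕ)) :=
  (box N M).powerset.filter (fun s => IsUpRightPath N M s)

/-- The quenched average `E_σ f((M+N-1)^{-1/2} Σ_{(i,j)∈σ} (W_{i,j} - E W_{i,j}))` over a
uniformly random up-right path `σ`, with `Wbar` the array of means. -/
noncomputable def pathAvgCentered (N M : ℕ) (W Wbar : ↥(box N M) → ℝ) (f : ℝ → ℝ) : ℝ :=
  ((upRightPaths N M).card : ℝ)⁻¹ *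
    ∑ s ∈ upRightPaths N M,
      f ((Real.sqrt ((M + N - 1 : ℕ) : ℝ))⁻¹ *
        ∑ a : ↥(box N M), if (a : ℕ × ℕ) ∈ s then W a - Wbar a else 0)

/-- The simplex `Δ_{(n,=)} = {x ∈ ℝ₊^ι : Σ x_i = card ι}` in Euclidean space. -/
def simplexEq (ι : Type) [Fintype ι] : Set (EuclideanSpace ℝ ι) :=
  {x | (∀ i, 0 ≤ x i) ∧ ∑ i, x i = (Fintype.card ι : ℝ)}

/-- The uniform (normalized Hausdorff surface) probability measure on `Δ_{(n,=)}`. -/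
noncomputable def simplexEqUniform (ι : Type) [Fintype ι] : Measure (EuclideanSpace ℝ ι) :=
  (μH[((Fintype.card ι - 1 : ℕ) : ℝ)] (simplexEq ι))⁻¹ •
    (μH[((Fintype.card ι - 1 : ℕ) : ℝ)]).restrict (simplexEq ι)

namespace UpRightPath

/-- The law of a family of independent standard exponential variables. -/
noncomputable def expPi (ι : Type) [Fintype ι] : Measure (ι → ℝ) :=
  Measure.pi fun _ : ι => expMeasure 1

instance : IsProbabilityMeasure (expMeasure 1) := isProbabilityMeasure_expMeasure one_pos

instance (ι : Type) [Fintype ι] : IsProbabilityMeasure (expPi ι) := by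
  unfold expPi; infer_instance

lemma measurable_exponentialPDF_one : Measurable (exponentialPDF 1) :=
  (measurable_exponentialPDFReal 1).ennreal_ofReal

lemma lintegral_expMeasure {f : ℝ → ENNReal} (hf : Measurable f) :
    ∫⁻ x, f x ∂(expMeasure 1) = ∫⁻ x, exponentialPDF 1 x * f x := by
  change ∫⁻ x, f x ∂(volume.withDensity (exponentialPDF 1)) = _
  rw [lintegral_withDensity_eq_lintegral_mul _ measurable_exponentialPDF_one hf]
  rfl

lemma measurePreserving_cons (μ : Measure ℝ) [SigmaFinite μ] (n : ℕ) :
    MeasurePreserving (fun p : ℝ × (Fin n → ℝ) => (Fin.cons p.1 p.2 : Fin (n + 1) → ℝ))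
      (μ.prod (Measure.pi fun _ => μ)) (Measure.pi fun _ => μ) := by
  have h := (measurePreserving_piFinSuccAbove (fun _ : Fin (n + 1) => μ) 0).symm
  convert h using 1
  ext p i
  simp [MeasurableEquiv.piFinSuccAbove_symm_apply, Fin.insertNthEquiv]

lemma measurable_cons (n : ℕ) :
    Measurable (fun p : ℝ × (Fin n → ℝ) => (Fin.cons p.1 p.2 : Fin (n + 1) → ℝ)) :=
  (measurePreserving_cons volume n).measurable

lemma lintegral_pi_cons (μ : Measure ℝ) [SigmaFinite μ] {n : ℕ}
    {f : (Fin (n + 1) → ℝ) → ENNReal} (hf : Measurable f) :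
    ∫⁻ x, f x ∂(Measure.pi fun _ => μ) =
      ∫⁻ a, ∫⁻ y, f (Fin.cons a y) ∂(Measure.pi fun _ : Fin n => μ) ∂μ := by
  rw [← (measurePreserving_cons μ n).lintegral_comp hf,
    lintegral_prod (fun p => f (Fin.cons p.1 p.2)) (hf.comp (measurable_cons n)).aemeasurable]

lemma lintegral_expPi_fin {n : ℕ} {f : (Fin n → ℝ) → ENNReal} (hf : Measurable f) :
    ∫⁻ x, f x ∂(expPi (Fin n)) = ∫⁻ x, (∏ i, exponentialPDF 1 (x i)) * f x := by
  induction n with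
  | zero =>
    simp only [Finset.univ_eq_empty, Finset.prod_empty, one_mul, expPi, volume_pi]
    rw [Measure.pi_of_empty (fun _ : Fin 0 => expMeasure 1) 0,
      Measure.pi_of_empty (fun _ : Fin 0 => (volume : Measure ℝ)) 0]
  | succ n ih =>
    have hp : Measurable fun x : Fin (n + 1) → ℝ => (∏ i, exponentialPDF 1 (x i)) * f x :=
      (Finset.measurable_prod _ fun i _ =>
        measurable_exponentialPDF_one.comp (measurable_pi_apply i)).mul hf
    rw [expPi, lintegral_pi_cons _ hf, volume_pi, lintegral_pi_cons _ hp,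
      lintegral_expMeasure]
    · refine lintegral_congr fun a => ?_
      have hfa : Measurable fun y : Fin n → ℝ => f (Fin.cons a y) :=
        hf.comp ((measurable_cons n).comp measurable_prodMk_left)
      have := ih hfa
      rw [expPi] at this
      rw [this, ← lintegral_const_mul, volume_pi]
      · simp [Fin.prod_univ_succ, mul_assoc]
      · exact (Finset.measurable_prod _ fun i _ =>
          measurable_exponentialPDF_one.comp (measurable_pi_apply i)).mul hfa
    · exact (hf.comp (measurable_cons n)).lintegral_prod_right'

open scoped Classical in
lemma prod_exponentialPDF {ι : Type} [Fintype ι] (x : ι → ℝ) :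
    ∏ i, exponentialPDF 1 (x i) =
      if ∀ i, 0 ≤ x i then ENNReal.ofReal (rexp (-∑ i, x i)) else 0 := by
  split_ifs with h
  · rw [← Finset.sum_neg_distrib, Real.exp_sum, ENNReal.ofReal_prod_of_nonneg]
    · refine Finset.prod_congr rfl fun i _ => ?_
      rw [exponentialPDF_of_nonneg (h i)]; simp
    · intros; positivity
  · push Not at h
    obtain ⟨i, hi⟩ := h
    exact Finset.prod_eq_zero (Finset.mem_univ i) (exponentialPDF_of_neg hi)

lemma lintegral_comp_smul {n : ℕ} {r : ℝ} (hr : 0 < r) {f : (Fin n → ℝ) → ENNReal}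
    (hf : Measurable f) :
    ∫⁻ x, f x = ENNReal.ofReal (r ^ n) * ∫⁻ x, f (r • x) := by
  have h := Measure.map_addHaar_smul (volume : Measure (Fin n → ℝ)) hr.ne'
  rw [← lintegral_map (g := fun x : Fin n → ℝ => r • x) hf (by fun_prop), h,
    lintegral_smul_measure, smul_eq_mul, ← mul_assoc, ← ENNReal.ofReal_mul (by positivity)]
  simp [abs_of_pos, hr, pow_pos, hr.ne']

/-- Parametrization of the hyperplane `∑ x_i = d + 1` by the last `d` coordinates. -/
def hyperplaneChart (d : ℕ) (y : Fin d → ℝ) : Fin (d + 1) → ℝ :=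
  Fin.cons ((d + 1 : ℝ) - ∑ i, y i) y

lemma measurable_hyperplaneChart (d : ℕ) : Measurable (hyperplaneChart d) :=
  (measurable_cons d).comp (by fun_prop : Measurable fun y : Fin d → ℝ => ((d + 1 : ℝ) - ∑ i, y i, y))

/-- Rescale a vector so that its coordinates sum to the number of coordinates. -/
noncomputable def normalize {ι : Type} [Fintype ι] (x : ι → ℝ) (i : ι) : ℝ :=
  (Fintype.card ι : ℝ) * x i / ∑ j, x j

lemma measurable_normalize {ι : Type} [Fintype ι] : Measurable (normalize (ι := ι)) := by
  unfold normalize; fun_prop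

lemma lintegral_normalize_expPi (d : ℕ) : ∃ c : ENNReal, ∀ h : (Fin (d + 1) → ℝ) → ENNReal,
    Measurable h → ∫⁻ x, h (normalize x) ∂(expPi (Fin (d + 1))) =
      c * ∫⁻ y in {y | ∀ i, 0 ≤ hyperplaneChart d y i}, h (hyperplaneChart d y) := by
  classical
  refine ⟨∫⁻ s in Set.Ioi (0 : ℝ), ENNReal.ofReal ((s / (d + 1)) ^ d) * ENNReal.ofReal (rexp (-s)),
    fun h hh => ?_⟩
  have hpos : MeasurableSet {x : Fin (d + 1) → ℝ | ∀ i, 0 ≤ x i} := by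
    simp only [Set.ofPred_forall]
    exact MeasurableSet.iInter fun i => measurableSet_le measurable_const (measurable_pi_apply i)
  set G : (Fin (d + 1) → ℝ) → ENNReal := fun x =>
    (if ∀ i, 0 ≤ x i then ENNReal.ofReal (rexp (-∑ i, x i)) else 0) * h (normalize x) with hG
  have hGm : Measurable G := by
    refine Measurable.mul (Measurable.ite hpos (by fun_prop) measurable_const)
      (hh.comp measurable_normalize)
  have hshear : Measurable fun p : ℝ × (Fin d → ℝ) =>
      (Fin.cons (p.1 - ∑ i, p.2 i) p.2 : Fin (d + 1) → ℝ) :=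
    (measurable_cons d).comp (by fun_prop : Measurable fun p : ℝ × (Fin d → ℝ) =>
      (p.1 - ∑ i, p.2 i, p.2))
  have hslice (s : ℝ) : Measurable fun y : Fin d → ℝ => G (Fin.cons (s - ∑ i, y i) y) :=
    hGm.comp (hshear.comp (measurable_prodMk_left (x := s)))
  have hpos' : MeasurableSet {y : Fin d → ℝ | ∀ i, 0 ≤ hyperplaneChart d y i} :=
    measurable_hyperplaneChart d hpos
  have key (s : ℝ) (hs : 0 < s) :
      ∫⁻ y : Fin d → ℝ, G (Fin.cons (s - ∑ i, y i) y) =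
        ENNReal.ofReal ((s / (d + 1)) ^ d) * ENNReal.ofReal (rexp (-s)) *
          ∫⁻ y in {y | ∀ i, 0 ≤ hyperplaneChart d y i}, h (hyperplaneChart d y) := by
    have hr : 0 < s / (d + 1) := by positivity
    rw [lintegral_comp_smul hr (hslice s), mul_assoc,
      ← lintegral_indicator hpos']
    congr 1
    rw [← lintegral_const_mul' _ _ (by simp)]
    refine lintegral_congr fun y => ?_
    have e1 : (Fin.cons (s - ∑ i, ((s / (d + 1)) • y) i) ((s / (d + 1)) • y) : Fin (d + 1) → ℝ)
        = (s / (d + 1)) • hyperplaneChart d y := by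
      ext i
      refine Fin.cases ?_ (fun i => ?_) i
      · simp [hyperplaneChart, ← Finset.mul_sum]; field_simp
      · simp [hyperplaneChart]
    have e2 : ∑ i, hyperplaneChart d y i = d + 1 := by
      simp [hyperplaneChart, Fin.sum_univ_succ]
    have e3 : normalize ((s / (d + 1)) • hyperplaneChart d y) = hyperplaneChart d y := by
      ext i
      simp only [normalize, Pi.smul_apply, smul_eq_mul, ← Finset.mul_sum, e2, Fintype.card_fin]
      push_cast
      field_simp
    have e4 : ∑ i, ((s / (d + 1)) • hyperplaneChart d y) i = s := by
      simp only [Pi.smul_apply, smul_eq_mul, ← Finset.mul_sum, e2]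
      field_simp
    rw [e1]
    simp only [hG, e3, e4]
    simp only [Set.indicator_apply, Set.mem_ofPred_eq, Pi.smul_apply, smul_eq_mul,
      mul_nonneg_iff_of_pos_left hr]
    split_ifs <;> simp
  have key0 (s : ℝ) (hs : s < 0) : ∫⁻ y : Fin d → ℝ, G (Fin.cons (s - ∑ i, y i) y) = 0 := by
    rw [lintegral_eq_zero_iff (hslice s)]
    refine Eventually.of_forall fun y => ?_
    simp only [hG]
    rw [if_neg]
    · simp
    · intro hy
      have := Finset.sum_nonneg fun i (_ : i ∈ Finset.univ) => hy i
      simp [Fin.sum_univ_succ] at this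
      linarith
  calc _ = ∫⁻ x, G x := by
        rw [lintegral_expPi_fin (f := fun x => h (normalize x)) (hh.comp measurable_normalize)]
        refine lintegral_congr fun x => ?_
        rw [prod_exponentialPDF]
        simp only [hG]
        congr
    _ = ∫⁻ a, ∫⁻ y : Fin d → ℝ, G (Fin.cons a y) := by rw [volume_pi, lintegral_pi_cons _ hGm]; rfl
    _ = ∫⁻ y : Fin d → ℝ, ∫⁻ a, G (Fin.cons a y) :=
        lintegral_lintegral_swap (hGm.comp (measurable_cons d)).aemeasurable
    _ = ∫⁻ y : Fin d → ℝ, ∫⁻ s, G (Fin.cons (s - ∑ i, y i) y) := by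
        refine lintegral_congr fun y => ?_
        exact (lintegral_sub_right_eq_self (fun a => G (Fin.cons a y)) _).symm
    _ = ∫⁻ s, ∫⁻ y : Fin d → ℝ, G (Fin.cons (s - ∑ i, y i) y) :=
        (lintegral_lintegral_swap (f := fun s (y : Fin d → ℝ) => G (Fin.cons (s - ∑ i, y i) y))
          (hGm.comp hshear).aemeasurable).symm
    _ = ∫⁻ s in Set.Ioi (0 : ℝ), ∫⁻ y : Fin d → ℝ, G (Fin.cons (s - ∑ i, y i) y) := by
        rw [← lintegral_indicator measurableSet_Ioi]
        refine lintegral_congr_ae ?_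
        filter_upwards [compl_mem_ae_iff.mpr (measure_singleton (μ := (volume : Measure ℝ)) 0)]
          with s hs
        rcases lt_or_gt_of_ne (show s ≠ 0 from hs) with h0 | h0
        · rw [key0 s h0]; simp [h0.le]
        · simp [h0]
    _ = _ := by
        rw [← lintegral_mul_const]
        · exact setLIntegral_congr_fun measurableSet_Ioi fun s hs => key s hs
        · fun_prop

/-- The set of `y` for which the hyperplane chart lands in the simplex. -/
def chartDomain (d : ℕ) : Set (Fin d → ℝ) := {y | ∀ i, 0 ≤ hyperplaneChart d y i}

/-- The linear part of the hyperplane chart, relabelled along an equivalence. -/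
noncomputable def chartLinear {ι : Type} [Fintype ι] {d : ℕ} (e : ι ≃ Fin (d + 1)) :
    EuclideanSpace ℝ (Fin d) →ₗ[ℝ] EuclideanSpace ℝ ι where
  toFun y := WithLp.toLp 2 fun i => (Fin.cons (-∑ j, y j) (fun j => y j) : Fin (d + 1) → ℝ) (e i)
  map_add' x y := by
    ext i
    simp only [PiLp.add_apply]
    refine Fin.cases ?_ (fun j => ?_) (e i)
    · simp [Finset.sum_add_distrib]; ring
    · simp
  map_smul' c x := by
    ext i
    simp only [PiLp.smul_apply, RingHom.id_apply]
    refine Fin.cases ?_ (fun j => ?_) (e i)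
    · simp [Finset.mul_sum]
    · simp

/-- The hyperplane chart relabelled along an equivalence, with values in Euclidean space. -/
noncomputable def euclideanChart {ι : Type} [Fintype ι] {d : ℕ} (e : ι ≃ Fin (d + 1))
    (y : Fin d → ℝ) : EuclideanSpace ℝ ι :=
  WithLp.toLp 2 fun i => hyperplaneChart d y (e i)

lemma measurable_euclideanChart {ι : Type} [Fintype ι] {d : ℕ} (e : ι ≃ Fin (d + 1)) :
    Measurable (euclideanChart e) := by
  refine (WithLp.measurable_toLp 2 (ι → ℝ)).comp (measurable_pi_lambda _ fun i => ?_)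
  exact (measurable_pi_apply (e i)).comp (measurable_hyperplaneChart d)

lemma euclideanChart_eq_vadd {ι : Type} [Fintype ι] {d : ℕ} (e : ι ≃ Fin (d + 1))
    (y : Fin d → ℝ) :
    euclideanChart e y = euclideanChart e 0 + chartLinear e (WithLp.toLp 2 y) := by
  ext i
  simp only [euclideanChart, chartLinear, hyperplaneChart, LinearMap.coe_mk, AddHom.coe_mk,
    PiLp.add_apply]
  refine Fin.cases ?_ (fun j => ?_) (e i)
  · simp; ring
  · simp

lemma hausdorffMeasure_euclideanChart_image {ι : Type} [Fintype ι] {d : ℕ} (e : ι ≃ Fin (d + 1)) :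
    ∃ c : ENNReal, ∀ s : Set (Fin d → ℝ), MeasurableSet s →
      μH[(d : ℝ)] (euclideanChart e '' s) = c * volume s := by
  obtain ⟨a, hH⟩ : ∃ a : NNReal, (μH[(d : ℝ)] : Measure (EuclideanSpace ℝ (Fin d))) = a • volume :=
    ⟨_, Measure.isAddLeftInvariant_eq_smul _ _⟩
  refine ⟨ENNReal.ofReal (chartLinear e).normDet * a, fun s hs => ?_⟩
  have h1 : euclideanChart e '' s =
      (euclideanChart e 0 +ᵥ ·) '' (chartLinear e '' (WithLp.toLp 2 '' s)) := by
    simp only [Set.image_image, vadd_eq_add]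
    exact Set.image_congr fun y _ => euclideanChart_eq_vadd e y
  have h2 := LinearMap.hausdorffMeasure_image (chartLinear e) (WithLp.toLp 2 '' s)
  rw [finrank_euclideanSpace_fin] at h2
  have h3 : volume (WithLp.toLp 2 '' s : Set (EuclideanSpace ℝ (Fin d))) = volume s := by
    have := (PiLp.volume_preserving_ofLp (Fin d)).measure_preimage hs.nullMeasurableSet
    rw [← this]
    congr 1
    ext x
    constructor
    · rintro ⟨y, hy, rfl⟩; exact hy
    · intro hx; exact ⟨x.ofLp, hx, rfl⟩
  rw [h1, (isometry_vadd _ (euclideanChart e 0)).hausdorffMeasure_image (Or.inl (by positivity)),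
    h2, hH, Measure.smul_apply, h3, mul_assoc]
  simp [ENNReal.smul_def]

lemma image_euclideanChart_inter {ι : Type} [Fintype ι] {d : ℕ} (e : ι ≃ Fin (d + 1))
    (s : Set (EuclideanSpace ℝ ι)) :
    euclideanChart e '' (euclideanChart e ⁻¹' s ∩ chartDomain d) = s ∩ simplexEq ι := by
  have hcard : Fintype.card ι = d + 1 := by simpa using Fintype.card_congr e
  ext x
  constructor
  · rintro ⟨y, ⟨hy, hy'⟩, rfl⟩
    refine ⟨hy, fun i => hy' (e i), ?_⟩
    simp only [euclideanChart]
    rw [e.sum_comp (hyperplaneChart d y), hcard]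
    simp [hyperplaneChart, Fin.sum_univ_succ]
  · rintro ⟨hx, hx0, hxs⟩
    have : euclideanChart e (fun j => x (e.symm j.succ)) = x := by
      ext i
      obtain ⟨j, rfl⟩ := e.symm.surjective i
      rw [← e.symm.sum_comp, Fin.sum_univ_succ, hcard] at hxs
      simp only [euclideanChart, Equiv.apply_symm_apply, hyperplaneChart]
      refine Fin.cases ?_ (fun j => ?_) j
      · simp only [Fin.cons_zero]
        push_cast at hxs
        linarith
      · simp
    refine ⟨_, ⟨?_, ?_⟩, this⟩
    · rw [Set.mem_preimage, this]; exact hx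
    · intro i
      have h := congrArg (fun z : EuclideanSpace ℝ ι => z (e.symm i)) this
      simp only [euclideanChart, Equiv.apply_symm_apply] at h
      rw [h]; exact hx0 _

lemma simplexEqUniform_eq_smul {ι : Type} [Fintype ι] {d : ℕ} (e : ι ≃ Fin (d + 1)) :
    ∃ c : ENNReal, simplexEqUniform ι =
      c • (volume.restrict (chartDomain d)).map (euclideanChart e) := by
  have hcard : Fintype.card ι - 1 = d := by simp [Fintype.card_congr e]
  obtain ⟨c, hc⟩ := hausdorffMeasure_euclideanChart_image e
  refine ⟨(μH[(d : ℝ)] (simplexEq ι))⁻¹ * c, ?_⟩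
  have hdom : MeasurableSet (chartDomain d) := by
    unfold chartDomain
    simp only [Set.ofPred_forall]
    exact MeasurableSet.iInter fun i => measurableSet_le measurable_const
      ((measurable_pi_apply i).comp (measurable_hyperplaneChart d))
  rw [simplexEqUniform, hcard, mul_smul]
  congr 1
  ext s hs
  rw [Measure.restrict_apply hs, Measure.smul_apply,
    Measure.map_apply (measurable_euclideanChart e) hs,
    Measure.restrict_apply (measurable_euclideanChart e hs), smul_eq_mul,
    ← hc _ ((measurable_euclideanChart e hs).inter hdom), image_euclideanChart_inter]

lemma measurePreserving_expPi_relabel {ι κ : Type} [Fintype ι] [Fintype κ] (e : ι ≃ κ) :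
    MeasurePreserving (fun (x : κ → ℝ) i => x (e i)) (expPi κ) (expPi ι) := by
  have h := measurePreserving_piCongrLeft (fun _ : ι => expMeasure 1) e.symm
  unfold expPi
  convert h using 1
  ext x i
  obtain ⟨j, rfl⟩ := e.symm.surjective i
  rw [MeasurableEquiv.coe_piCongrLeft, Equiv.piCongrLeft_apply_apply]
  simp

lemma map_normalize_eq_smul {ι : Type} [Fintype ι] {d : ℕ} (e : ι ≃ Fin (d + 1)) :
    ∃ c : ENNReal, (expPi ι).map (fun x => WithLp.toLp 2 (normalize x)) =
      c • (volume.restrict (chartDomain d)).map (euclideanChart e) := by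
  obtain ⟨c, hc⟩ := lintegral_normalize_expPi d
  refine ⟨c, ?_⟩
  have hrel : Measurable fun (x : Fin (d + 1) → ℝ) => (WithLp.toLp 2 fun i => x (e i) :
      EuclideanSpace ℝ ι) := by
    fun_prop
  have hn : Measurable fun x : ι → ℝ => (WithLp.toLp 2 (normalize x) : EuclideanSpace ℝ ι) :=
    (WithLp.measurable_toLp 2 (ι → ℝ)).comp measurable_normalize
  have hcomm (x : Fin (d + 1) → ℝ) :
      normalize (fun i => x (e i)) = fun i => normalize x (e i) := by
    funext i
    simp only [normalize, e.sum_comp x, Fintype.card_congr e]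
  refine Measure.ext_of_lintegral _ fun f hf => ?_
  have h1 := hc (fun x => f (WithLp.toLp 2 fun i => x (e i))) (hf.comp hrel)
  rw [lintegral_map hf hn, ← (measurePreserving_expPi_relabel e).lintegral_comp
    (f := fun x => f (WithLp.toLp 2 (normalize x))) (hf.comp hn)]
  simp only [hcomm]
  rw [h1, lintegral_smul_measure, lintegral_map hf (measurable_euclideanChart e)]
  rfl

/-- The uniform law on the simplex is the law of normalized independent exponential variables. -/
theorem simplexEqUniform_eq_map_normalize {ι : Type} [Fintype ι] [Nonempty ι]
    (h : IsProbabilityMeasure (simplexEqUniform ι)) :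
    simplexEqUniform ι = (expPi ι).map (fun x => WithLp.toLp 2 (normalize x)) := by
  obtain ⟨d, hd⟩ := Nat.exists_eq_succ_of_ne_zero (Fintype.card_ne_zero (α := ι))
  let e : ι ≃ Fin (d + 1) := Fintype.equivFinOfCardEq hd
  have hn : Measurable fun x : ι → ℝ => (WithLp.toLp 2 (normalize x) : EuclideanSpace ℝ ι) :=
    (WithLp.measurable_toLp 2 (ι → ℝ)).comp measurable_normalize
  obtain ⟨a, ha⟩ := simplexEqUniform_eq_smul e
  obtain ⟨b, hb⟩ := map_normalize_eq_smul e
  have ha1 : a * (volume.restrict (chartDomain d)).map (euclideanChart e) Set.univ = 1 := by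
    rw [← smul_eq_mul, ← Measure.smul_apply, ← ha, measure_univ]
  have hb1 : b * (volume.restrict (chartDomain d)).map (euclideanChart e) Set.univ = 1 := by
    have := Measure.isProbabilityMeasure_map (μ := expPi ι) hn.aemeasurable
    rw [← smul_eq_mul, ← Measure.smul_apply, ← hb, measure_univ]
  have hab : a = b := by
    rw [ENNReal.eq_inv_of_mul_eq_one_left ha1, ENNReal.eq_inv_of_mul_eq_one_left hb1]
  rw [ha, hb, hab]

lemma lintegral_exp_mul_expMeasure {t : ℝ} (ht : t < 1) :
    ∫⁻ x, ENNReal.ofReal (rexp (t * x)) ∂(expMeasure 1) = ENNReal.ofReal (1 - t)⁻¹ := by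
  rw [lintegral_expMeasure (by fun_prop)]
  have h : ∀ x, exponentialPDF 1 x * ENNReal.ofReal (rexp (t * x)) =
      ENNReal.ofReal (1 - t)⁻¹ * exponentialPDF (1 - t) x := fun x => by
    rcases lt_or_ge x 0 with hx | hx
    · simp [exponentialPDF_of_neg hx]
    · have h1 : 0 < 1 - t := by linarith
      rw [exponentialPDF_of_nonneg hx, exponentialPDF_of_nonneg hx,
        ← ENNReal.ofReal_mul (by positivity), ← ENNReal.ofReal_mul (by positivity)]
      congr 1
      rw [one_mul, ← Real.exp_add, ← mul_assoc, inv_mul_cancel₀ h1.ne', one_mul]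
      ring_nf
  simp_rw [h]
  rw [lintegral_const_mul' _ _ (by simp), lintegral_exponentialPDF_eq_one (by linarith), mul_one]

lemma integrable_exp_mul_expMeasure {t : ℝ} (ht : t < 1) :
    Integrable (fun x => rexp (t * x)) (expMeasure 1) := by
  refine ⟨by fun_prop, ?_⟩
  rw [hasFiniteIntegral_iff_ofReal (Eventually.of_forall fun x => (Real.exp_pos _).le),
    lintegral_exp_mul_expMeasure ht]
  exact ENNReal.ofReal_lt_top

lemma integral_exp_mul_expMeasure {t : ℝ} (ht : t < 1) :
    ∫ x, rexp (t * x) ∂(expMeasure 1) = (1 - t)⁻¹ := by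
  rw [integral_eq_lintegral_of_nonneg_ae (Eventually.of_forall fun x => (Real.exp_pos _).le)
    (by fun_prop), lintegral_exp_mul_expMeasure ht, ENNReal.toReal_ofReal]
  simp; linarith

lemma ae_nonneg_expMeasure : ∀ᵐ x ∂(expMeasure 1), 0 ≤ x := by
  rw [ae_iff]
  have h : {x : ℝ | ¬ 0 ≤ x} = Set.Iio 0 := by ext x; simp
  rw [h]
  change (volume.withDensity (exponentialPDF 1)) (Set.Iio 0) = 0
  rw [withDensity_apply _ measurableSet_Iio]
  exact lintegral_exponentialPDF_of_nonpos le_rfl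

lemma lintegral_pow_expMeasure (k : ℕ) :
    ∫⁻ x, ENNReal.ofReal (x ^ k) ∂(expMeasure 1) = ENNReal.ofReal (k.factorial) := by
  rw [lintegral_expMeasure (by fun_prop)]
  have h : ∀ x, exponentialPDF 1 x * ENNReal.ofReal (x ^ k) =
      ENNReal.ofReal k.factorial * gammaPDF (k + 1) 1 x := fun x => by
    rcases lt_or_ge x 0 with hx | hx
    · simp [exponentialPDF_of_neg hx, gammaPDF_of_neg hx]
    · rw [exponentialPDF_of_nonneg hx, gammaPDF_of_nonneg hx,
        ← ENNReal.ofReal_mul (by positivity), ← ENNReal.ofReal_mul (by positivity)]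
      congr 1
      rw [Real.Gamma_nat_eq_factorial]
      have : (k.factorial : ℝ) ≠ 0 := by positivity
      simp
      field_simp
  simp_rw [h]
  rw [lintegral_const_mul' _ _ (by simp), lintegral_gammaPDF_eq_one (by positivity) one_pos, mul_one]

lemma integrable_pow_expMeasure (k : ℕ) : Integrable (fun x : ℝ => x ^ k) (expMeasure 1) := by
  refine ⟨by fun_prop, ?_⟩
  rw [hasFiniteIntegral_iff_ofReal (ae_nonneg_expMeasure.mono fun x hx => pow_nonneg hx k),
    lintegral_pow_expMeasure]
  exact ENNReal.ofReal_lt_top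

lemma integral_pow_expMeasure (k : ℕ) : ∫ x, x ^ k ∂(expMeasure 1) = k.factorial := by
  rw [integral_eq_lintegral_of_nonneg_ae (ae_nonneg_expMeasure.mono fun x hx => pow_nonneg hx k)
    (by fun_prop), lintegral_pow_expMeasure, ENNReal.toReal_ofReal (by positivity)]

lemma integrable_id_expMeasure : Integrable (fun x : ℝ => x) (expMeasure 1) := by
  simpa using integrable_pow_expMeasure 1

lemma integral_id_expMeasure : ∫ x, x ∂(expMeasure 1) = 1 := by
  simpa using integral_pow_expMeasure 1

lemma integral_sub_one_expMeasure : ∫ x, (x - 1) ∂(expMeasure 1) = 0 := by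
  rw [integral_sub integrable_id_expMeasure (integrable_const _), integral_id_expMeasure]
  simp

lemma integral_sub_one_sq_expMeasure : ∫ x, (x - 1) ^ 2 ∂(expMeasure 1) = 1 := by
  have h : ∀ x : ℝ, (x - 1) ^ 2 = x ^ 2 - 2 * x + 1 := fun x => by ring
  simp_rw [h]
  have h2 : Integrable (fun x : ℝ => x ^ 2 - 2 * x) (expMeasure 1) :=
    (integrable_pow_expMeasure 2).sub (integrable_id_expMeasure.const_mul 2)
  rw [integral_add h2 (integrable_const _), integral_sub (integrable_pow_expMeasure 2)
    (integrable_id_expMeasure.const_mul 2), integral_const_mul, integral_id_expMeasure,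
    integral_pow_expMeasure]
  norm_num

lemma inv_one_sub_sq_le_exp {a : ℝ} (h0 : 0 ≤ a) (h : a ≤ 1 / 2) :
    (1 - a)⁻¹ * (1 + a)⁻¹ ≤ rexp (2 * a ^ 2) := by
  have h1 : 0 < (1 - a) * (1 + a) := by nlinarith
  rw [← mul_inv, inv_le_iff_one_le_mul₀ h1]
  have h2 := Real.add_one_le_exp (2 * a ^ 2)
  have h3 : a ^ 2 ≤ 1 / 4 := by nlinarith
  nlinarith [sq_nonneg a, mul_nonneg (sq_nonneg a) (sub_nonneg.2 h3)]

/-- Laplace transform bound for a Lipschitz function of one exponential variable. -/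
lemma integral_exp_lipschitz_expMeasure {g : ℝ → ℝ} {c l : ℝ} (hc : 0 ≤ c) (hl : 0 ≤ l)
    (hlc : l * c ≤ 1 / 2) (hg : ∀ x y, |g x - g y| ≤ c * |x - y|) :
    Integrable (fun x => rexp (l * g x)) (expMeasure 1) ∧
      ∫ x, rexp (l * g x) ∂(expMeasure 1) ≤
        rexp (l * ∫ x, g x ∂(expMeasure 1) + 2 * (l * c) ^ 2) := by
  set μ := expMeasure 1 with hμ
  have hcont : Continuous g := by
    have : LipschitzWith c.toNNReal g := LipschitzWith.of_dist_le_mul fun x y => by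
      rw [Real.dist_eq, Real.dist_eq, Real.coe_toNNReal _ hc]; exact hg x y
    exact this.continuous
  have hgi : Integrable g μ := by
    refine ((integrable_const |g 0|).add (integrable_id_expMeasure.abs.const_mul c)).mono'
      hcont.aestronglyMeasurable (Eventually.of_forall fun x => ?_)
    have := hg x 0
    rw [sub_zero] at this
    have h2 := abs_sub_abs_le_abs_sub (g x) (g 0)
    simp only [Real.norm_eq_abs, Pi.add_apply]
    linarith
  have hexp : ∀ s : ℝ, |s| ≤ l → Integrable (fun x => rexp (s * g x)) μ := fun s hs => by
    refine ((integrable_exp_mul_expMeasure (t := l * c) (by linarith)).const_mul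
      (rexp (l * |g 0|))).mono' (by fun_prop) ?_
    filter_upwards [ae_nonneg_expMeasure] with x hx
    rw [Real.norm_eq_abs, abs_of_pos (Real.exp_pos _), ← Real.exp_add]
    refine Real.exp_le_exp.2 ?_
    have := hg x 0
    rw [sub_zero, abs_of_nonneg hx] at this
    have h2 := abs_sub_abs_le_abs_sub (g x) (g 0)
    calc s * g x ≤ |s * g x| := le_abs_self _
      _ = |s| * |g x| := abs_mul _ _
      _ ≤ l * (|g 0| + c * x) := by gcongr; linarith
      _ = _ := by ring
  have hpos := hexp l (by rw [abs_of_nonneg hl])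
  refine ⟨hpos, ?_⟩
  have hneg := hexp (-l) (by rw [abs_neg, abs_of_nonneg hl])
  have hjensen : rexp (-l * ∫ x, g x ∂μ) ≤ ∫ x, rexp (-l * g x) ∂μ := by
    rw [← integral_const_mul]
    exact convexOn_exp.map_integral_le continuous_exp.continuousOn isClosed_univ
      (Eventually.of_forall fun _ => Set.mem_univ _) (hgi.const_mul _) hneg
  set a := l * c with ha
  have ha0 : 0 ≤ a := mul_nonneg hl hc
  have hprod : (∫ x, rexp (l * g x) ∂μ) * ∫ x, rexp (-l * g x) ∂μ ≤ (1 - a)⁻¹ * (1 + a)⁻¹ := by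
    have e1 := integral_prod_mul (μ := μ) (ν := μ) (fun x => rexp (l * g x))
      (fun x => rexp (-l * g x))
    have e2 := integral_prod_mul (μ := μ) (ν := μ) (fun x => rexp (-l * g x))
      (fun x => rexp (l * g x))
    have e3 := integral_prod_mul (μ := μ) (ν := μ) (fun x => rexp (a * x)) (fun x => rexp (-a * x))
    have e4 := integral_prod_mul (μ := μ) (ν := μ) (fun x => rexp (-a * x)) (fun x => rexp (a * x))
    have i1 := hpos.mul_prod hneg
    have i2 := hneg.mul_prod hpos
    have ja := integrable_exp_mul_expMeasure (t := a) (by linarith)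
    have jb := integrable_exp_mul_expMeasure (t := -a) (by linarith)
    have i3 := ja.mul_prod jb
    have i4 := jb.mul_prod ja
    have hle : ∫ z, (rexp (l * g z.1) * rexp (-l * g z.2) + rexp (-l * g z.1) * rexp (l * g z.2))
          ∂(μ.prod μ) ≤
        ∫ z, (rexp (a * z.1) * rexp (-a * z.2) + rexp (-a * z.1) * rexp (a * z.2))
          ∂(μ.prod μ) := by
      refine integral_mono (i1.add i2) (i3.add i4) fun z => ?_
      simp only [← Real.exp_add]
      have k1 : rexp (l * g z.1 + -l * g z.2) + rexp (-l * g z.1 + l * g z.2) =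
          2 * Real.cosh (l * (g z.1 - g z.2)) := by
        rw [Real.cosh_eq]; ring_nf
      have k2 : rexp (a * z.1 + -a * z.2) + rexp (-a * z.1 + a * z.2) =
          2 * Real.cosh (a * (z.1 - z.2)) := by
        rw [Real.cosh_eq]; ring_nf
      rw [k1, k2]
      have : Real.cosh (l * (g z.1 - g z.2)) ≤ Real.cosh (a * (z.1 - z.2)) := by
        rw [Real.cosh_le_cosh, abs_mul, abs_mul, abs_of_nonneg hl, abs_of_nonneg ha0, ha, mul_assoc]
        exact mul_le_mul_of_nonneg_left (hg _ _) hl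
      linarith
    rw [integral_add i1 i2, integral_add i3 i4, e1, e2, e3, e4,
      integral_exp_mul_expMeasure (by linarith), integral_exp_mul_expMeasure (by linarith)] at hle
    have : 1 - -a = 1 + a := by ring
    rw [this] at hle
    linarith [mul_comm (∫ x, rexp (l * g x) ∂μ) (∫ x, rexp (-l * g x) ∂μ),
      mul_comm (1 - a)⁻¹ (1 + a)⁻¹]
  have hI0 : 0 ≤ ∫ x, rexp (l * g x) ∂μ := integral_nonneg fun x => (Real.exp_pos _).le
  have hfin : (∫ x, rexp (l * g x) ∂μ) * rexp (-l * ∫ x, g x ∂μ) ≤ rexp (2 * a ^ 2) :=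
    (mul_le_mul_of_nonneg_left hjensen hI0).trans
      (hprod.trans (inv_one_sub_sq_le_exp ha0 hlc))
  calc ∫ x, rexp (l * g x) ∂μ
      = (∫ x, rexp (l * g x) ∂μ) * rexp (-l * ∫ x, g x ∂μ) * rexp (l * ∫ x, g x ∂μ) := by
        rw [mul_assoc, ← Real.exp_add]; simp
    _ ≤ rexp (2 * a ^ 2) * rexp (l * ∫ x, g x ∂μ) := by gcongr
    _ = _ := by rw [← Real.exp_add, add_comm]

lemma integral_comp_of_measurePreserving {α β : Type*} [MeasurableSpace α] [MeasurableSpace β]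
    {μ : Measure α} {ν : Measure β} {T : α → β} (h : MeasurePreserving T μ ν) {g : β → ℝ}
    (hg : AEStronglyMeasurable g ν) : ∫ y, g y ∂ν = ∫ x, g (T x) ∂μ := by
  rw [← h.map_eq] at hg ⊢
  exact integral_map h.measurable.aemeasurable hg

/-- `F` is Lipschitz in the weighted `ℓ¹` distance with weights `c`. -/
def WeightedLipschitz {ι : Type} [Fintype ι] (c : ι → ℝ) (F : (ι → ℝ) → ℝ) : Prop :=
  ∀ x y, |F x - F y| ≤ ∑ i, c i * |x i - y i|

lemma WeightedLipschitz.continuous {ι : Type} [Fintype ι] {c : ι → ℝ} {F : (ι → ℝ) → ℝ}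
    (hF : WeightedLipschitz c F) : Continuous F := by
  rw [continuous_iff_continuousAt]
  intro x
  rw [ContinuousAt, tendsto_iff_dist_tendsto_zero]
  have h : Tendsto (fun y : ι → ℝ => ∑ i, c i * |y i - x i|) (nhds x)
      (nhds (∑ i, c i * |x i - x i|)) := by
    apply Continuous.tendsto
    fun_prop
  simp only [sub_self, abs_zero, mul_zero, Finset.sum_const_zero] at h
  exact squeeze_zero (fun _ => dist_nonneg) (fun y => by rw [Real.dist_eq]; exact hF y x) h

lemma integral_comp_eval_expPi {ι : Type} [Fintype ι] (i : ι) {g : ℝ → ℝ} (hg : Measurable g) :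
    ∫ x, g (x i) ∂(expPi ι) = ∫ x, g x ∂(expMeasure 1) :=
  (integral_comp_of_measurePreserving (measurePreserving_eval (fun _ : ι => expMeasure 1) i)
    hg.aestronglyMeasurable).symm

lemma integrable_comp_eval_expPi {ι : Type} [Fintype ι] (i : ι) {g : ℝ → ℝ}
    (hg : Integrable g (expMeasure 1)) : Integrable (fun x => g (x i)) (expPi ι) :=
  (measurePreserving_eval (fun _ : ι => expMeasure 1) i).integrable_comp_of_integrable hg

lemma WeightedLipschitz.integrable {ι : Type} [Fintype ι] {c : ι → ℝ} {F : (ι → ℝ) → ℝ}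
    (hF : WeightedLipschitz c F) : Integrable F (expPi ι) := by
  have h : Integrable (fun x : ι → ℝ => |F 0| + ∑ i, c i * |x i|) (expPi ι) :=
    (integrable_const _).add (integrable_finsetSum _ fun i _ =>
      (integrable_comp_eval_expPi i integrable_id_expMeasure).abs.const_mul _)
  refine h.mono' hF.continuous.aestronglyMeasurable (Eventually.of_forall fun x => ?_)
  have h1 := hF x 0
  simp only [Pi.zero_apply, sub_zero] at h1
  have h2 := abs_sub_abs_le_abs_sub (F x) (F 0)
  rw [Real.norm_eq_abs]
  linarith

lemma WeightedLipschitz.neg {ι : Type} [Fintype ι] {c : ι → ℝ} {F : (ι → ℝ) → ℝ}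
    (hF : WeightedLipschitz c F) : WeightedLipschitz c (fun x => -F x) := fun x y => by
  rw [neg_sub_neg, abs_sub_comm]; exact hF x y

lemma WeightedLipschitz.lintegral_exp_fin_le {n : ℕ} {c : Fin n → ℝ} {F : (Fin n → ℝ) → ℝ}
    (hF : WeightedLipschitz c F) (hc : ∀ i, 0 ≤ c i) {l : ℝ} (hl : 0 ≤ l)
    (hlc : ∀ i, l * c i ≤ 1 / 2) :
    ∫⁻ x, ENNReal.ofReal (rexp (l * F x)) ∂(expPi (Fin n)) ≤
      ENNReal.ofReal (rexp (l * ∫ x, F x ∂(expPi (Fin n)) + 2 * l ^ 2 * ∑ i, c i ^ 2)) := by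
  induction n with
  | zero =>
    have h : F = fun _ => F 0 := by funext x; rw [Subsingleton.elim x 0]
    rw [h]
    simp
  | succ n ih =>
    have hlip : ∀ a, WeightedLipschitz (fun i => c i.succ) (fun y => F (Fin.cons a y)) :=
      fun a x y => by
        have := hF (Fin.cons a x) (Fin.cons a y)
        rw [Fin.sum_univ_succ] at this
        simpa using this
    have hmp := measurePreserving_cons (expMeasure 1) n
    have hinteg : ∫ x, F x ∂(expPi (Fin (n + 1))) =
        ∫ a, ∫ y, F (Fin.cons a y) ∂(expPi (Fin n)) ∂(expMeasure 1) := by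
      have h1 := integral_comp_of_measurePreserving hmp hF.continuous.aestronglyMeasurable
      have h2 : Integrable (fun p : ℝ × (Fin n → ℝ) => F (Fin.cons p.1 p.2))
          ((expMeasure 1).prod (Measure.pi fun _ => expMeasure 1)) :=
        hmp.integrable_comp_of_integrable hF.integrable
      rw [integral_prod _ h2] at h1
      exact h1
    set G : ℝ → ℝ := fun a => ∫ y, F (Fin.cons a y) ∂(expPi (Fin n)) with hG
    have hGlip : ∀ a b, |G a - G b| ≤ c 0 * |a - b| := fun a b => by
      rw [hG]
      simp only
      rw [← integral_sub (hlip a).integrable (hlip b).integrable]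
      refine (abs_integral_le_integral_abs).trans ?_
      refine (integral_mono_of_nonneg (Eventually.of_forall fun _ => abs_nonneg _)
        (integrable_const (c 0 * |a - b|)) (Eventually.of_forall fun y => ?_)).trans (by simp)
      have := hF (Fin.cons a y) (Fin.cons b y)
      rw [Fin.sum_univ_succ] at this
      simpa using this
    obtain ⟨hGi, hGe⟩ := integral_exp_lipschitz_expMeasure (hc 0) hl (hlc 0) hGlip
    have hFc := hF.continuous
    rw [hinteg, expPi, lintegral_pi_cons _ (by fun_prop), ← expPi]
    calc ∫⁻ a, ∫⁻ y, ENNReal.ofReal (rexp (l * F (Fin.cons a y)))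
          ∂(expPi (Fin n)) ∂(expMeasure 1)
        ≤ ∫⁻ a, ENNReal.ofReal (rexp (l * G a)) *
            ENNReal.ofReal (rexp (2 * l ^ 2 * ∑ i : Fin n, c i.succ ^ 2)) ∂(expMeasure 1) := by
          refine lintegral_mono fun a => ?_
          refine (ih (hlip a) (fun i => hc _) (fun i => hlc _)).trans ?_
          rw [← ENNReal.ofReal_mul (Real.exp_pos _).le, ← Real.exp_add]
      _ = ENNReal.ofReal (∫ a, rexp (l * G a) ∂(expMeasure 1)) *
            ENNReal.ofReal (rexp (2 * l ^ 2 * ∑ i : Fin n, c i.succ ^ 2)) := by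
          rw [lintegral_mul_const' _ _ (by simp), ofReal_integral_eq_lintegral_ofReal hGi
            (Eventually.of_forall fun _ => (Real.exp_pos _).le)]
      _ ≤ ENNReal.ofReal (rexp (l * ∫ x, G x ∂(expMeasure 1) + 2 * (l * c 0) ^ 2)) *
            ENNReal.ofReal (rexp (2 * l ^ 2 * ∑ i : Fin n, c i.succ ^ 2)) := by gcongr
      _ = _ := by
          rw [← ENNReal.ofReal_mul (Real.exp_pos _).le, ← Real.exp_add, Fin.sum_univ_succ]
          congr 2
          ring

lemma WeightedLipschitz.lintegral_exp_le {ι : Type} [Fintype ι] {c : ι → ℝ} {F : (ι → ℝ) → ℝ}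
    (hF : WeightedLipschitz c F) (hc : ∀ i, 0 ≤ c i) {l : ℝ} (hl : 0 ≤ l)
    (hlc : ∀ i, l * c i ≤ 1 / 2) :
    ∫⁻ x, ENNReal.ofReal (rexp (l * F x)) ∂(expPi ι) ≤
      ENNReal.ofReal (rexp (l * ∫ x, F x ∂(expPi ι) + 2 * l ^ 2 * ∑ i, c i ^ 2)) := by
  set e := Fintype.equivFin ι
  have hmp := measurePreserving_expPi_relabel e
  have hlip : WeightedLipschitz (fun i => c (e.symm i)) (fun x => F (fun i => x (e i))) :=
    fun x y => by
      refine (hF _ _).trans_eq ?_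
      rw [← e.sum_comp]
      simp
  have h := hlip.lintegral_exp_fin_le (fun i => hc _) hl (fun i => hlc _)
  have hFc := hF.continuous
  have h1 := hmp.lintegral_comp (f := fun x => ENNReal.ofReal (rexp (l * F x))) (by fun_prop)
  have h2 := integral_comp_of_measurePreserving hmp hFc.aestronglyMeasurable
  rw [h1, ← h2, e.symm.sum_comp (fun i => c i ^ 2)] at h
  exact h

lemma WeightedLipschitz.measure_ge_le {ι : Type} [Fintype ι] {c : ι → ℝ} {F : (ι → ℝ) → ℝ}
    (hF : WeightedLipschitz c F) (hc : ∀ i, 0 ≤ c i) {l : ℝ} (hl : 0 < l)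
    (hlc : ∀ i, l * c i ≤ 1 / 2) (ε : ℝ) :
    expPi ι {x | ε ≤ F x - ∫ x, F x ∂(expPi ι)} ≤
      ENNReal.ofReal (rexp (2 * l ^ 2 * ∑ i, c i ^ 2 - l * ε)) := by
  set m := ∫ x, F x ∂(expPi ι)
  have hFc := hF.continuous
  have h := hF.lintegral_exp_le hc hl.le hlc
  have h1 := mul_meas_ge_le_lintegral (μ := expPi ι)
    (f := fun x => ENNReal.ofReal (rexp (l * F x))) (by fun_prop)
    (ENNReal.ofReal (rexp (l * (m + ε))))
  have hset : {x | ε ≤ F x - m} ⊆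
      {x | ENNReal.ofReal (rexp (l * (m + ε))) ≤ ENNReal.ofReal (rexp (l * F x))} := fun x hx => by
    have hx' : ε ≤ F x - m := hx
    refine ENNReal.ofReal_le_ofReal (Real.exp_le_exp.2 (mul_le_mul_of_nonneg_left ?_ hl.le))
    linarith
  have h2 := (mul_le_mul_right (measure_mono (μ := expPi ι) hset)
    (ENNReal.ofReal (rexp (l * (m + ε))))).trans (h1.trans h)
  have hne : ENNReal.ofReal (rexp (l * (m + ε))) ≠ 0 := by
    rw [Ne, ENNReal.ofReal_eq_zero, not_le]; exact Real.exp_pos _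
  rw [ENNReal.mul_le_iff_le_inv hne ENNReal.ofReal_ne_top] at h2
  refine h2.trans_eq ?_
  rw [← ENNReal.ofReal_inv_of_pos (Real.exp_pos _), ← ENNReal.ofReal_mul (by positivity),
    ← Real.exp_neg, ← Real.exp_add]
  congr 2
  ring

/-- Two-sided concentration of a weighted-Lipschitz function of i.i.d. exponential variables. -/
lemma WeightedLipschitz.measure_abs_ge_le {ι : Type} [Fintype ι] {c : ι → ℝ}
    {F : (ι → ℝ) → ℝ} (hF : WeightedLipschitz c F) (hc : ∀ i, 0 ≤ c i) {l : ℝ} (hl : 0 < l)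
    (hlc : ∀ i, l * c i ≤ 1 / 2) (ε : ℝ) :
    expPi ι {x | ε ≤ |F x - ∫ x, F x ∂(expPi ι)|} ≤
      2 * ENNReal.ofReal (rexp (2 * l ^ 2 * ∑ i, c i ^ 2 - l * ε)) := by
  have h1 := hF.measure_ge_le hc hl hlc ε
  have h2 := hF.neg.measure_ge_le hc hl hlc ε
  refine (measure_mono ?_).trans ((measure_union_le _ _).trans
    ((add_le_add h1 h2).trans_eq (two_mul _).symm))
  intro x hx
  rcases le_abs.1 (show ε ≤ |F x - ∫ x, F x ∂(expPi ι)| from hx) with h | h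
  · exact Or.inl h
  · refine Or.inr ?_
    change ε ≤ -F x - ∫ x, -F x ∂(expPi ι)
    rw [integral_neg]
    linarith

/-- The number of `m`-subsets of `{0,…,n-1}` having `i` elements below `k`. -/
noncomputable def hyperCount (n m k i : ℕ) : ℝ :=
  if i ≤ m then (k.choose i * (n - k).choose (m - i) : ℕ) else 0

lemma hyperCount_nonneg (n m k i : ℕ) : 0 ≤ hyperCount n m k i := by
  unfold hyperCount; split_ifs <;> positivity

lemma choose_succ_mul_cast (a j : ℕ) :
    (a.choose (j + 1) : ℝ) * (j + 1) = a.choose j * (a - j) := by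
  rcases le_or_gt j a with h | h
  · have := Nat.choose_succ_right_eq a j
    have h2 : ((a.choose (j + 1) * (j + 1) : ℕ) : ℝ) = (a.choose j * (a - j) : ℕ) := by rw [this]
    push_cast [Nat.cast_sub h] at h2
    exact h2
  · rw [Nat.choose_eq_zero_of_lt h, Nat.choose_eq_zero_of_lt (by omega)]; simp

lemma hyperCount_succ {n m k : ℕ} (hk : k ≤ n) (i : ℕ) :
    hyperCount n m k (i + 1) * ((i + 1) * (n - k - m + i + 1)) =
      hyperCount n m k i * ((k - i) * (m - i)) := by
  unfold hyperCount
  rcases lt_trichotomy i m with h | h | h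
  · rw [if_pos (by omega), if_pos h.le]
    obtain ⟨j, rfl⟩ : ∃ j, m = i + 1 + j := ⟨m - (i + 1), by omega⟩
    have h1 := choose_succ_mul_cast k i
    have h2 := choose_succ_mul_cast (n - k) j
    rw [Nat.cast_sub hk] at h2
    have e1 : i + 1 + j - (i + 1) = j := by omega
    have e2 : i + 1 + j - i = j + 1 := by omega
    rw [e1, e2]
    push_cast
    linear_combination ((n - k).choose j * ((n : ℝ) - k - j)) * h1 - k.choose i * ((k : ℝ) - i) * h2
  · subst h; simp
  · rw [if_neg (by omega), if_neg (by omega)]; simp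

lemma sum_hyperCount {n m k : ℕ} (hk : k ≤ n) :
    ∑ i ∈ Finset.range (m + 1), hyperCount n m k i = n.choose m := by
  have h := Nat.add_choose_eq k (n - k) m
  rw [Nat.add_sub_cancel' hk, Finset.Nat.sum_antidiagonal_eq_sum_range_succ
    (fun i j => k.choose i * (n - k).choose j)] at h
  rw [h]
  push_cast
  refine Finset.sum_congr rfl fun i hi => ?_
  rw [hyperCount, if_pos (by simpa [Nat.lt_succ_iff] using hi)]
  push_cast; rfl

lemma sum_Ico_hyperCount_le {n m k : ℕ} (hk : k ≤ n) (a b : ℕ) :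
    ∑ i ∈ Finset.Ico a b, hyperCount n m k i ≤ n.choose m := by
  rw [← sum_hyperCount hk]
  rw [← Finset.sum_subset (Finset.filter_subset (· ≤ m) (Finset.Ico a b))]
  · refine Finset.sum_le_sum_of_subset_of_nonneg (fun i hi => ?_)
      fun i _ _ => hyperCount_nonneg n m k i
    simpa [Nat.lt_succ_iff] using (Finset.mem_filter.1 hi).2
  · intro i hi hi2
    rw [hyperCount, if_neg fun h => hi2 (Finset.mem_filter.2 ⟨hi, h⟩)]

/-- A hypergeometric distribution has no atom of mass larger than `2 / t`, where `t ^ 2` is at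
most its variance proxy. -/
lemma hyperCount_mul_le {n m k t : ℕ} (hk : k ≤ n) (hm : m ≤ n)
    (ht : (t : ℝ) ^ 2 * (n + 2) ^ 3 ≤ (k + 1) * (m + 1) * (n + 1 - k) * (n + 1 - m)) (i : ℕ) :
    hyperCount n m k i * t ≤ 2 * n.choose m := by
  obtain ⟨j, hj, hmax⟩ := Finset.exists_max_image (Finset.range (m + 1)) (hyperCount n m k)
    ⟨0, by simp⟩
  have hmax' : ∀ i, hyperCount n m k i ≤ hyperCount n m k j := fun i => by
    by_cases hi : i ≤ m
    · exact hmax i (by simpa [Nat.lt_succ_iff] using hi)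
    · refine le_of_eq_of_le ?_ (hyperCount_nonneg n m k j)
      rw [hyperCount, if_neg hi]
  refine (mul_le_mul_of_nonneg_right (hmax' i) (by positivity)).trans ?_
  have hjm : j ≤ m := by simpa [Nat.lt_succ_iff] using hj
  set h := hyperCount n m k with hh
  have hpos : 0 < h j := by
    by_contra hcon
    have h0 : ∀ i, h i = 0 := fun i =>
      le_antisymm ((hmax' i).trans (not_lt.1 hcon)) (hyperCount_nonneg n m k i)
    have hs := sum_hyperCount (m := m) hk
    simp only [← hh, h0, Finset.sum_const_zero] at hs
    have := Nat.choose_pos hm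
    rw [← Nat.cast_pos (α := ℝ), ← hs] at this
    exact lt_irrefl _ this
  have hjk : j ≤ k := by
    by_contra hcon
    rw [hh, hyperCount, if_pos hjm, Nat.choose_eq_zero_of_lt (by omega)] at hpos
    simp at hpos
  have hjn : m - j ≤ n - k := by
    by_contra hcon
    rw [hh, hyperCount, if_pos hjm, Nat.choose_eq_zero_of_lt (show n - k < m - j by omega)] at hpos
    simp at hpos
  have hjn' : (m : ℝ) + k ≤ n + j := by
    have : m + k ≤ n + j := by omega
    exact_mod_cast this
  have hjk' : (j : ℝ) ≤ k := by exact_mod_cast hjk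
  have hjm' : (j : ℝ) ≤ m := by exact_mod_cast hjm
  have hkn' : (k : ℝ) ≤ n := by exact_mod_cast hk
  have hmn' : (m : ℝ) ≤ n := by exact_mod_cast hm
  have hlow : ((k : ℝ) + 1) * (m + 1) ≤ (n + 2) * (j + 1) := by
    have h1 := hyperCount_succ (m := m) hk j
    have h2 : h j * (((k : ℝ) - j) * (m - j)) ≤ h j * ((j + 1) * (n - k - m + j + 1)) := by
      rw [← h1]
      exact mul_le_mul_of_nonneg_right (hmax' _) (by apply mul_nonneg <;> linarith)
    have h3 := le_of_mul_le_mul_left h2 hpos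
    linarith
  have hup : ((n : ℝ) + 2) * j ≤ (k + 1) * (m + 1) := by
    rcases Nat.eq_zero_or_pos j with h0 | h0
    · rw [h0]; push_cast; rw [mul_zero]; positivity
    · obtain ⟨j', rfl⟩ : ∃ j', j = j' + 1 := ⟨j - 1, by omega⟩
      have h1 := hyperCount_succ (m := m) hk j'
      push_cast at *
      have h2 : h (j' + 1) * (((j' : ℝ) + 1) * (n - k - m + j' + 1)) ≤
          h (j' + 1) * ((k - j') * (m - j')) := by
        rw [h1]
        exact mul_le_mul_of_nonneg_right (hmax' _) (by apply mul_nonneg <;> linarith)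
      have h3 := le_of_mul_le_mul_left h2 hpos
      linarith
  set D : ℝ := (k + 1) * (m + 1) * (n + 1 - k) * (n + 1 - m) with hD
  have hDpos : 0 < D := by
    rw [hD]
    have : (0 : ℝ) < n + 1 - k := by linarith
    have : (0 : ℝ) < n + 1 - m := by linarith
    positivity
  set θ : ℝ := (n + 2) ^ 3 / D with hθ
  have hθ0 : 0 ≤ θ := by positivity
  have hstep : ∀ s : ℕ, h (j + s) * (1 - (s + 1) * θ) ≤ h (j + s + 1) := fun s => by
    have h1 := hyperCount_succ (m := m) hk (j + s)
    push_cast at h1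
    set q : ℝ := (j + s + 1) * (n - k - m + (j + s) + 1) with hq
    have hqpos : 0 < q := by
      rw [hq]
      have : (0 : ℝ) < n - k - m + (j + s) + 1 := by
        have : (0 : ℝ) ≤ s := by positivity
        linarith
      positivity
    have hnum : ((k : ℝ) - (j + s)) * (m - (j + s)) = q - ((n + 2) * (j + s + 1) -
      (k + 1) * (m + 1)) := by rw [hq]; ring
    have hdef : ((n : ℝ) + 2) * (j + s + 1) - (k + 1) * (m + 1) ≤ (s + 1) * θ * q := by
      have hq2 : D ≤ (n + 2) ^ 2 * q := by
        have a1 : ((k : ℝ) + 1) * (m + 1) ≤ (n + 2) * (j + s + 1) := by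
          have : (0 : ℝ) ≤ (n + 2) * s := by positivity
          linarith
        have a2 : ((n : ℝ) + 1 - k) * (n + 1 - m) ≤ (n + 2) * (n - k - m + (j + s) + 1) := by
          linarith
        calc D = ((k + 1) * (m + 1)) * ((n + 1 - k) * (n + 1 - m)) := by rw [hD]; ring
          _ ≤ ((n + 2) * (j + s + 1)) * ((n + 2) * (n - k - m + (j + s) + 1)) := by
            refine mul_le_mul a1 a2 ?_ (by positivity)
            apply mul_nonneg <;> linarith
          _ = _ := by rw [hq]; ring
      have h4 : (n + 2 : ℝ) ≤ θ * q := by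
        rw [hθ, div_mul_eq_mul_div, le_div_iff₀ hDpos]
        have : (0 : ℝ) ≤ n + 2 := by positivity
        linarith [mul_le_mul_of_nonneg_left hq2 this]
      calc ((n : ℝ) + 2) * (j + s + 1) - (k + 1) * (m + 1) ≤ (s + 1) * (n + 2) := by linarith
        _ ≤ (s + 1) * (θ * q) := by gcongr
        _ = _ := by ring
    have h5 : h (j + s) * (1 - (s + 1) * θ) * q ≤ h (j + s + 1) * q := by
      rw [h1, hnum, mul_assoc]
      refine mul_le_mul_of_nonneg_left ?_ (hyperCount_nonneg _ _ _ _)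
      linarith
    exact le_of_mul_le_mul_right h5 hqpos
  have hlb : ∀ s : ℕ, h j * (1 - s * (s + 1) / 2 * θ) ≤ h (j + s) := fun s => by
    induction s with
    | zero => simp
    | succ s ih =>
      have h1 := hstep s
      have h2 := hmax' (j + s)
      have h3 : (0 : ℝ) ≤ (s + 1) * θ := by positivity
      have h4 := mul_le_mul_of_nonneg_right h2 h3
      rw [← add_assoc]
      push_cast
      linarith
  have hhalf : ∀ s < t, h j / 2 ≤ h (j + s) := fun s hs => by
    refine le_trans ?_ (hlb s)
    have h1 : (s : ℝ) + 1 ≤ t := by exact_mod_cast hs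
    have h2 : (s : ℝ) * (s + 1) ≤ t ^ 2 := by
      have : (0 : ℝ) ≤ s := by positivity
      nlinarith
    have h3 : (t : ℝ) ^ 2 * θ ≤ 1 := by
      rw [hθ, ← mul_div_assoc, div_le_one hDpos]; exact ht
    have h4 := mul_le_mul_of_nonneg_right h2 hθ0
    have h5 : 1 / 2 ≤ 1 - (s : ℝ) * (s + 1) / 2 * θ := by linarith
    calc h j / 2 = h j * (1 / 2) := by ring
      _ ≤ _ := mul_le_mul_of_nonneg_left h5 hpos.le
  have hsum := sum_Ico_hyperCount_le (m := m) hk j (j + t)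
  rw [Finset.sum_Ico_eq_sum_range, Nat.add_sub_cancel_left] at hsum
  have := Finset.card_nsmul_le_sum (Finset.range t) (fun s => h (j + s)) (h j / 2)
    (fun s hs => hhalf s (Finset.mem_range.1 hs))
  rw [Finset.card_range, nsmul_eq_mul] at this
  have h6 := this.trans hsum
  linarith

/-- The site at time `k` of the path from `(1,1)` that moves right exactly at the times in `S`. -/
def siteAt (S : Finset ℕ) (k : ℕ) : ℕ × ℕ :=
  (1 + (S.filter (· < k)).card, 1 + (k - (S.filter (· < k)).card))

/-- The path of length `n` from `(1,1)` that moves right exactly at the times in `S`. -/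
def pathOf (n : ℕ) (S : Finset ℕ) : Finset (ℕ × ℕ) := (Finset.range (n + 1)).image (siteAt S)

lemma card_filter_lt_succ (S : Finset ℕ) (k : ℕ) :
    (S.filter (· < k + 1)).card = (S.filter (· < k)).card + if k ∈ S then 1 else 0 := by
  split_ifs with h
  · have : S.filter (· < k + 1) = insert k (S.filter (· < k)) := by
      ext x; simp only [Finset.mem_filter, Finset.mem_insert]
      constructor
      · rintro ⟨h1, h2⟩
        rcases Nat.lt_succ_iff_lt_or_eq.1 h2 with h3 | h3
        · exact Or.inr ⟨h1, h3⟩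
        · exact Or.inl h3
      · rintro (rfl | ⟨h1, h2⟩)
        · exact ⟨h, by omega⟩
        · exact ⟨h1, by omega⟩
    rw [this, Finset.card_insert_of_notMem (by simp)]
  · rw [add_zero]
    congr 1
    ext x; simp only [Finset.mem_filter]
    refine and_congr_right fun hx => ⟨fun h2 => ?_, fun h2 => by omega⟩
    rcases Nat.lt_succ_iff_lt_or_eq.1 h2 with h3 | h3
    · exact h3
    · exact absurd (h3 ▸ hx) h

lemma card_filter_lt_le (S : Finset ℕ) (k : ℕ) : (S.filter (· < k)).card ≤ k := by
  calc (S.filter (· < k)).card ≤ (Finset.range k).card :=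
        Finset.card_le_card fun x hx => Finset.mem_range.2 (Finset.mem_filter.1 hx).2
    _ = k := Finset.card_range k

lemma siteAt_fst_add_snd (S : Finset ℕ) (k : ℕ) : (siteAt S k).1 + (siteAt S k).2 = k + 2 := by
  have := card_filter_lt_le S k
  simp only [siteAt]; omega

lemma card_filter_lt_eq {n : ℕ} {S : Finset ℕ} (hS : S ⊆ Finset.range n) :
    (S.filter (· < n)).card = S.card := by
  congr 1
  exact Finset.filter_true_of_mem fun x hx => Finset.mem_range.1 (hS hx)

lemma isUpRightPath_pathOf {N M : ℕ} (hN : 1 ≤ N) (hM : 1 ≤ M) {S : Finset ℕ}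
    (hS : S ∈ Finset.powersetCard (N - 1) (Finset.range (N + M - 2))) :
    IsUpRightPath N M (pathOf (N + M - 2) S) := by
  obtain ⟨h1, h2⟩ := Finset.mem_powersetCard.1 hS
  refine ⟨siteAt S, by simp [siteAt], ?_, fun k _ => ?_, ?_⟩
  · rw [siteAt, card_filter_lt_eq h1, h2]
    ext <;> simp <;> omega
  · have h3 := card_filter_lt_le S k
    simp only [siteAt, card_filter_lt_succ]
    split_ifs
    · left; ext <;> simp only <;> omega
    · right; ext <;> simp only <;> omega
  · rw [pathOf]; congr 2; omega

lemma fst_add_snd_of_steps {n : ℕ} {c : ℕ → ℕ × ℕ} (h0 : c 0 = (1, 1))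
    (hs : ∀ k, k < n →
      c (k + 1) = ((c k).1 + 1, (c k).2) ∨ c (k + 1) = ((c k).1, (c k).2 + 1)) :
    ∀ k ≤ n, (c k).1 + (c k).2 = k + 2 := by
  intro k hk
  induction k with
  | zero => simp [h0]
  | succ k ih =>
    have := ih (by omega)
    rcases hs k (by omega) with h | h <;> rw [h] <;> simp only <;> omega

lemma exists_pathOf_eq {N M : ℕ} (hN : 1 ≤ N) (hM : 1 ≤ M) {s : Finset (ℕ × ℕ)}
    (hs : IsUpRightPath N M s) :
    ∃ S ∈ Finset.powersetCard (N - 1) (Finset.range (N + M - 2)), pathOf (N + M - 2) S = s := by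
  obtain ⟨c, h0, hend, hstep, rfl⟩ := hs
  set n := N + M - 2 with hn
  set S := (Finset.range n).filter fun k => (c (k + 1)).1 = (c k).1 + 1 with hS
  have hsum := fst_add_snd_of_steps h0 hstep
  have hfst : ∀ k ≤ n, (c k).1 = 1 + (S.filter (· < k)).card := by
    intro k hk
    induction k with
    | zero => simp [h0]
    | succ k ih =>
      have h1 := ih (by omega)
      rw [card_filter_lt_succ]
      have hmem : k ∈ S ↔ (c (k + 1)).1 = (c k).1 + 1 := by
        rw [hS, Finset.mem_filter, Finset.mem_range]
        exact and_iff_right (by omega)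
      rcases hstep k (by omega) with h | h
      · rw [if_pos (hmem.2 (by rw [h])), h]
        simp only; omega
      · rw [if_neg (fun h2 => by have := hmem.1 h2; rw [h] at this; simp at this), h]
        simp only; omega
  have hsite : ∀ k ≤ n, siteAt S k = c k := fun k hk => by
    have h1 := hfst k hk
    have h2 := hsum k hk
    have h3 := card_filter_lt_le S k
    ext <;> simp only [siteAt] <;> omega
  have hSn : S ⊆ Finset.range n := Finset.filter_subset _ _
  refine ⟨S, Finset.mem_powersetCard.2 ⟨hSn, ?_⟩, ?_⟩
  · have h1 := hfst n le_rfl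
    rw [card_filter_lt_eq hSn, hend] at h1
    simp only at h1
    omega
  · rw [pathOf, show n + 1 = N + M - 1 by omega]
    exact Finset.image_congr fun k hk => hsite k (by simp at hk; omega)

lemma siteAt_of_mem_pathOf {n : ℕ} {S : Finset ℕ} {a : ℕ × ℕ} (h : a ∈ pathOf n S) :
    siteAt S (a.1 + a.2 - 2) = a := by
  obtain ⟨k, -, rfl⟩ := Finset.mem_image.1 h
  rw [siteAt_fst_add_snd, Nat.add_sub_cancel]

lemma injOn_pathOf (n : ℕ) : Set.InjOn (pathOf n) {S | S ⊆ Finset.range n} := by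
  intro S hS T hT h
  have hsite : ∀ k ≤ n, siteAt S k = siteAt T k := fun k hk => by
    have h1 : siteAt S k ∈ pathOf n T := by
      rw [← h]; exact Finset.mem_image_of_mem _ (by simp; omega)
    have h2 := siteAt_of_mem_pathOf h1
    rw [siteAt_fst_add_snd, Nat.add_sub_cancel] at h2
    exact h2.symm
  have hcount : ∀ k ≤ n, (S.filter (· < k)).card = (T.filter (· < k)).card := fun k hk => by
    have := congrArg Prod.fst (hsite k hk)
    simp only [siteAt] at this
    omega
  ext k
  by_cases hk : k < n
  · have h1 := hcount k hk.le
    have h2 := hcount (k + 1) hk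
    rw [card_filter_lt_succ, card_filter_lt_succ, h1] at h2
    by_cases hkS : k ∈ S <;> by_cases hkT : k ∈ T <;> simp_all
  · exact iff_of_false (fun h' => hk (Finset.mem_range.1 (hS h')))
      (fun h' => hk (Finset.mem_range.1 (hT h')))

lemma pathOf_subset_box {N M : ℕ} (hN : 1 ≤ N) (hM : 1 ≤ M) {S : Finset ℕ}
    (hS : S ∈ Finset.powersetCard (N - 1) (Finset.range (N + M - 2))) :
    pathOf (N + M - 2) S ⊆ box N M := by
  obtain ⟨h1, h2⟩ := Finset.mem_powersetCard.1 hS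
  intro a ha
  obtain ⟨k, hk, rfl⟩ := Finset.mem_image.1 ha
  rw [Finset.mem_range] at hk
  have h3 : (S.filter (· < k)).card ≤ S.card := Finset.card_filter_le _ _
  have h4 : S.card ≤ (S.filter (· < k)).card + (N + M - 2 - k) := by
    rw [← Finset.card_filter_add_card_filter_not (s := S) (· < k)]
    gcongr
    calc _ ≤ (Finset.Ico k (N + M - 2)).card := Finset.card_le_card fun x hx => by
            have h5 := Finset.mem_filter.1 hx
            have h6 := Finset.mem_range.1 (h1 h5.1)
            rw [Finset.mem_Ico]; omega
      _ = _ := Nat.card_Ico _ _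
  have h5 := card_filter_lt_le S k
  simp only [box, siteAt, Finset.mem_product, Finset.mem_Icc]
  omega

lemma upRightPaths_eq_image {N M : ℕ} (hN : 1 ≤ N) (hM : 1 ≤ M) :
    upRightPaths N M = (Finset.powersetCard (N - 1) (Finset.range (N + M - 2))).image
      (pathOf (N + M - 2)) := by
  ext s
  simp only [upRightPaths, Finset.mem_filter, Finset.mem_powerset, Finset.mem_image]
  constructor
  · rintro ⟨-, h⟩
    exact exists_pathOf_eq hN hM h
  · rintro ⟨S, hS, rfl⟩
    exact ⟨pathOf_subset_box hN hM hS, isUpRightPath_pathOf hN hM hS⟩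

lemma card_upRightPaths {N M : ℕ} (hN : 1 ≤ N) (hM : 1 ≤ M) :
    (upRightPaths N M).card = (N + M - 2).choose (N - 1) := by
  rw [upRightPaths_eq_image hN hM, Finset.card_image_of_injOn, Finset.card_powersetCard,
    Finset.card_range]
  exact (injOn_pathOf _).mono fun S hS => (Finset.mem_powersetCard.1 hS).1

lemma card_upRightPaths_pos {N M : ℕ} (hN : 1 ≤ N) (hM : 1 ≤ M) :
    0 < (upRightPaths N M).card := by
  rw [card_upRightPaths hN hM]
  exact Nat.choose_pos (by omega)

lemma subset_box_of_mem {N M : ℕ} {s : Finset (ℕ × ℕ)} (hs : s ∈ upRightPaths N M) :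
    s ⊆ box N M := by
  classical
  exact Finset.mem_powerset.1 (Finset.mem_filter.1 hs).1

lemma card_of_mem_upRightPaths {N M : ℕ} (hN : 1 ≤ N) (hM : 1 ≤ M) {s : Finset (ℕ × ℕ)}
    (hs : s ∈ upRightPaths N M) : s.card = M + N - 1 := by
  rw [upRightPaths_eq_image hN hM] at hs
  obtain ⟨S, -, rfl⟩ := Finset.mem_image.1 hs
  rw [pathOf, Finset.card_image_of_injective, Finset.card_range]
  · omega
  · intro k l h
    have h1 := siteAt_fst_add_snd S k
    have h2 := siteAt_fst_add_snd S l
    rw [h] at h1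
    omega

lemma eq_of_mem_upRightPaths {N M : ℕ} (hN : 1 ≤ N) (hM : 1 ≤ M) {s : Finset (ℕ × ℕ)}
    (hs : s ∈ upRightPaths N M) {a b : ℕ × ℕ} (ha : a ∈ s) (hb : b ∈ s)
    (hab : a.1 + a.2 = b.1 + b.2) : a = b := by
  rw [upRightPaths_eq_image hN hM] at hs
  obtain ⟨S, -, rfl⟩ := Finset.mem_image.1 hs
  rw [← siteAt_of_mem_pathOf ha, ← siteAt_of_mem_pathOf hb, hab]

lemma card_filter_mem_le {N M : ℕ} (hN : 1 ≤ N) (hM : 1 ≤ M) {a : ℕ × ℕ} (ha : a ∈ box N M) :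
    (((upRightPaths N M).filter (a ∈ ·)).card : ℝ) ≤
      hyperCount (N + M - 2) (N - 1) (a.1 + a.2 - 2) (a.1 - 1) := by
  obtain ⟨⟨a1, a2⟩, a3, a4⟩ : (1 ≤ a.1 ∧ a.1 ≤ N) ∧ 1 ≤ a.2 ∧ a.2 ≤ M := by
    simpa [box, Finset.mem_product, Finset.mem_Icc] using ha
  set n := N + M - 2 with hn
  set k := a.1 + a.2 - 2 with hk
  set i := a.1 - 1 with hi
  rw [hyperCount, if_pos (by omega), Nat.cast_le, upRightPaths_eq_image hN hM,
    Finset.filter_image]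
  refine Finset.card_image_le.trans ?_
  have hcard : ∀ S ∈ (Finset.powersetCard (N - 1) (Finset.range n)).filter
      (fun S => a ∈ pathOf n S), (S.filter (· < k)).card = i := fun S hS => by
    have h := congrArg Prod.fst (siteAt_of_mem_pathOf (Finset.mem_filter.1 hS).2)
    simp only [siteAt, ← hk] at h
    omega
  have hle : ((Finset.powersetCard (N - 1) (Finset.range n)).filter
      (fun S => a ∈ pathOf n S)).card ≤
      (Finset.powersetCard i (Finset.range k) ×ˢ
        Finset.powersetCard (N - 1 - i) (Finset.Ico k n)).card := by
    refine Finset.card_le_card_of_injOn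
      (fun S => (S.filter (· < k), S.filter fun x => ¬ x < k)) (fun S hS => ?_) ?_
    · have h1 := hcard S hS
      obtain ⟨h2, h3⟩ := Finset.mem_powersetCard.1 (Finset.mem_filter.1 hS).1
      have h4 := Finset.card_filter_add_card_filter_not (s := S) (· < k)
      simp only [Finset.coe_product, Set.mem_prod, Finset.mem_coe, Finset.mem_powersetCard]
      refine ⟨⟨fun x hx => Finset.mem_range.2 (Finset.mem_filter.1 hx).2, h1⟩,
        fun x hx => ?_, by omega⟩
      have h5 := Finset.mem_filter.1 hx
      have h6 := Finset.mem_range.1 (h2 h5.1)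
      rw [Finset.mem_Ico]; omega
    · intro S _ T _ h
      simp only [Prod.mk.injEq] at h
      rw [← Finset.filter_union_filter_not_eq (· < k) S, h.1, h.2,
        Finset.filter_union_filter_not_eq]
  simpa using hle

/-- The probability that a uniformly random up-right path visits the site `a`. -/
noncomputable def visitProb (N M : ℕ) (a : ℕ × ℕ) : ℝ :=
  ((upRightPaths N M).filter (a ∈ ·)).card / (upRightPaths N M).card

lemma visitProb_nonneg (N M : ℕ) (a : ℕ × ℕ) : 0 ≤ visitProb N M a := by
  unfold visitProb; positivity

lemma visitProb_le_one (N M : ℕ) (a : ℕ × ℕ) : visitProb N M a ≤ 1 :=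
  div_le_one_of_le₀ (by exact_mod_cast Finset.card_filter_le _ _) (by positivity)

lemma sum_visitProb_mul (N M : ℕ) (g : ℕ × ℕ → ℝ) :
    ∑ a ∈ box N M, visitProb N M a * g a =
      ((upRightPaths N M).card : ℝ)⁻¹ * ∑ s ∈ upRightPaths N M, ∑ a ∈ s, g a := by
  have h1 : ∀ s ∈ upRightPaths N M, ∑ a ∈ s, g a = ∑ a ∈ box N M, if a ∈ s then g a else 0 :=
    fun s hs => by
      rw [← Finset.sum_filter, Finset.filter_mem_eq_inter,
        Finset.inter_eq_right.2 (subset_box_of_mem hs)]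
  rw [Finset.sum_congr rfl h1, Finset.sum_comm, Finset.mul_sum]
  refine Finset.sum_congr rfl fun a _ => ?_
  rw [← Finset.sum_filter, Finset.sum_const, nsmul_eq_mul, visitProb]
  ring

lemma sum_visitProb {N M : ℕ} (hN : 1 ≤ N) (hM : 1 ≤ M) :
    ∑ a ∈ box N M, visitProb N M a = (M + N - 1 : ℕ) := by
  have h := sum_visitProb_mul N M fun _ => 1
  simp only [mul_one, Finset.sum_const, nsmul_eq_mul] at h
  rw [h, Finset.sum_congr rfl fun s hs => by rw [card_of_mem_upRightPaths hN hM hs],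
    Finset.sum_const, nsmul_eq_mul]
  have : ((upRightPaths N M).card : ℝ) ≠ 0 := by
    exact_mod_cast (card_upRightPaths_pos hN hM).ne'
  field_simp

lemma visitProb_mul_le {N M t : ℕ} (hN : 1 ≤ N) (hM : 1 ≤ M) {δ : ℝ}
    (hδ : δ * (N + M) ^ 2 ≤ N * M) {a : ℕ × ℕ} (ha : a ∈ box N M)
    (ht : (t : ℝ) ^ 2 * (N + M) ≤ δ * (((a.1 + a.2 - 1 : ℕ) : ℝ) * (N + M - (a.1 + a.2 - 1 : ℕ)))) :
    visitProb N M a * t ≤ 2 := by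
  obtain ⟨⟨a1, a2⟩, a3, a4⟩ : (1 ≤ a.1 ∧ a.1 ≤ N) ∧ 1 ≤ a.2 ∧ a.2 ≤ M := by
    simpa [box, Finset.mem_product, Finset.mem_Icc] using ha
  have h1 := card_filter_mem_le hN hM ha
  have h2 : hyperCount (N + M - 2) (N - 1) (a.1 + a.2 - 2) (a.1 - 1) * t ≤
      2 * (N + M - 2).choose (N - 1) := by
    refine hyperCount_mul_le (by omega) (by omega) ?_ _
    have e1 : ((N + M - 2 : ℕ) : ℝ) = N + M - 2 := by
      rw [Nat.cast_sub (by omega)]; push_cast; ring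
    have e2 : ((a.1 + a.2 - 2 : ℕ) : ℝ) = (a.1 + a.2 - 1 : ℕ) - 1 := by
      rw [Nat.cast_sub (by omega), Nat.cast_sub (by omega)]; push_cast; ring
    have e3 : ((N - 1 : ℕ) : ℝ) = N - 1 := by
      rw [Nat.cast_sub (by omega)]; push_cast; ring
    rw [e1, e2, e3]
    set κ : ℝ := ((a.1 + a.2 - 1 : ℕ) : ℝ) with hκ
    have hκ0 : 0 ≤ κ := by positivity
    have hκ1 : κ ≤ N + M := by
      rw [hκ]
      have : a.1 + a.2 - 1 ≤ N + M := by omega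
      exact_mod_cast this
    calc (t : ℝ) ^ 2 * (N + M - 2 + 2) ^ 3 = (t ^ 2 * (N + M)) * (N + M) ^ 2 := by ring
      _ ≤ (δ * (κ * (N + M - κ))) * (N + M) ^ 2 := by gcongr
      _ = (κ * (N + M - κ)) * (δ * (N + M) ^ 2) := by ring
      _ ≤ (κ * (N + M - κ)) * (N * M) :=
        mul_le_mul_of_nonneg_left hδ (mul_nonneg hκ0 (by linarith))
      _ = _ := by ring
  have hpos : (0 : ℝ) < (upRightPaths N M).card := by
    exact_mod_cast card_upRightPaths_pos hN hM
  rw [visitProb, div_mul_eq_mul_div, div_le_iff₀ hpos]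
  rw [← card_upRightPaths hN hM] at h2
  exact (mul_le_mul_of_nonneg_right h1 (by positivity)).trans h2

lemma card_bad_diagonals_le {A t : ℕ} {δ : ℝ} (hδ : 0 < δ) :
    (((Finset.Icc 1 (A - 1)).filter fun κ : ℕ =>
      ¬ (t : ℝ) ^ 2 * A ≤ δ * ((κ : ℝ) * (A - κ))).card : ℝ) ≤ 4 * t ^ 2 / δ := by
  set R : ℝ := 2 * t ^ 2 / δ with hR
  have hR0 : 0 ≤ R := by positivity
  have hsub : ((Finset.Icc 1 (A - 1)).filter fun κ : ℕ =>
      ¬ (t : ℝ) ^ 2 * A ≤ δ * ((κ : ℝ) * (A - κ))) ⊆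
      Finset.Icc 1 ⌊R⌋₊ ∪ (Finset.Icc 1 ⌊R⌋₊).image (A - ·) := fun κ hκ => by
    obtain ⟨h1, h2⟩ := Finset.mem_filter.1 hκ
    rw [Finset.mem_Icc] at h1
    rw [not_le] at h2
    have hκA : (κ : ℝ) ≤ A := by exact_mod_cast (by omega : κ ≤ A)
    have hA : (0 : ℝ) < A := by exact_mod_cast (by omega : 0 < A)
    have hκ0 : (0 : ℝ) ≤ κ := by positivity
    have hR2 : δ * R = 2 * t ^ 2 := by rw [hR]; field_simp
    rw [Finset.mem_union, Finset.mem_image]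
    rcases le_total (2 * (κ : ℝ)) A with h | h
    · left
      rw [Finset.mem_Icc]
      refine ⟨h1.1, Nat.le_floor ?_⟩
      have h3 : (A : ℝ) * (δ * κ) ≤ A * (δ * R) := by
        rw [hR2]
        have : 0 ≤ δ * κ * (A - 2 * κ) := by
          apply mul_nonneg <;> positivity
        linarith
      exact le_of_mul_le_mul_left (le_of_mul_le_mul_left h3 hA) hδ
    · right
      refine ⟨A - κ, ?_, by omega⟩
      rw [Finset.mem_Icc]
      refine ⟨by omega, Nat.le_floor ?_⟩
      rw [Nat.cast_sub (by omega)]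
      have h3 : (A : ℝ) * (δ * (A - κ)) ≤ A * (δ * R) := by
        rw [hR2]
        have : 0 ≤ δ * (A - κ) * (2 * κ - A) := by
          apply mul_nonneg
          · apply mul_nonneg hδ.le; linarith
          · linarith
        linarith
      exact le_of_mul_le_mul_left (le_of_mul_le_mul_left h3 hA) hδ
  have h1 : ((Finset.Icc 1 ⌊R⌋₊).card : ℝ) ≤ R := by
    rw [Nat.card_Icc, Nat.add_sub_cancel]; exact Nat.floor_le hR0
  calc _ ≤ (((Finset.Icc 1 ⌊R⌋₊ ∪ (Finset.Icc 1 ⌊R⌋₊).image (A - ·)).card : ℕ) : ℝ) := by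
        exact_mod_cast Finset.card_le_card hsub
    _ ≤ (((Finset.Icc 1 ⌊R⌋₊).card + (Finset.Icc 1 ⌊R⌋₊).card : ℕ) : ℝ) := by
        exact_mod_cast (Finset.card_union_le _ _).trans (Nat.add_le_add_left Finset.card_image_le _)
    _ ≤ R + R := by push_cast; linarith
    _ = _ := by rw [hR]; ring

lemma sum_visitProb_sq_le_of_pos {N M t : ℕ} (hN : 1 ≤ N) (hM : 1 ≤ M) (ht : 1 ≤ t) {δ : ℝ}
    (hδ0 : 0 < δ) (hδ : δ * (N + M) ^ 2 ≤ N * M) :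
    ∑ a ∈ box N M, visitProb N M a ^ 2 ≤ 2 * (M + N - 1 : ℕ) / t + 4 * t ^ 2 / δ := by
  set good : ℕ → Prop := fun κ => (t : ℝ) ^ 2 * (N + M : ℕ) ≤ δ * ((κ : ℝ) * ((N + M : ℕ) - κ))
    with hgood
  have ht0 : (0 : ℝ) < t := by exact_mod_cast ht
  have hpt : ∀ a ∈ box N M, visitProb N M a ^ 2 ≤
      visitProb N M a * (2 / t) + visitProb N M a * (if ¬ good (a.1 + a.2 - 1) then 1 else 0) :=
    fun a ha => by
      have h0 := visitProb_nonneg N M a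
      by_cases hg : good (a.1 + a.2 - 1)
      · have h1 := visitProb_mul_le hN hM hδ ha (by simpa [hgood] using hg)
        rw [if_neg (not_not.2 hg), mul_zero, add_zero, sq]
        refine mul_le_mul_of_nonneg_left ?_ h0
        rwa [le_div_iff₀ ht0]
      · rw [if_pos hg, mul_one, sq]
        have h1 := mul_le_mul_of_nonneg_left (visitProb_le_one N M a) h0
        have h2 : 0 ≤ visitProb N M a * (2 / t) := by positivity
        linarith
  refine (Finset.sum_le_sum hpt).trans ?_
  rw [Finset.sum_add_distrib, ← Finset.sum_mul, sum_visitProb hN hM]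
  refine add_le_add (le_of_eq (by ring)) ?_
  rw [sum_visitProb_mul N M fun a => if ¬ good (a.1 + a.2 - 1) then 1 else 0]
  have hpos : (0 : ℝ) < (upRightPaths N M).card := by
    exact_mod_cast card_upRightPaths_pos hN hM
  rw [inv_mul_le_iff₀ hpos, ← nsmul_eq_mul]
  refine Finset.sum_le_card_nsmul _ _ _ fun s hs => ?_
  refine le_trans ?_ (card_bad_diagonals_le (A := N + M) (t := t) hδ0)
  rw [Finset.sum_boole]
  norm_cast
  refine Finset.card_le_card_of_injOn (fun a => a.1 + a.2 - 1) (fun a ha => ?_)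
    fun a ha b hb hab => ?_
  · obtain ⟨h1, h2⟩ := Finset.mem_filter.1 ha
    have h3 := subset_box_of_mem hs h1
    simp only [box, Finset.mem_product, Finset.mem_Icc] at h3
    refine Finset.mem_filter.2 ⟨Finset.mem_Icc.2 (by simp only; omega), ?_⟩
    simpa [hgood] using h2
  · have ha1 := (Finset.mem_filter.1 ha).1
    have hb1 := (Finset.mem_filter.1 hb).1
    have ha2 := subset_box_of_mem hs ha1
    have hb2 := subset_box_of_mem hs hb1
    simp only [box, Finset.mem_product, Finset.mem_Icc] at ha2 hb2
    simp only at hab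
    exact eq_of_mem_upRightPaths hN hM hs ha1 hb1 (by omega)

/-- The expected number of common sites of two independent uniform paths is `O(L ^ (3/4))`. -/
lemma sum_visitProb_sq_le {N M : ℕ} (hN : 1 ≤ N) (hM : 1 ≤ M) {δ : ℝ} (hδ0 : 0 < δ)
    (hδ : δ * (N + M) ^ 2 ≤ N * M) :
    ∑ a ∈ box N M, visitProb N M a ^ 2 ≤
      (2 + 16 / δ) * ((M + N - 1 : ℕ) : ℝ) ^ (3 / 4 : ℝ) := by
  set L : ℝ := ((M + N - 1 : ℕ) : ℝ) with hL
  have hL1 : 1 ≤ L := by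
    rw [hL]; exact_mod_cast (by omega : 1 ≤ M + N - 1)
  have hL0 : 0 < L := by linarith
  set r := L ^ (1 / 4 : ℝ) with hr
  have hr1 : 1 ≤ r := Real.one_le_rpow hL1 (by norm_num)
  have hr4 : L = r ^ 4 := by
    rw [hr, ← Real.rpow_natCast, ← Real.rpow_mul hL0.le]; norm_num
  have hr3 : L ^ (3 / 4 : ℝ) = r ^ 3 := by
    rw [hr, ← Real.rpow_natCast, ← Real.rpow_mul hL0.le]; norm_num
  have hrt : r ≤ ⌈r⌉₊ := Nat.le_ceil r
  have htr : (⌈r⌉₊ : ℝ) ≤ 2 * r := (Nat.ceil_lt_add_one (by linarith)).le.trans (by linarith)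
  have ht : 1 ≤ ⌈r⌉₊ := Nat.one_le_ceil_iff.2 (by linarith)
  refine (sum_visitProb_sq_le_of_pos hN hM ht hδ0 hδ).trans ?_
  rw [← hL, hr3, hr4, add_mul]
  refine add_le_add ?_ ?_
  · rw [div_le_iff₀ (by linarith)]
    have : 0 ≤ 2 * r ^ 3 := by positivity
    nlinarith
  · rw [div_mul_eq_mul_div]
    refine div_le_div_of_nonneg_right ?_ hδ0.le
    have h1 : (⌈r⌉₊ : ℝ) ^ 2 ≤ (2 * r) ^ 2 := by gcongr
    have h2 : r ^ 2 ≤ r ^ 3 := pow_le_pow_right₀ hr1 (by norm_num)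
    linarith

lemma avg_sum_ite_mem (N M : ℕ) (g : ↥(box N M) → ℝ) :
    ((upRightPaths N M).card : ℝ)⁻¹ *
      ∑ s ∈ upRightPaths N M, ∑ a : ↥(box N M), (if (a : ℕ × ℕ) ∈ s then g a else 0) =
      ∑ a : ↥(box N M), visitProb N M a * g a := by
  rw [Finset.sum_comm, Finset.mul_sum]
  refine Finset.sum_congr rfl fun a _ => ?_
  rw [← Finset.sum_filter, Finset.sum_const, nsmul_eq_mul, visitProb]
  ring

lemma abs_pathAvgCentered_sub_le {f : ℝ → ℝ} (hf : ∀ x y, |f x - f y| ≤ |x - y|) (N M : ℕ)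
    (x y b : ↥(box N M) → ℝ) :
    |pathAvgCentered N M x b f - pathAvgCentered N M y b f| ≤
      (√((M + N - 1 : ℕ) : ℝ))⁻¹ * ∑ a : ↥(box N M), visitProb N M a * |x a - y a| := by
  set L : ℝ := ((M + N - 1 : ℕ) : ℝ) with hL
  rw [← avg_sum_ite_mem, pathAvgCentered, pathAvgCentered, ← mul_sub, ← Finset.sum_sub_distrib,
    abs_mul, abs_of_nonneg (by positivity : (0 : ℝ) ≤ ((upRightPaths N M).card : ℝ)⁻¹),
    mul_left_comm, Finset.mul_sum (s := upRightPaths N M)]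
  refine mul_le_mul_of_nonneg_left ?_ (by positivity)
  refine (Finset.abs_sum_le_sum_abs _ _).trans (Finset.sum_le_sum fun s _ => ?_)
  refine (hf _ _).trans ?_
  rw [← mul_sub, ← Finset.sum_sub_distrib, abs_mul,
    abs_of_nonneg (by positivity : (0 : ℝ) ≤ (√L)⁻¹)]
  refine mul_le_mul_of_nonneg_left ?_ (by positivity)
  refine (Finset.abs_sum_le_sum_abs _ _).trans (Finset.sum_le_sum fun a _ => ?_)
  split_ifs
  · rw [sub_sub_sub_cancel_right]
  · simp

lemma weightedLipschitz_pathAvgCentered {f : ℝ → ℝ} (hf : ∀ x y, |f x - f y| ≤ |x - y|)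
    (N M : ℕ) (b : ↥(box N M) → ℝ) :
    WeightedLipschitz (fun a : ↥(box N M) => (√((M + N - 1 : ℕ) : ℝ))⁻¹ * visitProb N M a)
      (fun x => pathAvgCentered N M x b f) := fun x y => by
  refine (abs_pathAvgCentered_sub_le hf N M x y b).trans_eq ?_
  rw [Finset.mul_sum]
  simp_rw [mul_assoc]

lemma weightedLipschitz_sum_mul {ι : Type} [Fintype ι] {c : ι → ℝ} (hc : ∀ i, 0 ≤ c i) :
    WeightedLipschitz c (fun x => ∑ i, c i * x i) := fun x y => by
  rw [← Finset.sum_sub_distrib]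
  refine (Finset.abs_sum_le_sum_abs _ _).trans_eq (Finset.sum_congr rfl fun i _ => ?_)
  rw [← mul_sub, abs_mul, abs_of_nonneg (hc i)]

lemma weightedLipschitz_sum_mul_abs {ι : Type} [Fintype ι] {c : ι → ℝ} (hc : ∀ i, 0 ≤ c i) :
    WeightedLipschitz c (fun x => ∑ i, c i * |x i|) := fun x y => by
  rw [← Finset.sum_sub_distrib]
  refine (Finset.abs_sum_le_sum_abs _ _).trans (Finset.sum_le_sum fun i _ => ?_)
  rw [← mul_sub, abs_mul, abs_of_nonneg (hc i)]
  exact mul_le_mul_of_nonneg_left (abs_abs_sub_abs_le _ _) (hc i)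

lemma integral_sum_mul_expPi {ι : Type} [Fintype ι] (c : ι → ℝ) :
    ∫ x, ∑ i, c i * x i ∂(expPi ι) = ∑ i, c i := by
  rw [integral_finsetSum _ fun i _ =>
    (integrable_comp_eval_expPi i integrable_id_expMeasure).const_mul (c i)]
  refine Finset.sum_congr rfl fun i _ => ?_
  rw [integral_const_mul, integral_comp_eval_expPi i measurable_id']
  rw [integral_id_expMeasure, mul_one]

lemma integral_abs_expMeasure : ∫ x, |x| ∂(expMeasure 1) = 1 := by
  rw [integral_congr_ae (ae_nonneg_expMeasure.mono fun x hx => abs_of_nonneg hx),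
    integral_id_expMeasure]

lemma integral_sum_mul_abs_expPi {ι : Type} [Fintype ι] (c : ι → ℝ) :
    ∫ x, ∑ i, c i * |x i| ∂(expPi ι) = ∑ i, c i := by
  rw [integral_finsetSum _ fun i _ =>
    (integrable_comp_eval_expPi i integrable_id_expMeasure.abs).const_mul (c i)]
  refine Finset.sum_congr rfl fun i _ => ?_
  rw [integral_const_mul, integral_comp_eval_expPi i (g := fun x => |x|) (by fun_prop)]
  rw [integral_abs_expMeasure, mul_one]

/-- Concentration of the mean of i.i.d. exponential variables at scale `L ^ (-3/4)`. -/
lemma measure_mean_deviation_le {ι : Type} [Fintype ι] [Nonempty ι] {δ L : ℝ} (hδ : 0 < δ)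
    (hL : 1 ≤ L) (hcard : δ * L ^ 2 ≤ Fintype.card ι) (hcard2 : 2 * L ≤ Fintype.card ι) :
    expPi ι {x | L ^ (-(3 / 4) : ℝ) ≤ |(Fintype.card ι : ℝ)⁻¹ * ∑ i, x i - 1|} ≤
      2 * ENNReal.ofReal (rexp (2 / δ - L ^ (1 / 4 : ℝ))) := by
  have hn : (0 : ℝ) < Fintype.card ι := by exact_mod_cast Fintype.card_pos
  have hL0 : 0 < L := by linarith
  have h := (weightedLipschitz_sum_mul (c := fun _ : ι => (Fintype.card ι : ℝ)⁻¹)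
    (fun _ => by positivity)).measure_abs_ge_le (fun _ => by positivity) hL0
    (fun _ => by rw [← div_eq_mul_inv, div_le_div_iff₀ hn two_pos]; linarith)
    (L ^ (-(3 / 4) : ℝ))
  rw [integral_sum_mul_expPi] at h
  simp only [← Finset.mul_sum, Finset.sum_const, Finset.card_univ, nsmul_eq_mul] at h
  rw [mul_inv_cancel₀ hn.ne'] at h
  refine h.trans ?_
  gcongr 2 * ENNReal.ofReal (rexp ?_)
  have h1 : L * L ^ (-(3 / 4) : ℝ) = L ^ (1 / 4 : ℝ) := by
    nth_rewrite 1 [← Real.rpow_one L]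
    rw [← Real.rpow_add hL0]; norm_num
  rw [h1]
  refine sub_le_sub_right ?_ _
  rw [sq (Fintype.card ι : ℝ)⁻¹, mul_inv_cancel_left₀ hn.ne', ← div_eq_mul_inv,
    div_le_div_iff₀ hn hδ]
  linarith

/-- The quenched average concentrates around its annealed value for exponential weights. -/
lemma measure_pathAvgCentered_deviation_le {f : ℝ → ℝ} (hf : ∀ x y, |f x - f y| ≤ |x - y|)
    {N M : ℕ} {C ε : ℝ} (hL : 8 ≤ M + N - 1)
    (hV : ∑ a ∈ box N M, visitProb N M a ^ 2 ≤ C * ((M + N - 1 : ℕ) : ℝ) ^ (3 / 4 : ℝ)) :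
    expPi ↥(box N M) {x | ε ≤ |pathAvgCentered N M x (fun _ => 1) f -
        ∫ x, pathAvgCentered N M x (fun _ => 1) f ∂(expPi ↥(box N M))|} ≤
      2 * ENNReal.ofReal (rexp (2 * C - ε * ((M + N - 1 : ℕ) : ℝ) ^ (1 / 8 : ℝ))) := by
  set L : ℝ := ((M + N - 1 : ℕ) : ℝ) with hLdef
  have hL8 : (8 : ℝ) ≤ L := by rw [hLdef]; exact_mod_cast hL
  have hL0 : 0 < L := by linarith
  set r := L ^ (1 / 8 : ℝ) with hr
  have hr0 : 0 < r := by positivity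
  have hr8 : L = r ^ 8 := by rw [hr, ← Real.rpow_natCast, ← Real.rpow_mul hL0.le]; norm_num
  have hr6 : L ^ (3 / 4 : ℝ) = r ^ 6 := by
    rw [hr, ← Real.rpow_natCast, ← Real.rpow_mul hL0.le]; norm_num
  have hsq : √L = r ^ 4 := by
    rw [hr8, show r ^ 8 = (r ^ 4) ^ 2 by ring, Real.sqrt_sq (by positivity)]
  have hr3 : 2 ≤ r ^ 3 := by
    by_contra hcon
    push Not at hcon
    have h1 : r ^ 8 * r = (r ^ 3) ^ 3 := by ring
    have h2 : (r ^ 3) ^ 3 < 2 ^ 3 := by gcongr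
    have h3 : 1 ≤ r := by
      rw [hr]; exact Real.one_le_rpow (by linarith) (by norm_num)
    rw [← hr8] at h1
    nlinarith
  have h := (weightedLipschitz_pathAvgCentered hf N M fun _ => 1).measure_abs_ge_le
    (fun a => mul_nonneg (by positivity) (visitProb_nonneg N M a)) hr0 (fun a => ?_) ε
  · refine h.trans ?_
    gcongr 2 * ENNReal.ofReal (rexp ?_)
    have h1 : ∑ a : ↥(box N M), ((√L)⁻¹ * visitProb N M a) ^ 2 =
        (r ^ 8)⁻¹ * ∑ a ∈ box N M, visitProb N M a ^ 2 := by
      rw [hsq, ← Finset.sum_coe_sort (box N M), Finset.mul_sum]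
      refine Finset.sum_congr rfl fun a _ => ?_
      rw [mul_pow, inv_pow]; ring
    rw [h1, mul_comm r ε]
    refine sub_le_sub_right ?_ _
    rw [hr6] at hV
    calc 2 * r ^ 2 * ((r ^ 8)⁻¹ * ∑ a ∈ box N M, visitProb N M a ^ 2)
        ≤ 2 * r ^ 2 * ((r ^ 8)⁻¹ * (C * r ^ 6)) := by gcongr
      _ = 2 * C := by field_simp
  · have h1 := visitProb_le_one N M a
    rw [← hLdef, hsq]
    calc r * ((r ^ 4)⁻¹ * visitProb N M a) ≤ r * ((r ^ 4)⁻¹ * 1) := by gcongr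
      _ = (r ^ 3)⁻¹ := by field_simp
      _ ≤ 2⁻¹ := by gcongr
      _ = 1 / 2 := by norm_num

lemma measure_weighted_sum_ge_le {N M : ℕ} (hN : 1 ≤ N) (hM : 1 ≤ M) :
    expPi ↥(box N M) {x | 3 * ((M + N - 1 : ℕ) : ℝ) ≤ ∑ a : ↥(box N M), visitProb N M a * |x a|} ≤
      2 * ENNReal.ofReal (rexp (-(((M + N - 1 : ℕ) : ℝ) / 2))) := by
  set L : ℝ := ((M + N - 1 : ℕ) : ℝ) with hLdef
  have hsum : ∑ a : ↥(box N M), visitProb N M a = L := by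
    rw [hLdef, ← sum_visitProb hN hM]
    exact Finset.sum_coe_sort (box N M) fun a => visitProb N M a
  have h := (weightedLipschitz_sum_mul_abs (c := fun a : ↥(box N M) => visitProb N M a)
    (fun a => visitProb_nonneg N M a)).measure_abs_ge_le (fun a => visitProb_nonneg N M a)
    (l := 1 / 2) (by norm_num) (fun a => by linarith [visitProb_le_one N M a]) (2 * L)
  rw [integral_sum_mul_abs_expPi, hsum] at h
  refine (measure_mono fun x hx => ?_).trans (h.trans ?_)
  · have h1 : 3 * L ≤ ∑ a : ↥(box N M), visitProb N M a * |x a| := hx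
    exact (by linarith : 2 * L ≤ ∑ a : ↥(box N M), visitProb N M a * |x a| - L).trans
      (le_abs_self _)
  · gcongr 2 * ENNReal.ofReal (rexp ?_)
    have : ∑ a : ↥(box N M), visitProb N M a ^ 2 ≤ L := by
      rw [← hsum]
      refine Finset.sum_le_sum fun a _ => ?_
      rw [sq]
      exact mul_le_of_le_one_left (visitProb_nonneg N M a) (visitProb_le_one N M a)
    linarith

lemma card_box (N M : ℕ) : Fintype.card ↥(box N M) = N * M := by
  rw [Fintype.card_coe, box, Finset.card_product]; simp

lemma nonempty_box {N M : ℕ} (hN : 1 ≤ N) (hM : 1 ≤ M) : Nonempty ↥(box N M) :=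
  ⟨⟨(1, 1), by simp [box, hN, hM]⟩⟩

/-- The annealed average for i.i.d. standard exponential weights. -/
noncomputable def annealedAvg (N M : ℕ) (f : ℝ → ℝ) : ℝ :=
  ∫ x, pathAvgCentered N M x (fun _ => 1) f ∂(expPi ↥(box N M))

/-- Normalizing the weights changes the quenched average by at most `6 * r⁻²`. -/
lemma abs_pathAvgCentered_normalize_sub_le {f : ℝ → ℝ} (hf : ∀ x y, |f x - f y| ≤ |x - y|)
    {N M : ℕ} {r : ℝ} (hr0 : 0 < r) (hr6 : 2 ≤ r ^ 6) (hr8 : ((M + N - 1 : ℕ) : ℝ) = r ^ 8)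
    {x : ↥(box N M) → ℝ}
    (hmean : |(Fintype.card ↥(box N M) : ℝ)⁻¹ * ∑ i, x i - 1| < (r ^ 6)⁻¹)
    (hvisit : ∑ a : ↥(box N M), visitProb N M a * |x a| ≤ 3 * r ^ 8) :
    |pathAvgCentered N M (normalize x) (fun _ => 1) f - pathAvgCentered N M x (fun _ => 1) f| ≤
      6 * (r ^ 2)⁻¹ := by
  have hsq : √(r ^ 8) = r ^ 4 := by
    rw [show r ^ 8 = (r ^ 4) ^ 2 by ring, Real.sqrt_sq (by positivity)]
  have hdiff := abs_pathAvgCentered_sub_le hf N M (normalize x) x (fun _ => 1)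
  rw [hr8, hsq] at hdiff
  refine hdiff.trans ?_
  set n : ℝ := (Fintype.card ↥(box N M) : ℝ) with hn
  set m := n⁻¹ * ∑ i, x i with hm
  have hr6' : (r ^ 6)⁻¹ ≤ 1 / 2 := by
    rw [one_div]; gcongr
  have hm2 : 1 / 2 ≤ m := by
    have := (abs_lt.1 hmean).1
    linarith
  have hm0 : 0 < m := by linarith
  have hnorm : ∀ a, normalize x a = x a * m⁻¹ := fun a => by
    rw [normalize, hm, mul_inv, inv_inv, ← hn]; ring
  have hinv : |m⁻¹ - 1| ≤ 2 * (r ^ 6)⁻¹ := by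
    have : m⁻¹ - 1 = -(m - 1) * m⁻¹ := by field_simp; ring
    rw [this, abs_mul, abs_neg, abs_of_pos (inv_pos.2 hm0), mul_comm 2]
    have hm3 : m⁻¹ ≤ 2 := by
      rw [inv_le_comm₀ hm0 two_pos]; linarith
    exact mul_le_mul hmean.le hm3 (inv_pos.2 hm0).le (by positivity)
  have hsum : ∑ a : ↥(box N M), visitProb N M a * |normalize x a - x a| =
      |m⁻¹ - 1| * ∑ a : ↥(box N M), visitProb N M a * |x a| := by
    rw [Finset.mul_sum]
    refine Finset.sum_congr rfl fun a _ => ?_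
    rw [hnorm, show x a * m⁻¹ - x a = (m⁻¹ - 1) * x a by ring, abs_mul]; ring
  have hpos : 0 ≤ ∑ a : ↥(box N M), visitProb N M a * |x a| :=
    Finset.sum_nonneg fun a _ => mul_nonneg (visitProb_nonneg N M a) (abs_nonneg _)
  rw [hsum]
  calc (r ^ 4)⁻¹ * (|m⁻¹ - 1| * ∑ a : ↥(box N M), visitProb N M a * |x a|)
      ≤ (r ^ 4)⁻¹ * (2 * (r ^ 6)⁻¹ * (3 * r ^ 8)) := by gcongr
    _ = 6 * (r ^ 2)⁻¹ := by field_simp; ring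

/-- The quenched average with normalized exponential weights concentrates around the annealed
average with i.i.d. exponential weights. -/
lemma measure_normalize_deviation_le {f : ℝ → ℝ} (hf : ∀ x y, |f x - f y| ≤ |x - y|)
    {N M : ℕ} (hN : 1 ≤ N) (hM : 1 ≤ M) {δ ε : ℝ} (hδ : 0 < δ) (hε : ε ≤ 1 / 2)
    (hδNM : δ * (N + M) ^ 2 ≤ N * M) (hL : 8 ≤ M + N - 1) (hLδ : 2 / δ ≤ (M + N - 1 : ℕ)) :
    expPi ↥(box N M) {x | ε + 6 * ((M + N - 1 : ℕ) : ℝ) ^ (-(1 / 4) : ℝ) ≤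
        |pathAvgCentered N M (normalize x) (fun _ => 1) f - annealedAvg N M f|} ≤
      6 * ENNReal.ofReal (rexp (4 + 32 / δ - ε * ((M + N - 1 : ℕ) : ℝ) ^ (1 / 8 : ℝ))) := by
  have := nonempty_box hN hM
  set L : ℝ := ((M + N - 1 : ℕ) : ℝ) with hLdef
  have hL8 : (8 : ℝ) ≤ L := by rw [hLdef]; exact_mod_cast hL
  have hL0 : 0 < L := by linarith
  have hLA : L ≤ N + M := by
    rw [hLdef]; exact_mod_cast (by omega : M + N - 1 ≤ N + M)
  set r := L ^ (1 / 8 : ℝ) with hr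
  have hr0 : 0 < r := by positivity
  have hr1 : 1 ≤ r := Real.one_le_rpow (by linarith) (by norm_num)
  have hr8 : L = r ^ 8 := by rw [hr, ← Real.rpow_natCast, ← Real.rpow_mul hL0.le]; norm_num
  have hr2 : L ^ (1 / 4 : ℝ) = r ^ 2 := by
    rw [hr, ← Real.rpow_natCast, ← Real.rpow_mul hL0.le]; norm_num
  have hrm2 : L ^ (-(1 / 4) : ℝ) = (r ^ 2)⁻¹ := by rw [Real.rpow_neg hL0.le, hr2]
  have hrm6 : L ^ (-(3 / 4) : ℝ) = (r ^ 6)⁻¹ := by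
    rw [Real.rpow_neg hL0.le, hr, ← Real.rpow_natCast, ← Real.rpow_mul hL0.le]; norm_num
  have hr6 : 2 ≤ r ^ 6 := by
    by_contra hcon
    push Not at hcon
    have h2 : r ^ 8 * 1 ≤ r ^ 8 * r ^ 4 := by gcongr; exact one_le_pow₀ hr1
    have h3 : r ^ 8 * r ^ 4 = (r ^ 6) ^ 2 := by ring
    have h4 : (r ^ 6) ^ 2 < 2 ^ 2 := by gcongr
    linarith
  set n : ℝ := (Fintype.card ↥(box N M) : ℝ) with hn
  have hn2 : n = N * M := by rw [hn, card_box]; push_cast; ring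
  have hn0 : 0 < n := by rw [hn]; exact_mod_cast Fintype.card_pos
  have hcard : δ * L ^ 2 ≤ n := by
    rw [hn2]; refine le_trans ?_ hδNM; gcongr
  have hcard2 : 2 * L ≤ n := by
    refine le_trans ?_ hcard
    rw [div_le_iff₀ hδ] at hLδ
    nlinarith
  have b1 := measure_pathAvgCentered_deviation_le hf (ε := ε) hL (sum_visitProb_sq_le hN hM hδ hδNM)
  have b2 := measure_mean_deviation_le (ι := ↥(box N M)) hδ (by linarith) hcard hcard2
  have b3 := measure_weighted_sum_ge_le hN hM
  rw [← hLdef] at b1 b3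
  rw [← hr, ← annealedAvg] at b1
  rw [← hn, hrm6, hr2] at b2
  set E1 := {x : ↥(box N M) → ℝ | ε ≤ |pathAvgCentered N M x (fun _ => 1) f - annealedAvg N M f|}
  set E2 := {x : ↥(box N M) → ℝ | (r ^ 6)⁻¹ ≤ |n⁻¹ * ∑ i, x i - 1|}
  set E3 := {x : ↥(box N M) → ℝ | 3 * L ≤ ∑ a : ↥(box N M), visitProb N M a * |x a|}
  have hsub : {x | ε + 6 * L ^ (-(1 / 4) : ℝ) ≤
        |pathAvgCentered N M (normalize x) (fun _ => 1) f - annealedAvg N M f|} ⊆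
      E1 ∪ E2 ∪ E3 := by
    intro x hx
    by_contra hcon
    simp only [Set.mem_union, not_or] at hcon
    obtain ⟨⟨h1, h2⟩, h3⟩ := hcon
    have h1' : |pathAvgCentered N M x (fun _ => 1) f - annealedAvg N M f| < ε := not_le.1 h1
    have h2' : |n⁻¹ * ∑ i, x i - 1| < (r ^ 6)⁻¹ := not_le.1 h2
    have h3' : ∑ a : ↥(box N M), visitProb N M a * |x a| < 3 * L := not_le.1 h3
    have hx' : ε + 6 * L ^ (-(1 / 4) : ℝ) ≤
      |pathAvgCentered N M (normalize x) (fun _ => 1) f - annealedAvg N M f| := hx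
    have hbd := abs_pathAvgCentered_normalize_sub_le hf hr0 hr6 hr8 h2' (h3'.le.trans_eq (by rw [hr8]))
    rw [hrm2] at hx'
    have htri := abs_sub_le (pathAvgCentered N M (normalize x) (fun _ => 1) f)
      (pathAvgCentered N M x (fun _ => 1) f) (annealedAvg N M f)
    linarith
  set K : ENNReal := ENNReal.ofReal (rexp (4 + 32 / δ - ε * r)) with hK
  have hpos : 0 < 1 / δ := by positivity
  have hd1 : 32 / δ = 32 * (1 / δ) := by ring
  have hd2 : 2 / δ = 2 * (1 / δ) := by ring
  have hd3 : 2 * (2 + 16 / δ) = 4 + 32 / δ := by ring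
  have hr12 : r ≤ r ^ 2 := by nlinarith
  have hr18 : r ≤ r ^ 8 := le_self_pow₀ hr1 (by norm_num)
  have hεr : ε * r ≤ 1 / 2 * r := by gcongr
  have c1 : expPi ↥(box N M) E1 ≤ 2 * K := b1.trans (by rw [hK, ← hd3])
  have c2 : expPi ↥(box N M) E2 ≤ 2 * K := b2.trans (by
    rw [hK]; gcongr 2 * ENNReal.ofReal (rexp ?_); linarith)
  have c3 : expPi ↥(box N M) E3 ≤ 2 * K := b3.trans (by
    rw [hK]; gcongr 2 * ENNReal.ofReal (rexp ?_); linarith)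
  calc _ ≤ expPi ↥(box N M) (E1 ∪ E2 ∪ E3) := measure_mono hsub
    _ ≤ expPi ↥(box N M) E1 + expPi ↥(box N M) E2 + expPi ↥(box N M) E3 :=
      (measure_union_le _ _).trans (by gcongr; exact measure_union_le _ _)
    _ ≤ 2 * K + 2 * K + 2 * K := by gcongr
    _ = 6 * K := by ring

lemma ae_mem_simplexEq (ι : Type) [Fintype ι] : ∀ᵐ x ∂(simplexEqUniform ι), x ∈ simplexEq ι := by
  have hm : MeasurableSet (simplexEq ι) := by
    unfold simplexEq
    measurability
  exact Measure.ae_smul_measure (ae_restrict_mem hm) _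

lemma measurable_toLp_normalize (ι : Type) [Fintype ι] :
    Measurable fun x : ι → ℝ => (WithLp.toLp 2 (normalize x) : EuclideanSpace ℝ ι) :=
  (WithLp.measurable_toLp 2 (ι → ℝ)).comp measurable_normalize

lemma integral_coord_simplexEqUniform {ι : Type} [Fintype ι] [Nonempty ι]
    (h : IsProbabilityMeasure (simplexEqUniform ι)) (i : ι) :
    ∫ x, x i ∂(simplexEqUniform ι) = 1 := by
  classical
  have hmeas : ∀ j : ι, Measurable fun x : EuclideanSpace ℝ ι => x j := fun j => by fun_prop
  have hinteg : ∀ j : ι, Integrable (fun x : EuclideanSpace ℝ ι => x j) (simplexEqUniform ι) :=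
    fun j => by
    refine Integrable.of_bound (hmeas j).aestronglyMeasurable (Fintype.card ι : ℝ) ?_
    filter_upwards [ae_mem_simplexEq ι] with x hx
    rw [Real.norm_eq_abs, abs_of_nonneg (hx.1 j), ← hx.2]
    exact Finset.single_le_sum (f := fun i => x i) (fun k _ => hx.1 k) (Finset.mem_univ j)
  have hsymm : ∀ j : ι, ∫ x, x j ∂(simplexEqUniform ι) = ∫ x, x i ∂(simplexEqUniform ι) :=
    fun j => by
    rw [simplexEqUniform_eq_map_normalize h,
      integral_map (measurable_toLp_normalize ι).aemeasurable (hmeas j).aestronglyMeasurable,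
      integral_map (measurable_toLp_normalize ι).aemeasurable (hmeas i).aestronglyMeasurable,
      integral_comp_of_measurePreserving (measurePreserving_expPi_relabel (Equiv.swap i j))
        (g := fun x => (WithLp.toLp 2 (normalize x) : EuclideanSpace ℝ ι) j)
        ((hmeas j).comp (measurable_toLp_normalize ι)).aestronglyMeasurable]
    refine integral_congr_ae (Eventually.of_forall fun x => ?_)
    simp [normalize, Equiv.sum_comp (Equiv.swap i j) x]
  have hsum : ∫ x, ∑ j, x j ∂(simplexEqUniform ι) = Fintype.card ι := by
    rw [integral_congr_ae (g := fun _ => (Fintype.card ι : ℝ))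
      ((ae_mem_simplexEq ι).mono fun x hx => hx.2)]
    simp
  rw [integral_finsetSum _ fun j _ => hinteg j, Finset.sum_congr rfl fun j _ => hsymm j,
    Finset.sum_const, Finset.card_univ, nsmul_eq_mul] at hsum
  have : (Fintype.card ι : ℝ) ≠ 0 := by exact_mod_cast Fintype.card_ne_zero
  exact mul_left_cancel₀ this (by rw [hsum, mul_one])

lemma summable_exp_neg_mul_rpow {ε : ℝ} (hε : 0 < ε) :
    Summable fun n : ℕ => rexp (-ε * (n : ℝ) ^ (1 / 8 : ℝ)) := by
  have h := (isLittleO_exp_neg_mul_rpow_atTop hε (-16)).comp_tendsto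
    ((tendsto_rpow_atTop (by norm_num : (0 : ℝ) < 1 / 8)).comp tendsto_natCast_atTop_atTop)
  refine summable_of_isBigO_nat (Real.summable_nat_rpow.2 (by norm_num : (-2 : ℝ) < -1)) ?_
  refine h.isBigO.congr_right fun n => ?_
  simp only [Function.comp]
  rw [← Real.rpow_mul (Nat.cast_nonneg n)]; norm_num

/-- For `M = ⌊ξ N⌋` the grids `□_{N,M}` eventually have comparable side lengths. -/
lemma eventually_grid_regular {ξ : ℝ} (hξ : 0 < ξ) {δ : ℝ} (hδ : δ = ξ / (2 * (1 + ξ) ^ 2)) :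
    ∀ᶠ N : ℕ in atTop, 1 ≤ N ∧ 1 ≤ ⌊ξ * (N : ℝ)⌋₊ ∧
      δ * ((N : ℝ) + (⌊ξ * (N : ℝ)⌋₊ : ℕ)) ^ 2 ≤ N * (⌊ξ * (N : ℝ)⌋₊ : ℕ) ∧
      8 ≤ ⌊ξ * (N : ℝ)⌋₊ + N - 1 ∧ 2 / δ ≤ ((⌊ξ * (N : ℝ)⌋₊ + N - 1 : ℕ) : ℝ) := by
  filter_upwards [eventually_ge_atTop 8, eventually_ge_atTop ⌈2 / ξ⌉₊,
    eventually_ge_atTop ⌈2 / δ⌉₊] with N h8 h2 hd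
  have h2' : 2 ≤ ξ * N := by
    have := (Nat.le_ceil _).trans (Nat.cast_le (α := ℝ).2 h2)
    rw [div_le_iff₀ hξ] at this; linarith
  have hd' : 2 / δ ≤ N := (Nat.le_ceil _).trans (Nat.cast_le (α := ℝ).2 hd)
  set M := ⌊ξ * (N : ℝ)⌋₊ with hM
  have hM1 : 1 ≤ M := Nat.one_le_floor_iff _ |>.2 (by linarith)
  have hMle : (M : ℝ) ≤ ξ * N := Nat.floor_le (by positivity)
  have hMge : ξ * N < M + 1 := Nat.lt_floor_add_one _
  refine ⟨by omega, hM1, ?_, by omega, hd'.trans (by exact_mod_cast (by omega))⟩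
  have hN0 : (0 : ℝ) ≤ N := Nat.cast_nonneg N
  calc δ * ((N : ℝ) + M) ^ 2 ≤ δ * ((1 + ξ) * N) ^ 2 := by
        have : 0 ≤ δ := by rw [hδ]; positivity
        gcongr; linarith
    _ = N * (ξ * N / 2) := by rw [hδ]; field_simp
    _ ≤ N * M := by gcongr; linarith

/-- Almost surely, quenched averages are asymptotically equal to annealed ones. -/
lemma ae_tendsto_pathAvgCentered_sub {ξ : ℝ} (hξ : 0 < ξ) {M : ℕ → ℕ}
    (hM : ∀ N, M N = ⌊ξ * (N : ℝ)⌋₊) {Ω : Type} [MeasurableSpace Ω] {P : Measure Ω}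
    [IsProbabilityMeasure P] {W : ∀ N : ℕ, Ω → EuclideanSpace ℝ ↥(box N (M N))}
    (hmeas : ∀ N, Measurable (W N))
    (hlaw : ∀ N, Measure.map (W N) P = simplexEqUniform ↥(box N (M N)))
    {f : ℝ → ℝ} (hf : ∀ x y, |f x - f y| ≤ |x - y|) :
    ∀ᵐ ω ∂P, Tendsto (fun N => pathAvgCentered N (M N) (fun a => W N ω a) (fun _ => 1) f -
      annealedAvg N (M N) f) atTop (nhds 0) := by
  obtain ⟨δ, hδ⟩ : ∃ δ, δ = ξ / (2 * (1 + ξ) ^ 2) := ⟨_, rfl⟩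
  have hδ0 : 0 < δ := by rw [hδ]; positivity
  have hreg := eventually_grid_regular hξ hδ
  simp_rw [← hM] at hreg
  set good : ℕ → Prop := fun N => 1 ≤ N ∧ 1 ≤ M N ∧ δ * ((N : ℝ) + M N) ^ 2 ≤ N * M N ∧
    8 ≤ M N + N - 1 ∧ 2 / δ ≤ ((M N + N - 1 : ℕ) : ℝ) with hgood
  have key : ∀ k : ℕ, ∀ᵐ ω ∂P, ∀ᶠ N in atTop,
      |pathAvgCentered N (M N) (fun a => W N ω a) (fun _ => 1) f - annealedAvg N (M N) f| <
        1 / ((k : ℝ) + 2) + 6 * ((M N + N - 1 : ℕ) : ℝ) ^ (-(1 / 4) : ℝ) := by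
    intro k
    set ε : ℝ := 1 / ((k : ℝ) + 2) with hε
    have hε0 : 0 < ε := by positivity
    have hε2 : ε ≤ 1 / 2 := by
      rw [hε]; gcongr; linarith [(Nat.cast_nonneg k : (0 : ℝ) ≤ k)]
    set A : ∀ N, Set (EuclideanSpace ℝ ↥(box N (M N))) := fun N =>
      {y | ε + 6 * ((M N + N - 1 : ℕ) : ℝ) ^ (-(1 / 4) : ℝ) ≤
        |pathAvgCentered N (M N) (fun a => y a) (fun _ => 1) f - annealedAvg N (M N) f|} with hA
    have hAm : ∀ N, MeasurableSet (A N) := fun N => by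
      have hc := (weightedLipschitz_pathAvgCentered hf N (M N) (fun _ => 1)).continuous
      have hc' : Continuous fun y : EuclideanSpace ℝ ↥(box N (M N)) => (fun a => y a) := by fun_prop
      exact measurableSet_le measurable_const
        (((hc.comp hc').sub continuous_const).abs).measurable
    have hbound : ∀ N, P {ω | good N ∧ W N ω ∈ A N} ≤
        6 * ENNReal.ofReal (rexp (4 + 32 / δ) * rexp (-ε * (N : ℝ) ^ (1 / 8 : ℝ))) := by
      intro N
      by_cases hg : good N
      · obtain ⟨hN1, hM1, h1, h2, h3⟩ := id hg
        have := nonempty_box hN1 hM1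
        have hprob : IsProbabilityMeasure (simplexEqUniform ↥(box N (M N))) := by
          rw [← hlaw N]; exact Measure.isProbabilityMeasure_map (hmeas N).aemeasurable
        have heq : P {ω | good N ∧ W N ω ∈ A N} =
            expPi ↥(box N (M N)) {x | WithLp.toLp 2 (normalize x) ∈ A N} := by
          have : {ω | good N ∧ W N ω ∈ A N} = W N ⁻¹' A N := by ext ω; simp [hg]
          rw [this, ← Measure.map_apply (hmeas N) (hAm N), hlaw N,
            simplexEqUniform_eq_map_normalize hprob,
            Measure.map_apply (measurable_toLp_normalize _) (hAm N)]
          rfl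
        rw [heq]
        refine (measure_normalize_deviation_le hf hN1 hM1 hδ0 hε2 h1 h2 h3).trans ?_
        rw [← Real.exp_add]
        have hle : (N : ℝ) ≤ ((M N + N - 1 : ℕ) : ℝ) := by exact_mod_cast (by omega)
        have hle2 : ε * (N : ℝ) ^ (1 / 8 : ℝ) ≤ ε * ((M N + N - 1 : ℕ) : ℝ) ^ (1 / 8 : ℝ) := by
          gcongr
        gcongr 6 * ENNReal.ofReal (rexp ?_)
        linarith
      · simp [hg]
    have hsum : ∑' N, P {ω | good N ∧ W N ω ∈ A N} ≠ ⊤ := by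
      refine ne_top_of_le_ne_top ?_ (ENNReal.tsum_le_tsum hbound)
      rw [ENNReal.tsum_mul_left]
      refine ENNReal.mul_ne_top (by norm_num) ?_
      exact ((summable_exp_neg_mul_rpow hε0).mul_left _).tsum_ofReal_ne_top
    filter_upwards [ae_eventually_notMem hsum] with ω hω
    filter_upwards [hω, hreg] with N h1 h2
    by_contra hcon
    exact h1 ⟨h2, not_lt.1 hcon⟩
  have hL : Tendsto (fun N : ℕ => 6 * ((M N + N - 1 : ℕ) : ℝ) ^ (-(1 / 4) : ℝ)) atTop (nhds 0) := by
    have h1 : Tendsto (fun N : ℕ => ((M N + N - 1 : ℕ) : ℝ)) atTop atTop := by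
      refine tendsto_natCast_atTop_atTop.comp (tendsto_atTop_mono' _ ?_ tendsto_id)
      filter_upwards [hreg] with N hN
      have := hN.2.1
      simp only [id]; omega
    simpa using ((tendsto_rpow_neg_atTop (by norm_num : (0 : ℝ) < 1 / 4)).comp h1).const_mul 6
  filter_upwards [ae_all_iff.2 key] with ω hω
  rw [tendsto_zero_iff_abs_tendsto_zero]
  refine tendsto_order.2 ⟨fun a ha => Eventually.of_forall fun N => ha.trans_le (abs_nonneg _),
    fun a ha => ?_⟩
  obtain ⟨k, hk⟩ := exists_nat_one_div_lt (half_pos ha)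
  filter_upwards [hω k, hL.eventually_lt_const (half_pos ha)] with N h1 h2
  have h3 : 1 / ((k : ℝ) + 2) ≤ 1 / ((k : ℝ) + 1) := by gcongr; norm_num
  simp only [Function.comp]
  linarith

/-- The centred and rescaled sum of the weights `x` along the set `s` of sites. -/
noncomputable def pathSum (N M : ℕ) (s : Finset (ℕ × ℕ)) (x : ↥(box N M) → ℝ) : ℝ :=
  (√((M + N - 1 : ℕ) : ℝ))⁻¹ * ∑ a : ↥(box N M), if (a : ℕ × ℕ) ∈ s then x a - 1 else 0

lemma pathAvgCentered_one (N M : ℕ) (x : ↥(box N M) → ℝ) (f : ℝ → ℝ) :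
    pathAvgCentered N M x (fun _ => 1) f =
      ((upRightPaths N M).card : ℝ)⁻¹ * ∑ s ∈ upRightPaths N M, f (pathSum N M s x) := rfl

lemma measurable_pathSum (N M : ℕ) (s : Finset (ℕ × ℕ)) : Measurable (pathSum N M s) := by
  unfold pathSum
  refine (Finset.measurable_sum _ fun a _ => ?_).const_mul _
  split_ifs <;> fun_prop

lemma card_filter_mem_box {N M : ℕ} {s : Finset (ℕ × ℕ)} (hs : s ∈ upRightPaths N M) :
    (Finset.univ.filter fun a : ↥(box N M) => (a : ℕ × ℕ) ∈ s).card = s.card := by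
  rw [← Finset.card_map (Function.Embedding.subtype _)]
  congr 1
  ext a
  have := @subset_box_of_mem N M s hs a
  simp only [Finset.mem_map, Finset.mem_filter, Finset.mem_univ, true_and,
    Function.Embedding.subtype_apply, Subtype.exists, exists_and_left, exists_prop]
  constructor
  · rintro ⟨b, hb, _, rfl⟩; exact hb
  · exact fun h => ⟨a, h, this h, rfl⟩

/-- The average of a family of equal annealed path averages. -/
lemma annealedAvg_eq {N M : ℕ} (hN : 1 ≤ N) (hM : 1 ≤ M) {f : ℝ → ℝ} {c : ℝ}
    (hinteg : ∀ s ∈ upRightPaths N M, Integrable (fun x => f (pathSum N M s x)) (expPi ↥(box N M)))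
    (h : ∀ s ∈ upRightPaths N M, ∫ x, f (pathSum N M s x) ∂(expPi ↥(box N M)) = c) :
    annealedAvg N M f = c := by
  simp_rw [annealedAvg, pathAvgCentered_one]
  rw [integral_const_mul, integral_finsetSum _ hinteg, Finset.sum_congr rfl h, Finset.sum_const,
    nsmul_eq_mul, ← mul_assoc, inv_mul_cancel₀, one_mul]
  exact_mod_cast (card_upRightPaths_pos hN hM).ne'

lemma charFun_map_pathSum {N M : ℕ} (hN : 1 ≤ N) (hM : 1 ≤ M) {s : Finset (ℕ × ℕ)}
    (hs : s ∈ upRightPaths N M) (t : ℝ) :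
    charFun ((expPi ↥(box N M)).map (pathSum N M s)) t =
      charFun ((expMeasure 1).map fun x => x - 1)
        ((√((M + N - 1 : ℕ) : ℝ))⁻¹ * t) ^ (M + N - 1) := by
  set L : ℝ := ((M + N - 1 : ℕ) : ℝ)
  rw [charFun_apply_real, integral_map (measurable_pathSum N M s).aemeasurable (by fun_prop),
    charFun_apply_real, integral_map (by fun_prop) (by fun_prop)]
  set φ := ∫ x, Complex.exp (((√L)⁻¹ * t : ℝ) * ((x - 1 : ℝ) : ℂ) * Complex.I) ∂(expMeasure 1)
    with hφ
  set g : ↥(box N M) → ℝ → ℂ := fun a y => if (a : ℕ × ℕ) ∈ s then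
    Complex.exp (((√L)⁻¹ * t : ℝ) * ((y - 1 : ℝ) : ℂ) * Complex.I) else 1 with hg
  have h1 : ∀ x, Complex.exp (t * (pathSum N M s x : ℂ) * Complex.I) = ∏ a, g a (x a) := fun x => by
    have : (t * (pathSum N M s x : ℂ) * Complex.I) = ∑ a : ↥(box N M), if (a : ℕ × ℕ) ∈ s then
        ((√L)⁻¹ * t : ℝ) * ((x a - 1 : ℝ) : ℂ) * Complex.I else 0 := by
      rw [pathSum, Complex.ofReal_mul, Complex.ofReal_sum, Finset.mul_sum, Finset.mul_sum,
        Finset.sum_mul]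
      refine Finset.sum_congr rfl fun a _ => ?_
      split_ifs
      · push_cast; ring
      · simp
    rw [this, Complex.exp_sum]
    refine Finset.prod_congr rfl fun a _ => ?_
    simp only [hg]
    split_ifs <;> simp
  simp_rw [h1]
  rw [expPi, integral_fintype_prod_eq_prod]
  have h2 : ∀ a, ∫ y, g a y ∂(expMeasure 1) = if (a : ℕ × ℕ) ∈ s then φ else 1 := fun a => by
    simp only [hg]
    split_ifs <;> simp [hφ]
  simp_rw [h2]
  rw [Finset.prod_ite, Finset.prod_const, Finset.prod_const_one, mul_one, card_filter_mem_box hs,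
    card_of_mem_upRightPaths hN hM hs]

lemma integral_cos_sin_eq_charFun {α : Type*} [MeasurableSpace α] (μ : Measure α)
    [IsProbabilityMeasure μ] {X : α → ℝ} (hX : Measurable X) (t : ℝ) :
    ∫ x, Real.cos (t * X x) ∂μ = (charFun (μ.map X) t).re ∧
      ∫ x, Real.sin (t * X x) ∂μ = (charFun (μ.map X) t).im := by
  rw [charFun_apply_real, integral_map hX.aemeasurable (by fun_prop)]
  have hinteg : Integrable (fun x => Complex.exp (t * X x * Complex.I)) μ := by
    refine Integrable.of_bound (by fun_prop) 1 (Eventually.of_forall fun x => ?_)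
    rw [← Complex.ofReal_mul, Complex.norm_exp_ofReal_mul_I]
  have h1 := integral_re hinteg
  have h2 := integral_im hinteg
  simp only [RCLike.re_to_complex, RCLike.im_to_complex] at h1 h2
  rw [← h1, ← h2]
  constructor <;> refine integral_congr_ae (Eventually.of_forall fun x => ?_) <;>
    simp only [← Complex.ofReal_mul, Complex.exp_ofReal_mul_I_re, Complex.exp_ofReal_mul_I_im]

lemma annealedAvg_cos_sin {N M : ℕ} (hN : 1 ≤ N) (hM : 1 ≤ M) (t : ℝ) :
    annealedAvg N M (fun x => Real.cos (t * x)) =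
      (charFun ((expMeasure 1).map fun x => x - 1)
        ((√((M + N - 1 : ℕ) : ℝ))⁻¹ * t) ^ (M + N - 1)).re ∧
    annealedAvg N M (fun x => Real.sin (t * x)) =
      (charFun ((expMeasure 1).map fun x => x - 1)
        ((√((M + N - 1 : ℕ) : ℝ))⁻¹ * t) ^ (M + N - 1)).im := by
  have hm := measurable_pathSum N M
  constructor
  · refine annealedAvg_eq hN hM (fun s _ => ?_) fun s hs => ?_
    · exact Integrable.of_bound (((hm s).const_mul t).cos).aestronglyMeasurable 1
        (Eventually.of_forall fun x => Real.abs_cos_le_one _)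
    · rw [(integral_cos_sin_eq_charFun _ (hm s) t).1, charFun_map_pathSum hN hM hs]
  · refine annealedAvg_eq hN hM (fun s _ => ?_) fun s hs => ?_
    · exact Integrable.of_bound (((hm s).const_mul t).sin).aestronglyMeasurable 1
        (Eventually.of_forall fun x => Real.abs_sin_le_one _)
    · rw [(integral_cos_sin_eq_charFun _ (hm s) t).2, charFun_map_pathSum hN hM hs]

lemma tendsto_charFun_expMeasure (t : ℝ) :
    Tendsto (fun n : ℕ => charFun ((expMeasure 1).map fun x => x - 1) ((√(n : ℝ))⁻¹ * t) ^ n) atTop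
      (nhds (rexp (-t ^ 2 / 2) : ℝ)) := by
  have h := tendsto_charFun_inv_sqrt_mul_pow (P := expMeasure 1) (X := fun x : ℝ => x - 1)
    (by fun_prop) integral_sub_one_expMeasure integral_sub_one_sq_expMeasure t
  convert h using 2
  push_cast; rfl

lemma memLp_sub_one_expMeasure : MemLp (fun x : ℝ => x - 1) 2 (expMeasure 1) := by
  refine (memLp_two_iff_integrable_sq (by fun_prop)).2 ?_
  by_contra hcon
  have := integral_undef hcon
  rw [integral_sub_one_sq_expMeasure] at this
  exact one_ne_zero this

lemma memLp_comp_eval_expPi {ι : Type} [Fintype ι] (i : ι) {g : ℝ → ℝ}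
    (hg : MemLp g 2 (expMeasure 1)) : MemLp (fun x => g (x i)) 2 (expPi ι) :=
  hg.comp_measurePreserving (measurePreserving_eval (fun _ : ι => expMeasure 1) i)

lemma memLp_pathSum (N M : ℕ) (s : Finset (ℕ × ℕ)) :
    MemLp (pathSum N M s) 2 (expPi ↥(box N M)) := by
  have h : ∀ a : ↥(box N M), MemLp (fun x : ↥(box N M) → ℝ =>
      if (a : ℕ × ℕ) ∈ s then x a - 1 else 0) 2 (expPi ↥(box N M)) := fun a => by
    split_ifs
    · exact memLp_comp_eval_expPi a memLp_sub_one_expMeasure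
    · exact MemLp.zero'
  exact (memLp_finsetSum Finset.univ fun a _ => h a).const_mul (√((M + N - 1 : ℕ) : ℝ))⁻¹

lemma integral_pathSum_sq {N M : ℕ} (hN : 1 ≤ N) (hM : 1 ≤ M) {s : Finset (ℕ × ℕ)}
    (hs : s ∈ upRightPaths N M) : ∫ x, pathSum N M s x ^ 2 ∂(expPi ↥(box N M)) = 1 := by
  have hL : ((M + N - 1 : ℕ) : ℝ) ≠ 0 := by
    have : M + N - 1 ≠ 0 := by omega
    exact_mod_cast this
  set X : ↥(box N M) → ℝ → ℝ := fun a y => if (a : ℕ × ℕ) ∈ s then y - 1 else 0 with hX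
  have hXm : ∀ a, MemLp (X a) 2 (expMeasure 1) := fun a => by
    simp only [hX]
    split_ifs
    · exact memLp_sub_one_expMeasure
    · exact MemLp.zero
  have hX0 : ∀ a, ∫ y, X a y ∂(expMeasure 1) = 0 := fun a => by
    simp only [hX]
    split_ifs
    · exact integral_sub_one_expMeasure
    · simp
  have hXv : ∀ a : ↥(box N M), Var[X a; expMeasure 1] = if (a : ℕ × ℕ) ∈ s then 1 else 0 :=
    fun a => by
    rw [variance_of_integral_eq_zero (hXm a).aemeasurable (hX0 a)]
    simp only [hX]
    split_ifs
    · exact integral_sub_one_sq_expMeasure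
    · simp
  have hY : ∀ a, MemLp (fun x : ↥(box N M) → ℝ => X a (x a)) 2 (expPi ↥(box N M)) := fun a =>
    memLp_comp_eval_expPi a (hXm a)
  have hsum : pathSum N M s = fun x => (√((M + N - 1 : ℕ) : ℝ))⁻¹ *
      (∑ a, fun x : ↥(box N M) → ℝ => X a (x a)) x := by
    ext x; simp only [pathSum, Finset.sum_apply, hX]
  have hmean : ∫ x, pathSum N M s x ∂(expPi ↥(box N M)) = 0 := by
    simp only [hsum, Finset.sum_apply]
    rw [integral_const_mul, integral_finsetSum _ fun a _ => (hY a).integrable one_le_two,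
      Finset.sum_eq_zero fun a _ => ?_, mul_zero]
    rw [integral_comp_eval_expPi a (by simp only [hX]; split_ifs <;> fun_prop), hX0 a]
  rw [← variance_of_integral_eq_zero (measurable_pathSum N M s).aemeasurable hmean, hsum,
    variance_const_mul, expPi, variance_sum_pi hXm, Finset.sum_congr rfl fun a _ => hXv a,
    Finset.sum_boole, card_filter_mem_box hs, card_of_mem_upRightPaths hN hM hs, inv_pow,
    Real.sq_sqrt (Nat.cast_nonneg _), inv_mul_cancel₀ hL]

lemma annealedAvg_abs_le {N M : ℕ} (hN : 1 ≤ N) (hM : 1 ≤ M) :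
    annealedAvg N M (fun x => |x|) ≤ 1 := by
  have hinteg : ∀ s, Integrable (fun x => |pathSum N M s x|) (expPi ↥(box N M)) := fun s =>
    ((memLp_pathSum N M s).integrable one_le_two).abs
  have h : ∀ s ∈ upRightPaths N M, ∫ x, |pathSum N M s x| ∂(expPi ↥(box N M)) ≤ 1 := by
    intro s hs
    have hsq := (memLp_pathSum N M s).integrable_sq
    calc ∫ x, |pathSum N M s x| ∂(expPi ↥(box N M))
        ≤ ∫ x, (1 / 2 + 1 / 2 * pathSum N M s x ^ 2) ∂(expPi ↥(box N M)) := by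
          refine integral_mono (hinteg s) ((integrable_const _).add (hsq.const_mul _)) fun x => ?_
          have := sq_nonneg (|pathSum N M s x| - 1)
          have h2 := sq_abs (pathSum N M s x)
          simp only
          nlinarith
      _ = 1 := by
          rw [integral_add (integrable_const _) (hsq.const_mul _), integral_const_mul,
            integral_pathSum_sq hN hM hs]
          simp; norm_num
  simp_rw [annealedAvg, pathAvgCentered_one]
  rw [integral_const_mul, integral_finsetSum _ fun s _ => hinteg s, inv_mul_le_iff₀
    (by exact_mod_cast card_upRightPaths_pos hN hM), mul_one]
  simpa using Finset.sum_le_sum h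

/-- The uniform law on the points `T s`, `s ∈ S`. -/
noncomputable def empiricalLaw {κ : Type*} (S : Finset κ) (T : κ → ℝ) : Measure ℝ :=
  (S.card : ENNReal)⁻¹ • ∑ s ∈ S, Measure.dirac (T s)

lemma isProbabilityMeasure_empiricalLaw {κ : Type*} {S : Finset κ} (hS : S.Nonempty) (T : κ → ℝ) :
    IsProbabilityMeasure (empiricalLaw S T) := by
  refine ⟨?_⟩
  simp only [empiricalLaw, Measure.smul_apply, Measure.finsetSum_apply, measure_univ,
    Finset.sum_const, nsmul_eq_mul, mul_one, smul_eq_mul]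
  exact ENNReal.inv_mul_cancel (by exact_mod_cast hS.card_pos.ne') (ENNReal.natCast_ne_top _)

lemma integral_empiricalLaw {κ E : Type*} [NormedAddCommGroup E] [NormedSpace ℝ E]
    [CompleteSpace E] (S : Finset κ) (T : κ → ℝ) (f : ℝ → E) :
    ∫ x, f x ∂(empiricalLaw S T) = (S.card : ℝ)⁻¹ • ∑ s ∈ S, f (T s) := by
  rw [empiricalLaw, integral_smul_measure, integral_finsetSum_measure fun s _ =>
    integrable_dirac (by simp)]
  simp

lemma charFun_empiricalLaw {κ : Type*} (S : Finset κ) (T : κ → ℝ) (t : ℝ) :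
    charFun (empiricalLaw S T) t =
      (((S.card : ℝ)⁻¹ * ∑ s ∈ S, Real.cos (t * T s) : ℝ) : ℂ) +
        (((S.card : ℝ)⁻¹ * ∑ s ∈ S, Real.sin (t * T s) : ℝ) : ℂ) * Complex.I := by
  rw [charFun_apply_real, integral_empiricalLaw]
  simp_rw [← Complex.ofReal_mul, Complex.exp_mul_I, Finset.sum_add_distrib, ← Finset.sum_mul,
    Complex.real_smul]
  push_cast
  ring

lemma tendsto_average_of_tendsto_charFun {κ : Type*} {S : ℕ → Finset κ} {T : ℕ → κ → ℝ}
    (hS : ∀ᶠ n in atTop, (S n).Nonempty)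
    (hc : ∀ t : ℝ, Tendsto (fun n => charFun (empiricalLaw (S n) (T n)) t) atTop
      (nhds (charFun (gaussianReal 0 1) t)))
    {f : ℝ → ℝ} (hf : Continuous f) {B : ℝ} (hB : ∀ x, |f x| ≤ B) :
    Tendsto (fun n => ((S n).card : ℝ)⁻¹ * ∑ s ∈ S n, f (T n s)) atTop
      (nhds (∫ x, f x ∂(gaussianReal 0 1))) := by
  classical
  set μ : ℕ → ProbabilityMeasure ℝ := fun n => if h : (S n).Nonempty then
    ⟨empiricalLaw (S n) (T n), isProbabilityMeasure_empiricalLaw h (T n)⟩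
    else ⟨Measure.dirac 0, inferInstance⟩
  have hμS : ∀ᶠ n in atTop, (μ n : Measure ℝ) = empiricalLaw (S n) (T n) := by
    filter_upwards [hS] with n hn
    have h : μ n = ⟨empiricalLaw (S n) (T n), isProbabilityMeasure_empiricalLaw hn (T n)⟩ :=
      dif_pos hn
    rw [h]; rfl
  set γ : ProbabilityMeasure ℝ := ⟨gaussianReal 0 1, inferInstance⟩
  have hlim : Tendsto μ atTop (nhds γ) := by
    refine ProbabilityMeasure.tendsto_iff_tendsto_charFun.2 fun t => (hc t).congr' ?_
    filter_upwards [hμS] with n hn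
    rw [hn]
  have h := ProbabilityMeasure.tendsto_iff_forall_integral_tendsto.1 hlim
    (BoundedContinuousFunction.ofNormedAddCommGroup f hf B hB)
  refine h.congr' ?_
  filter_upwards [hμS] with n hn
  rw [hn, integral_empiricalLaw]
  rfl

/-- Pointwise convergence at rational points of equi-Lipschitz functions extends to all reals. -/
lemma tendsto_of_tendsto_rat {g : ℕ → ℝ → ℝ} {G : ℝ → ℝ} {K : ℝ} (hG : Continuous G)
    (hg : ∀ q : ℚ, Tendsto (fun n => g n q) atTop (nhds (G q)))
    (hL : ∀ᶠ n in atTop, ∀ s t, |g n s - g n t| ≤ K * |s - t|) (t : ℝ) :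
    Tendsto (fun n => g n t) atTop (nhds (G t)) := by
  rw [Metric.tendsto_nhds]
  intro ε hε
  have h1 : Tendsto (fun u => K * |u - t|) (nhds t) (nhds 0) := by
    have : Continuous fun u => K * |u - t| := by fun_prop
    simpa using this.tendsto t
  obtain ⟨q, hq1, hq2⟩ := Rat.denseRange_cast.mem_nhds
    ((h1.eventually_lt_const (by positivity : 0 < ε / 3)).and
      (Metric.tendsto_nhds.1 (hG.tendsto t) (ε / 3) (by positivity)))
  filter_upwards [hL, Metric.tendsto_nhds.1 (hg q) (ε / 3) (by positivity)] with n h2 h3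
  have h4 := h2 q t
  rw [Real.dist_eq] at hq2 h3 ⊢
  rw [abs_lt] at hq2 h3 ⊢
  rw [abs_le] at h4
  constructor <;> linarith [h4.1, h4.2, hq2.1, hq2.2, h3.1, h3.2]

lemma abs_average_sub_le {κ : Type*} (S : Finset κ) (T : κ → ℝ) {h : ℝ → ℝ}
    (hh : ∀ x y, |h x - h y| ≤ |x - y|) {B : ℝ}
    (hB : (S.card : ℝ)⁻¹ * ∑ s ∈ S, |T s| ≤ B) (u t : ℝ) :
    |(S.card : ℝ)⁻¹ * ∑ s ∈ S, h (u * T s) - (S.card : ℝ)⁻¹ * ∑ s ∈ S, h (t * T s)| ≤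
      B * |u - t| := by
  rw [← mul_sub, ← Finset.sum_sub_distrib, abs_mul, abs_of_nonneg (by positivity)]
  calc (S.card : ℝ)⁻¹ * |∑ s ∈ S, (h (u * T s) - h (t * T s))|
      ≤ (S.card : ℝ)⁻¹ * ∑ s ∈ S, |T s| * |u - t| := by
        gcongr
        refine (Finset.abs_sum_le_sum_abs _ _).trans (Finset.sum_le_sum fun s _ => ?_)
        refine (hh _ _).trans_eq ?_
        rw [← sub_mul, abs_mul, mul_comm]
    _ = ((S.card : ℝ)⁻¹ * ∑ s ∈ S, |T s|) * |u - t| := by rw [← Finset.sum_mul, mul_assoc]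
    _ ≤ B * |u - t| := by gcongr

lemma pathAvgCentered_const_mul (N M : ℕ) (x b : ↥(box N M) → ℝ) (c : ℝ) (f : ℝ → ℝ) :
    pathAvgCentered N M x b (fun y => c * f y) = c * pathAvgCentered N M x b f := by
  simp only [pathAvgCentered, ← Finset.mul_sum]; ring

lemma annealedAvg_const_mul (N M : ℕ) (c : ℝ) (f : ℝ → ℝ) :
    annealedAvg N M (fun y => c * f y) = c * annealedAvg N M f := by
  simp only [annealedAvg, pathAvgCentered_const_mul, integral_const_mul]

section Simplex

variable {ξ : ℝ} {M : ℕ → ℕ} {Ω : Type} [MeasurableSpace Ω] {P : Measure Ω}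
  [IsProbabilityMeasure P] {W : ∀ N : ℕ, Ω → EuclideanSpace ℝ ↥(box N (M N))}

lemma ae_tendsto_pathAvgCentered_of_annealedAvg (hξ : 0 < ξ)
    (hM : ∀ N, M N = ⌊ξ * (N : ℝ)⌋₊) (hmeas : ∀ N, Measurable (W N))
    (hlaw : ∀ N, Measure.map (W N) P = simplexEqUniform ↥(box N (M N)))
    {f : ℝ → ℝ} {K l : ℝ} (hK : 0 < K) (hf : ∀ x y, |f x - f y| ≤ K * |x - y|)
    (hl : Tendsto (fun N => annealedAvg N (M N) f) atTop (nhds l)) :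
    ∀ᵐ ω ∂P, Tendsto (fun N => pathAvgCentered N (M N) (fun a => W N ω a) (fun _ => 1) f)
      atTop (nhds l) := by
  have hf' : ∀ x y, |K⁻¹ * f x - K⁻¹ * f y| ≤ |x - y| := fun x y => by
    rw [← mul_sub, abs_mul, abs_of_pos (inv_pos.2 hK), inv_mul_le_iff₀ hK]
    exact hf x y
  filter_upwards [ae_tendsto_pathAvgCentered_sub hξ hM hmeas hlaw hf'] with ω hω
  simp_rw [pathAvgCentered_const_mul, annealedAvg_const_mul] at hω
  have h := (hω.const_mul K).add hl
  simp only [mul_zero, zero_add] at h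
  refine h.congr fun N => ?_
  field_simp
  ring

lemma tendsto_annealedAvg_cos_sin (hξ : 0 < ξ) (hM : ∀ N, M N = ⌊ξ * (N : ℝ)⌋₊) (t : ℝ) :
    Tendsto (fun N => annealedAvg N (M N) fun x => Real.cos (t * x)) atTop
      (nhds (rexp (-t ^ 2 / 2))) ∧
    Tendsto (fun N => annealedAvg N (M N) fun x => Real.sin (t * x)) atTop (nhds 0) := by
  have hreg := eventually_grid_regular hξ rfl
  simp_rw [← hM] at hreg
  have hL : Tendsto (fun N : ℕ => M N + N - 1) atTop atTop := by
    refine tendsto_atTop_mono' _ ?_ tendsto_id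
    filter_upwards [hreg] with N hN
    have := hN.2.1
    simp only [id]; omega
  have h := (tendsto_charFun_expMeasure t).comp hL
  constructor
  · have h1 := (Complex.continuous_re.tendsto _).comp h
    rw [Complex.ofReal_re] at h1
    refine h1.congr' ?_
    filter_upwards [hreg] with N hN
    exact (annealedAvg_cos_sin hN.1 hN.2.1 t).1.symm
  · have h1 := (Complex.continuous_im.tendsto _).comp h
    rw [Complex.ofReal_im] at h1
    refine h1.congr' ?_
    filter_upwards [hreg] with N hN
    exact (annealedAvg_cos_sin hN.1 hN.2.1 t).2.symm

lemma eventually_integral_coord_eq_one (hξ : 0 < ξ) (hM : ∀ N, M N = ⌊ξ * (N : ℝ)⌋₊)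
    (hmeas : ∀ N, Measurable (W N))
    (hlaw : ∀ N, Measure.map (W N) P = simplexEqUniform ↥(box N (M N))) :
    ∀ᶠ N in atTop, (fun a : ↥(box N (M N)) => ∫ ω, W N ω a ∂P) = fun _ => 1 := by
  have hreg := eventually_grid_regular hξ rfl
  simp_rw [← hM] at hreg
  filter_upwards [hreg] with N hN
  have := nonempty_box hN.1 hN.2.1
  have hprob : IsProbabilityMeasure (simplexEqUniform ↥(box N (M N))) := by
    rw [← hlaw N]; exact Measure.isProbabilityMeasure_map (hmeas N).aemeasurable
  ext a
  rw [← integral_coord_simplexEqUniform hprob a, ← hlaw N,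
    integral_map (hmeas N).aemeasurable (by fun_prop)]

/-- Almost surely, the characteristic function of the quenched law converges pointwise. -/
lemma ae_tendsto_charFun_quenched (hξ : 0 < ξ) (hM : ∀ N, M N = ⌊ξ * (N : ℝ)⌋₊)
    (hmeas : ∀ N, Measurable (W N))
    (hlaw : ∀ N, Measure.map (W N) P = simplexEqUniform ↥(box N (M N))) :
    ∀ᵐ ω ∂P, ∀ t : ℝ, Tendsto (fun N => charFun (empiricalLaw (upRightPaths N (M N))
      fun s => pathSum N (M N) s fun a => W N ω a) t) atTop
        (nhds (charFun (gaussianReal 0 1) t)) := by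
  have hreg := eventually_grid_regular hξ rfl
  simp_rw [← hM] at hreg
  have hcos : ∀ᵐ ω ∂P, ∀ q : ℚ, Tendsto (fun N => pathAvgCentered N (M N) (fun a => W N ω a)
      (fun _ => 1) fun x => Real.cos (q * x)) atTop (nhds (rexp (-(q : ℝ) ^ 2 / 2))) :=
    ae_all_iff.2 fun q => ae_tendsto_pathAvgCentered_of_annealedAvg hξ hM hmeas hlaw
      (by positivity : 0 < |(q : ℝ)| + 1) (fun x y => by
        refine (Real.abs_cos_sub_cos_le _ _).trans ?_
        rw [← mul_sub, abs_mul]; gcongr; linarith) (tendsto_annealedAvg_cos_sin hξ hM q).1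
  have hsin : ∀ᵐ ω ∂P, ∀ q : ℚ, Tendsto (fun N => pathAvgCentered N (M N) (fun a => W N ω a)
      (fun _ => 1) fun x => Real.sin (q * x)) atTop (nhds 0) :=
    ae_all_iff.2 fun q => ae_tendsto_pathAvgCentered_of_annealedAvg hξ hM hmeas hlaw
      (by positivity : 0 < |(q : ℝ)| + 1) (fun x y => by
        refine (Real.abs_sin_sub_sin_le _ _).trans ?_
        rw [← mul_sub, abs_mul]; gcongr; linarith) (tendsto_annealedAvg_cos_sin hξ hM q).2
  filter_upwards [hcos, hsin, ae_tendsto_pathAvgCentered_sub hξ hM hmeas hlaw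
    abs_abs_sub_abs_le] with ω h1 h2 h3 t
  have hbd : ∀ᶠ N in atTop, ((upRightPaths N (M N)).card : ℝ)⁻¹ *
      ∑ s ∈ upRightPaths N (M N), |pathSum N (M N) s fun a => W N ω a| ≤ 2 := by
    filter_upwards [hreg, h3.eventually_lt_const one_pos] with N hN h
    rw [pathAvgCentered_one] at h
    linarith [annealedAvg_abs_le hN.1 hN.2.1]
  simp only [pathAvgCentered_one] at h1 h2
  simp only [charFun_empiricalLaw]
  have hc := tendsto_of_tendsto_rat (g := fun N t => ((upRightPaths N (M N)).card : ℝ)⁻¹ *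
      ∑ s ∈ upRightPaths N (M N), Real.cos (t * pathSum N (M N) s fun a => W N ω a)) (G := fun t => rexp (-t ^ 2 / 2)) (by fun_prop) h1
    (hbd.mono fun N hN => abs_average_sub_le _ _ Real.abs_cos_sub_cos_le hN) t
  have hs := tendsto_of_tendsto_rat (g := fun N t => ((upRightPaths N (M N)).card : ℝ)⁻¹ *
      ∑ s ∈ upRightPaths N (M N), Real.sin (t * pathSum N (M N) s fun a => W N ω a)) (G := fun _ => 0) (by fun_prop) h2
    (hbd.mono fun N hN => abs_average_sub_le _ _ Real.abs_sin_sub_sin_le hN) t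
  have hlim := ((Complex.continuous_ofReal.tendsto _).comp hc).add
    (((Complex.continuous_ofReal.tendsto _).comp hs).mul_const Complex.I)
  have hγ : charFun (gaussianReal 0 1) t =
      ((rexp (-t ^ 2 / 2) : ℝ) : ℂ) + ((0 : ℝ) : ℂ) * Complex.I := by
    rw [charFun_gaussianReal]
    simp [neg_div]
  rw [hγ]
  exact hlim

end Simplex

end UpRightPath

/-- Quenched CLT along up-right paths with weights uniform on the simplex `Δ_{(MN,=)}`. -/
theorem stmt11
    (ξ : ℝ) (hξ : 0 < ξ)
    (M : ℕ → ℕ) (hM : ∀ N, M N = ⌊ξ * (N : ℝ)⌋₊)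
    (Ω : Type) [MeasurableSpace Ω] (P : Measure Ω) [IsProbabilityMeasure P]
    (W : ∀ N : ℕ, Ω → EuclideanSpace ℝ ↥(box N (M N)))
    (hmeas : ∀ N, Measurable (W N))
    (hlaw : ∀ N, Measure.map (W N) P = simplexEqUniform ↥(box N (M N))) :
    ∀ᵐ ω ∂P, ∀ f : ℝ → ℝ, (∃ B, ∀ x, |f x| ≤ B) → LipschitzWith 1 f →
      Tendsto
        (fun N => pathAvgCentered N (M N) (fun a => W N ω a)
          (fun a => ∫ ω', W N ω' a ∂P) f)
        atTop (nhds (∫ x, f x ∂(gaussianReal 0 1))) := by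
  have hreg := UpRightPath.eventually_grid_regular hξ rfl
  simp_rw [← hM] at hreg
  filter_upwards [UpRightPath.ae_tendsto_charFun_quenched hξ hM hmeas hlaw] with ω hω f hB hf
  obtain ⟨B, hB⟩ := hB
  have hne : ∀ᶠ N in atTop, (upRightPaths N (M N)).Nonempty := by
    filter_upwards [hreg] with N hN
    exact Finset.card_pos.1 (UpRightPath.card_upRightPaths_pos hN.1 hN.2.1)
  refine (UpRightPath.tendsto_average_of_tendsto_charFun hne hω hf.continuous hB).congr' ?_
  filter_upwards [UpRightPath.eventually_integral_coord_eq_one hξ hM hmeas hlaw] with N hN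
  rw [hN, UpRightPath.pathAvgCentered_one]
end

section
/- Finitely many uniform picks from the simplex: Let w be uniformly distributed on Δ_{N,=} = {x ∈ ℝ₊^N : x_1 + ⋯ + x_N = N} (or on Δ_{N,≤} = {x ∈ ℝ₊^N : x_1 + ⋯ + x_N ≤ N}), let m ∈ ℕ be fixed, and let σ be chosen uniformly at random from the m-element subsets of {1, …, N}, independently of w. Then P_w-almost surely, the quenched law of Σ_{j∈σ} w_j given w converges weakly to the Gamma distribution Γ_{m,1} with shape parameter m and scale parameter 1 as N → ∞. -/
open MeasureTheory ProbabilityTheory Real Filter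

/-- The solid simplex `Δ_{N,≤} = {x ∈ ℝ₊^N : x_1 + ⋯ + x_N ≤ N}` in Euclidean space. -/
def simplexLe (ι : Type) [Fintype ι] : Set (EuclideanSpace ℝ ι) :=
  {x | (∀ i, 0 ≤ x i) ∧ ∑ i, x i ≤ (Fintype.card ι : ℝ)}

/-- The uniform (normalized Lebesgue) probability measure on `Δ_{N,≤}`. -/
noncomputable def simplexLeUniform (ι : Type) [Fintype ι] : Measure (EuclideanSpace ℝ ι) :=
  (volume (simplexLe ι))⁻¹ • volume.restrict (simplexLe ι)

/-- The quenched average `E_σ f(Σ_{j∈σ} W_j)` over a uniformly random `m`-element subset `σ`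
of the `N` coordinates, the vector `W` being fixed. -/
noncomputable def pickSumAvg (N m : ℕ) (W : Fin N → ℝ) (f : ℝ → ℝ) : ℝ :=
  ((N.choose m : ℕ) : ℝ)⁻¹ *
    ∑ σ ∈ Finset.powersetCard m (Finset.univ : Finset (Fin N)), f (∑ j ∈ σ, W j)

lemma pi_withDensity_of_isProbabilityMeasure {ι : Type*} [Fintype ι] (μ : Measure ℝ)
    [IsProbabilityMeasure μ] {q : ℝ → ENNReal} (hq : Measurable q)
    [SigmaFinite (μ.withDensity q)] :
    (Measure.pi fun _ : ι => μ).withDensity (fun x => ∏ i, q (x i)) =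
      Measure.pi fun _ : ι => μ.withDensity q := by
  symm
  refine Measure.pi_eq fun s hs => ?_
  have hind : iIndepFun (fun (i : ι) (x : ι → ℝ) => (s i).indicator q (x i))
      (Measure.pi fun _ : ι => μ) :=
    iIndepFun_pi (X := fun i => (s i).indicator q)
      fun i => (hq.indicator (hs i)).aemeasurable
  have h1 := lintegral_prod_eq_prod_lintegral_of_indepFun Finset.univ _ hind
    fun i => (hq.indicator (hs i)).comp (measurable_pi_apply i)
  rw [withDensity_apply _ (MeasurableSet.univ_pi hs),
    ← lintegral_indicator (MeasurableSet.univ_pi hs)]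
  have h2 : (Set.univ.pi s).indicator (fun x : ι → ℝ => ∏ i, q (x i)) =
      fun x => ∏ i, (s i).indicator q (x i) := by
    classical
    ext x
    by_cases hx : x ∈ Set.univ.pi s
    · rw [Set.indicator_of_mem hx]
      exact Finset.prod_congr rfl fun i _ =>
        (Set.indicator_of_mem (hx i (Set.mem_univ i)) q).symm
    · rw [Set.indicator_of_notMem hx]
      simp only [Set.mem_pi, Set.mem_univ, true_imp_iff, not_forall] at hx
      obtain ⟨i, hi⟩ := hx
      exact (Finset.prod_eq_zero (Finset.mem_univ i) (Set.indicator_of_notMem hi q)).symm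
  rw [h2, h1]
  refine Finset.prod_congr rfl fun i _ => ?_
  rw [withDensity_apply _ (hs i), ← lintegral_indicator (hs i)]
  have := (measurePreserving_eval (fun _ : ι => μ) i).lintegral_comp (hq.indicator (hs i))
  exact this

lemma expMeasure_withDensity_exp :
    (expMeasure 1).withDensity (fun x => ENNReal.ofReal (exp x)) =
      volume.restrict (Set.Ici 0) := by
  rw [expMeasure, gammaMeasure, ← withDensity_mul _ (by unfold gammaPDF; fun_prop) (by fun_prop),
    ← withDensity_indicator_one measurableSet_Ici]
  congr 1
  ext x
  by_cases hx : 0 ≤ x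
  · rw [Set.indicator_of_mem (Set.mem_Ici.2 hx), Pi.mul_apply, gammaPDF_of_nonneg hx,
      ← ENNReal.ofReal_mul (by positivity)]
    simp [← Real.exp_add]
  · rw [Set.indicator_of_notMem (by simpa using hx), Pi.mul_apply, gammaPDF_of_neg (not_le.1 hx),
      zero_mul]

lemma measurableSet_solidSimplex {n : ℕ} (R : ℝ) :
    MeasurableSet {x : Fin n → ℝ | (∀ i, 0 ≤ x i) ∧ ∑ i, x i ≤ R} := by
  measurability

lemma volume_inter_solidSimplex_le_exp {n : ℕ} (R : ℝ) {A : Set (Fin n → ℝ)}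
    (hA : MeasurableSet A) :
    volume (A ∩ {x | (∀ i, 0 ≤ x i) ∧ ∑ i, x i ≤ R}) ≤
      ENNReal.ofReal (exp R) * Measure.pi (fun _ : Fin n => expMeasure 1) A := by
  have := isProbabilityMeasure_expMeasure zero_lt_one
  have hS : MeasurableSet (A ∩ {x : Fin n → ℝ | (∀ i, 0 ≤ x i) ∧ ∑ i, x i ≤ R}) :=
    hA.inter (measurableSet_solidSimplex R)
  have hsf : SigmaFinite ((expMeasure 1).withDensity (fun x => ENNReal.ofReal (exp x))) := by
    rw [expMeasure_withDensity_exp]; infer_instance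
  have key := pi_withDensity_of_isProbabilityMeasure (ι := Fin n) (expMeasure 1)
    (q := fun x => ENNReal.ofReal (exp x)) (by fun_prop)
  rw [expMeasure_withDensity_exp, ← Measure.restrict_pi_pi] at key
  have hvol : volume (A ∩ {x : Fin n → ℝ | (∀ i, 0 ≤ x i) ∧ ∑ i, x i ≤ R}) =
      (volume.restrict (Set.univ.pi fun _ => Set.Ici 0))
        (A ∩ {x : Fin n → ℝ | (∀ i, 0 ≤ x i) ∧ ∑ i, x i ≤ R}) := by
    have hsub : A ∩ {x : Fin n → ℝ | (∀ i, 0 ≤ x i) ∧ ∑ i, x i ≤ R} ⊆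
        Set.univ.pi fun _ => Set.Ici 0 := fun x hx i _ => hx.2.1 i
    rw [Measure.restrict_apply hS, Set.inter_eq_left.2 hsub]
  rw [hvol, volume_pi, ← key, withDensity_apply _ hS]
  calc ∫⁻ x in A ∩ {x : Fin n → ℝ | (∀ i, 0 ≤ x i) ∧ ∑ i, x i ≤ R},
        ∏ i, ENNReal.ofReal (exp (x i)) ∂(Measure.pi fun _ : Fin n => expMeasure 1)
      ≤ ∫⁻ x in A ∩ {x : Fin n → ℝ | (∀ i, 0 ≤ x i) ∧ ∑ i, x i ≤ R},
        ENNReal.ofReal (exp R) ∂(Measure.pi fun _ : Fin n => expMeasure 1) := by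
        refine setLIntegral_mono measurable_const fun x hx => ?_
        rw [← ENNReal.ofReal_prod_of_nonneg fun i _ => (exp_pos _).le, ← Real.exp_sum]
        exact ENNReal.ofReal_le_ofReal (exp_le_exp.2 hx.2.2)
    _ ≤ _ := by
        rw [setLIntegral_const]
        gcongr
        exact Set.inter_subset_left

lemma pow_div_factorial_le_volume_solidSimplex {n : ℕ} (hn : 1 ≤ n) {R : ℝ} (hR : 0 ≤ R) :
    ENNReal.ofReal (R ^ n / n.factorial) ≤
      volume {x : Fin n → ℝ | (∀ i, 0 ≤ x i) ∧ ∑ i, x i ≤ R} := by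
  have : Nonempty (Fin n) := ⟨⟨0, hn⟩⟩
  set S := {x : Fin n → ℝ | (∀ i, 0 ≤ x i) ∧ ∑ i, x i ≤ R}
  have hball := volume_sum_rpow_le (ι := Fin n) le_rfl R
  let F (s : Fin n → Bool) (x : Fin n → ℝ) (i : Fin n) : ℝ :=
    (if s i then (fun y => -y) else id) (x i)
  have hF (s : Fin n → Bool) : MeasurePreserving (F s) := by
    refine volume_preserving_pi (f := fun i => if s i then (fun y : ℝ => -y) else id) fun i => ?_
    cases s i
    · simpa using MeasurePreserving.id _
    · simpa using Measure.measurePreserving_neg (volume : Measure ℝ)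
  have hsub : {x : Fin n → ℝ | (∑ i, |x i| ^ (1 : ℝ)) ^ (1 / (1 : ℝ)) ≤ R} ⊆
      ⋃ s : Fin n → Bool, F s ⁻¹' S := by
    intro x hx
    simp only [Real.rpow_one, div_one, Set.mem_ofPred_eq] at hx
    have h (i : Fin n) : F (fun i => decide (x i < 0)) x i = |x i| := by
      by_cases hi : x i < 0
      · simp [F, hi, abs_of_neg]
      · simp [F, hi, abs_of_nonneg (not_lt.1 hi)]
    refine Set.mem_iUnion.2 ⟨fun i => decide (x i < 0), ?_, ?_⟩
    · intro i; rw [h]; exact abs_nonneg _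
    · simpa only [h] using hx
  have h2 : volume {x : Fin n → ℝ | (∑ i, |x i| ^ (1 : ℝ)) ^ (1 / (1 : ℝ)) ≤ R} ≤
      2 ^ n * volume S := by
    refine (measure_mono hsub).trans ((measure_iUnion_fintype_le _ _).trans ?_)
    have (s : Fin n → Bool) : volume (F s ⁻¹' S) = volume S :=
      (hF s).measure_preimage (measurableSet_solidSimplex R).nullMeasurableSet
    simp only [this, Finset.sum_const, Finset.card_univ, Fintype.card_fun, Fintype.card_bool,
      Fintype.card_fin, nsmul_eq_mul, Nat.cast_pow, Nat.cast_ofNat, le_refl]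
  rw [hball, ← ENNReal.ofReal_pow hR, ← ENNReal.ofReal_mul (by positivity)] at h2
  have h3 : R ^ Fintype.card (Fin n) * ((2 * Gamma (1 / 1 + 1)) ^ Fintype.card (Fin n) /
      Gamma ((Fintype.card (Fin n) : ℝ) / 1 + 1)) = 2 ^ n * (R ^ n / n.factorial) := by
    rw [Fintype.card_fin, div_one, div_one, Real.Gamma_nat_eq_factorial]
    norm_num [Real.Gamma_two]
    ring
  rw [h3, ENNReal.ofReal_mul (by positivity), ENNReal.ofReal_pow (by norm_num)] at h2
  simp only [ENNReal.ofReal_ofNat] at h2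
  exact (ENNReal.mul_le_mul_iff_right (by positivity) (by finiteness)).1 h2

lemma factorial_le_stirling {n : ℕ} (hn : 1 ≤ n) :
    (n.factorial : ℝ) ≤ exp 1 * n * (n / exp 1) ^ n := by
  obtain ⟨k, rfl⟩ : ∃ k, n = k + 1 := ⟨n - 1, by omega⟩
  have h := Stirling.stirlingSeq'_antitone (Nat.zero_le k)
  simp only [Function.comp, Nat.succ_eq_add_one, zero_add, Stirling.stirlingSeq_one] at h
  rw [Stirling.stirlingSeq, div_le_iff₀ (by positivity)] at h
  refine h.trans ?_
  have h1 : √((k + 1 : ℕ) : ℝ) ≤ ((k + 1 : ℕ) : ℝ) := by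
    rw [Real.sqrt_le_left (by positivity)]
    push_cast
    nlinarith [(Nat.cast_nonneg k : (0 : ℝ) ≤ k)]
  have h2 : exp 1 / √2 * √(2 * ((k + 1 : ℕ) : ℝ)) = exp 1 * √((k + 1 : ℕ) : ℝ) := by
    rw [Real.sqrt_mul (by norm_num)]
    field_simp
  rw [← mul_assoc, h2]
  gcongr

lemma volume_inter_solidSimplex_le {n : ℕ} (hn : 1 ≤ n) {R : ℝ} (hR : n ≤ R) (hR' : R ≤ n + 1)
    {A : Set (Fin n → ℝ)} (hA : MeasurableSet A) :
    volume (A ∩ {x | (∀ i, 0 ≤ x i) ∧ ∑ i, x i ≤ R}) ≤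
      ENNReal.ofReal (exp 2 * n) * volume {x : Fin n → ℝ | (∀ i, 0 ≤ x i) ∧ ∑ i, x i ≤ R} *
        Measure.pi (fun _ : Fin n => expMeasure 1) A := by
  refine (volume_inter_solidSimplex_le_exp R hA).trans ?_
  gcongr
  have hn0 : (0 : ℝ) < n := by exact_mod_cast hn
  refine le_trans ?_ (mul_le_mul_right (pow_div_factorial_le_volume_solidSimplex hn
    (hn0.le.trans hR)) _)
  rw [← ENNReal.ofReal_mul (by positivity)]
  refine ENNReal.ofReal_le_ofReal ?_
  have h1 : exp R ≤ exp 1 * exp 1 ^ n := by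
    rw [← Real.exp_nat_mul, ← Real.exp_add]
    exact exp_le_exp.2 (by linarith)
  have h2 : (n : ℝ) ^ n ≤ R ^ n := by gcongr
  have h3 := factorial_le_stirling hn
  rw [div_pow, mul_div_assoc', le_div_iff₀ (by positivity)] at h3
  have h4 : exp 2 = exp 1 * exp 1 := by rw [← Real.exp_add]; norm_num
  rw [mul_div_assoc', le_div_iff₀ (by positivity)]
  calc exp R * n.factorial ≤ exp 1 * exp 1 ^ n * n.factorial := by gcongr
    _ = exp 1 * (n.factorial * exp 1 ^ n) := by ring
    _ ≤ exp 1 * (exp 1 * n * n ^ n) := by gcongr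
    _ ≤ exp 1 * (exp 1 * n * R ^ n) := by gcongr
    _ = _ := by rw [h4]; ring

lemma norm_pow_mul_cexp_neg {c : ℂ} (hc : c.re = 1) (k : ℕ) {x : ℝ} (hx : 0 ≤ x) :
    ‖(x : ℂ) ^ k * Complex.exp (-(c * x))‖ = x ^ k * exp (-x) := by
  rw [norm_mul, norm_pow, Complex.norm_real, Real.norm_of_nonneg hx, Complex.norm_exp]
  simp [hc]

lemma integrableOn_pow_mul_cexp_neg {c : ℂ} (hc : c.re = 1) (k : ℕ) :
    IntegrableOn (fun x : ℝ => (x : ℂ) ^ k * Complex.exp (-(c * x))) (Set.Ioi 0) := by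
  have h := Real.GammaIntegral_convergent (s := k + 1) (by positivity)
  refine Integrable.mono' h (by fun_prop) ?_
  refine (ae_restrict_iff' measurableSet_Ioi).2 (ae_of_all _ fun x hx => ?_)
  rw [norm_pow_mul_cexp_neg hc k (le_of_lt hx), add_sub_cancel_right, Real.rpow_natCast, mul_comm]

lemma integral_pow_mul_cexp_neg {c : ℂ} (hc : c.re = 1) (k : ℕ) :
    ∫ x in Set.Ioi (0 : ℝ), (x : ℂ) ^ k * Complex.exp (-(c * x)) =
      k.factorial * (1 / c) ^ (k + 1) := by
  have hc0 : c ≠ 0 := by rintro rfl; simp at hc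
  induction k with
  | zero =>
    have := integral_exp_mul_complex_Ioi (a := -c) (by simp [hc]) 0
    simp only [pow_zero, one_mul, Nat.factorial_zero, Nat.cast_one, zero_add, pow_one]
    simp only [neg_mul, Complex.ofReal_zero, mul_zero, Complex.exp_zero] at this
    rw [this, neg_div_neg_eq]
  | succ k ih =>
    have hd (x : ℝ) : HasDerivAt (fun x : ℝ => (x : ℂ) ^ (k + 1) * Complex.exp (-(c * x)))
        (((k + 1 : ℕ) : ℂ) * ((x : ℂ) ^ k * Complex.exp (-(c * x))) -
          c * ((x : ℂ) ^ (k + 1) * Complex.exp (-(c * x)))) x := by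
      have h1 : HasDerivAt (fun z : ℂ => z ^ (k + 1) * Complex.exp (-(c * z)))
          (((k + 1 : ℕ) : ℂ) * ((x : ℂ) ^ k * Complex.exp (-(c * x))) -
          c * ((x : ℂ) ^ (k + 1) * Complex.exp (-(c * x)))) (x : ℂ) := by
        have h2 := (hasDerivAt_pow (k + 1) (x : ℂ)).mul
          (((hasDerivAt_id (x : ℂ)).const_mul c).neg.cexp)
        convert! h2 using 1
        simp
        ring
      exact h1.comp_ofReal
    have hi1 := (integrableOn_pow_mul_cexp_neg hc k).const_mul ((k + 1 : ℕ) : ℂ)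
    have hi2 := (integrableOn_pow_mul_cexp_neg hc (k + 1)).const_mul c
    have hlim : Tendsto (fun x : ℝ => (x : ℂ) ^ (k + 1) * Complex.exp (-(c * x))) atTop
        (nhds 0) := by
      rw [tendsto_zero_iff_norm_tendsto_zero]
      refine (tendsto_pow_mul_exp_neg_atTop_nhds_zero (k + 1)).congr' ?_
      filter_upwards [eventually_ge_atTop 0] with x hx
      rw [norm_pow_mul_cexp_neg hc _ hx]
    have := integral_Ioi_of_hasDerivAt_of_tendsto' (a := 0) (fun x _ => hd x) (hi1.sub hi2) hlim
    rw [integral_sub hi1 hi2, integral_const_mul, integral_const_mul, ih] at this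
    simp only [Complex.ofReal_zero, ne_eq, Nat.succ_ne_zero, not_false_eq_true, zero_pow,
      zero_mul, sub_zero] at this
    rw [sub_eq_zero] at this
    rw [← mul_right_inj' hc0, ← this, Nat.factorial_succ, pow_succ (1 / c) (k + 1)]
    push_cast
    field_simp

lemma charFun_gammaMeasure_natCast {m : ℕ} (hm : 0 < m) (t : ℝ) :
    charFun (gammaMeasure m 1) t = (1 / (1 - t * Complex.I)) ^ m := by
  obtain ⟨k, rfl⟩ : ∃ k, m = k + 1 := ⟨m - 1, by omega⟩
  have hpos : (0 : ℝ) < ((k + 1 : ℕ) : ℝ) := by positivity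
  rw [charFun_apply_real, gammaMeasure,
    integral_withDensity_eq_integral_toReal_smul (by unfold gammaPDF; fun_prop)
      (ae_of_all _ fun x => by simp [gammaPDF])]
  have h1 : (fun x : ℝ => (gammaPDF ((k + 1 : ℕ) : ℝ) 1 x).toReal •
      Complex.exp (t * x * Complex.I)) = (Set.Ici 0).indicator fun x : ℝ =>
        (k.factorial : ℂ)⁻¹ * ((x : ℂ) ^ k * Complex.exp (-((1 - t * Complex.I) * x))) := by
    ext x
    by_cases hx : 0 ≤ x
    · rw [Set.indicator_of_mem (Set.mem_Ici.2 hx), gammaPDF_of_nonneg hx,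
        ENNReal.toReal_ofReal (by positivity)]
      push_cast
      rw [Real.Gamma_nat_eq_factorial, add_sub_cancel_right, Real.rpow_natCast, Real.one_rpow,
        Complex.real_smul]
      push_cast
      rw [show -((1 - t * Complex.I) * x) = -(1 * (x : ℂ)) + t * x * Complex.I by ring,
        Complex.exp_add]
      ring
    · rw [Set.indicator_of_notMem (by simpa using hx), gammaPDF_of_neg (not_le.1 hx)]
      simp
  rw [h1, integral_indicator measurableSet_Ici, integral_Ici_eq_integral_Ioi, integral_const_mul,
    integral_pow_mul_cexp_neg (by simp), ← mul_assoc, inv_mul_cancel₀, one_mul]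
  exact_mod_cast k.factorial_ne_zero

lemma charFun_expMeasure (t : ℝ) :
    charFun (expMeasure 1) t = 1 / (1 - t * Complex.I) := by
  simpa [expMeasure] using charFun_gammaMeasure_natCast one_pos t

/-- The affine parametrisation of the hyperplane `∑ x_i = R` by all coordinates but the first. -/
def hyperplaneChart (n : ℕ) (R : ℝ) (y : Fin n → ℝ) : EuclideanSpace ℝ (Fin (n + 1)) :=
  WithLp.toLp 2 (Fin.cons (R - ∑ i, y i) y)

/-- The linear part of `hyperplaneChart`. -/
def hyperplaneChartLinear (n : ℕ) : (Fin n → ℝ) →ₗ[ℝ] EuclideanSpace ℝ (Fin (n + 1)) where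
  toFun y := hyperplaneChart n 0 y
  map_add' x y := by
    ext i
    refine Fin.cases ?_ (fun i => ?_) i
    · simp [hyperplaneChart, Finset.sum_add_distrib]; ring
    · simp [hyperplaneChart]
  map_smul' c y := by
    ext i
    refine Fin.cases ?_ (fun i => ?_) i
    · simp [hyperplaneChart, Finset.mul_sum]
    · simp [hyperplaneChart]

lemma hyperplaneChart_add (n : ℕ) (R : ℝ) (x y : Fin n → ℝ) :
    hyperplaneChart n R (x + y) = hyperplaneChartLinear n x + hyperplaneChart n R y := by
  ext i
  refine Fin.cases ?_ (fun i => ?_) i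
  · simp [hyperplaneChartLinear, hyperplaneChart, Finset.sum_add_distrib]; ring
  · simp [hyperplaneChartLinear, hyperplaneChart]

lemma lipschitzWith_hyperplaneChart (n : ℕ) (R : ℝ) :
    LipschitzWith ‖(hyperplaneChartLinear n).toContinuousLinearMap‖₊ (hyperplaneChart n R) := by
  have h : hyperplaneChart n R = fun y =>
      (hyperplaneChartLinear n).toContinuousLinearMap y + hyperplaneChart n R 0 := by
    ext1 y
    simpa using hyperplaneChart_add n R y 0
  rw [h]
  have := (hyperplaneChartLinear n).toContinuousLinearMap.lipschitz.add
    (LipschitzWith.const (hyperplaneChart n R 0))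
  simpa using this

lemma hyperplaneChart_injective (n : ℕ) (R : ℝ) : Function.Injective (hyperplaneChart n R) := by
  intro x y h
  ext i
  simpa [hyperplaneChart] using congrArg (fun z : EuclideanSpace ℝ (Fin (n + 1)) => z i.succ) h

lemma exists_hausdorffMeasure_image_hyperplaneChart (n : ℕ) (R : ℝ) :
    ∃ c : NNReal, ∀ A : Set (Fin n → ℝ),
      μH[(n : ℝ)] (hyperplaneChart n R '' A) = c * volume A := by
  have hemb : MeasurableEmbedding (hyperplaneChart n R) :=
    (lipschitzWith_hyperplaneChart n R).continuous.measurableEmbedding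
      (hyperplaneChart_injective n R)
  set ρ : Measure (Fin n → ℝ) := Measure.comap (hyperplaneChart n R) μH[(n : ℝ)] with hρ
  have hρA (A : Set (Fin n → ℝ)) : ρ A = μH[(n : ℝ)] (hyperplaneChart n R '' A) :=
    hemb.comap_apply _ _
  have : IsFiniteMeasureOnCompacts ρ := by
    refine ⟨fun K hK => ?_⟩
    rw [hρA]
    refine ((lipschitzWith_hyperplaneChart n R).hausdorffMeasure_image_le
      (Nat.cast_nonneg n) K).trans_lt ?_
    have hH : (μH[(n : ℝ)] : Measure (Fin n → ℝ)) = volume := by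
      simpa using hausdorffMeasure_pi_real (ι := Fin n)
    rw [hH]
    exact ENNReal.mul_lt_top (by simp) hK.measure_lt_top
  have : ρ.IsAddLeftInvariant := by
    refine ⟨fun g => ?_⟩
    ext s hs
    rw [Measure.map_apply (measurable_const_add g) hs, hρA, hρA,
      ← IsometryEquiv.hausdorffMeasure_image (IsometryEquiv.addLeft (hyperplaneChartLinear n g))]
    congr 1
    ext z
    simp only [Set.mem_image, Set.mem_preimage, IsometryEquiv.addLeft_apply,
      exists_exists_and_eq_and, ← hyperplaneChart_add]
    constructor
    · rintro ⟨a, ha, rfl⟩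
      exact ⟨g + a, ha, rfl⟩
    · rintro ⟨a, ha, rfl⟩
      exact ⟨-g + a, by simpa using ha, by simp⟩
  refine ⟨ρ.addHaarScalarFactor volume, fun A => ?_⟩
  rw [← hρA]
  exact congrArg (fun ν : Measure (Fin n → ℝ) => ν A) (Measure.isAddLeftInvariant_eq_smul ρ volume)

lemma ENNReal.inv_mul_le_mul_of_le_mul_mul {a b c y : ENNReal} (h : y ≤ b * a * c) :
    a⁻¹ * y ≤ b * c := by
  calc a⁻¹ * y ≤ a⁻¹ * (b * a * c) := by gcongr
    _ = (a⁻¹ * a) * (b * c) := by ring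
    _ ≤ 1 * (b * c) := by gcongr; exact ENNReal.inv_mul_le_one a
    _ = b * c := one_mul _

lemma simplexLeUniform_preimage_le {n : ℕ} (hn : 1 ≤ n) {A : Set (Fin n → ℝ)}
    (hA : MeasurableSet A) :
    simplexLeUniform (Fin n) ((fun x i => x i) ⁻¹' A) ≤
      ENNReal.ofReal (exp 2 * n) * Measure.pi (fun _ : Fin n => expMeasure 1) A := by
  have hmp := PiLp.volume_preserving_ofLp (Fin n)
  have hvol {B : Set (Fin n → ℝ)} (hB : MeasurableSet B) :
      volume ((fun (x : EuclideanSpace ℝ (Fin n)) i => x i) ⁻¹' B) = volume B :=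
    hmp.measure_preimage hB.nullMeasurableSet
  have hS := measurableSet_solidSimplex (n := n) n
  have hSeq : simplexLe (Fin n) = (fun (x : EuclideanSpace ℝ (Fin n)) i => x i) ⁻¹'
      {x | (∀ i, 0 ≤ x i) ∧ ∑ i, x i ≤ (n : ℝ)} := by
    ext x; simp [simplexLe]
  have hmeas : Measurable (fun (x : EuclideanSpace ℝ (Fin n)) i => x i) := hmp.measurable
  rw [simplexLeUniform, Measure.smul_apply, Measure.restrict_apply (hmeas hA), hSeq,
    ← Set.preimage_inter, hvol hS, hvol (hA.inter hS), smul_eq_mul]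
  refine ENNReal.inv_mul_le_mul_of_le_mul_mul ?_
  exact volume_inter_solidSimplex_le hn le_rfl (by simp) hA

lemma preimage_tail_inter_simplexEq {n : ℕ} (A : Set (Fin n → ℝ)) :
    (fun (x : EuclideanSpace ℝ (Fin (n + 1))) i => x (Fin.succ i)) ⁻¹' A ∩
      simplexEq (Fin (n + 1)) = hyperplaneChart n (n + 1) ''
        (A ∩ {x | (∀ i, 0 ≤ x i) ∧ ∑ i, x i ≤ (n : ℝ) + 1}) := by
  ext x
  constructor
  · rintro ⟨hxA, hx0, hxs⟩
    rw [Fin.sum_univ_succ, Fintype.card_fin] at hxs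
    push_cast at hxs
    refine ⟨fun i => x i.succ, ⟨hxA, fun i => hx0 _, ?_⟩, ?_⟩
    · have := hx0 0
      linarith
    · ext i
      refine Fin.cases ?_ (fun i => ?_) i
      · simp only [hyperplaneChart, PiLp.toLp_apply, Fin.cons_zero]
        linarith
      · simp [hyperplaneChart]
  · rintro ⟨y, ⟨hyA, hy0, hys⟩, rfl⟩
    refine ⟨by simpa [hyperplaneChart] using hyA, fun i => ?_, ?_⟩
    · refine Fin.cases ?_ (fun i => ?_) i
      · simpa [hyperplaneChart] using hys
      · simpa [hyperplaneChart] using hy0 i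
    · rw [Fin.sum_univ_succ]
      simp [hyperplaneChart]

lemma simplexEqUniform_preimage_tail_le {n : ℕ} (hn : 1 ≤ n) {A : Set (Fin n → ℝ)}
    (hA : MeasurableSet A) :
    simplexEqUniform (Fin (n + 1)) ((fun x i => x (Fin.succ i)) ⁻¹' A) ≤
      ENNReal.ofReal (exp 2 * n) * Measure.pi (fun _ : Fin n => expMeasure 1) A := by
  obtain ⟨c, hc⟩ := exists_hausdorffMeasure_image_hyperplaneChart n (n + 1)
  have hmeas : Measurable (fun (x : EuclideanSpace ℝ (Fin (n + 1))) i => x (Fin.succ i)) := by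
    fun_prop
  have hd : ((Fintype.card (Fin (n + 1)) - 1 : ℕ) : ℝ) = n := by simp
  have hS : μH[(n : ℝ)] (simplexEq (Fin (n + 1))) =
      c * volume {x : Fin n → ℝ | (∀ i, 0 ≤ x i) ∧ ∑ i, x i ≤ (n : ℝ) + 1} := by
    have := preimage_tail_inter_simplexEq (n := n) Set.univ
    rw [Set.preimage_univ, Set.univ_inter, Set.univ_inter] at this
    rw [this, hc]
  rw [simplexEqUniform, hd, Measure.smul_apply, Measure.restrict_apply (hmeas hA),
    preimage_tail_inter_simplexEq, hc, hS, smul_eq_mul]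
  refine ENNReal.inv_mul_le_mul_of_le_mul_mul ?_
  refine (mul_le_mul_right (volume_inter_solidSimplex_le hn (by simp) le_rfl hA) _).trans
    (le_of_eq ?_)
  ring

lemma measure_pi_le_sum_sub_integral (μ : Measure ℝ) [IsProbabilityMeasure μ] {g : ℝ → ℝ}
    (hg : Measurable g) (hb : ∀ x, |g x| ≤ 1) {n : ℕ} (hn : 1 ≤ n) {ε : ℝ} (hε : 0 < ε) :
    (Measure.pi fun _ : Fin n => μ) {x | n * ε ≤ ∑ i, (g (x i) - ∫ y, g y ∂μ)} ≤
      ENNReal.ofReal (exp (-(ε ^ 2 / 2) * n)) := by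
  have hn0 : (0 : ℝ) < n := by exact_mod_cast hn
  have hsub := hasSubgaussianMGF_of_mem_Icc (μ := μ) (X := g) (a := -1) (b := 1)
    hg.aemeasurable (ae_of_all _ fun x => abs_le.1 (hb x))
  have hind : iIndepFun (fun (i : Fin n) (x : Fin n → ℝ) => g (x i) - ∫ y, g y ∂μ)
      (Measure.pi fun _ : Fin n => μ) :=
    iIndepFun_pi (X := fun _ x => g x - ∫ y, g y ∂μ) fun i => (hg.sub_const _).aemeasurable
  have hsub' (i : Fin n) : HasSubgaussianMGF (fun x : Fin n → ℝ => g (x i) - ∫ y, g y ∂μ)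
      ((‖(1 : ℝ) - -1‖₊ / 2) ^ 2) (Measure.pi fun _ : Fin n => μ) := by
    have hmap := (measurePreserving_eval (fun _ : Fin n => μ) i)
    refine HasSubgaussianMGF.of_map (Y := fun x : Fin n → ℝ => x i)
      (X := fun y => g y - ∫ y, g y ∂μ) hmap.measurable.aemeasurable ?_
    have h2 : Measure.map (fun x : Fin n → ℝ => x i) (Measure.pi fun _ : Fin n => μ) = μ :=
      hmap.map_eq
    rw [h2]
    exact hsub
  have h := HasSubgaussianMGF.measure_sum_ge_le_of_iIndepFun hind (s := Finset.univ)
    (fun i _ => hsub' i) (ε := n * ε) (by positivity)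
  rw [← ofReal_measureReal]
  refine ENNReal.ofReal_le_ofReal (h.trans (le_of_eq ?_))
  have hc : ‖(1 : ℝ) - -1‖₊ / 2 = 1 := by
    ext
    norm_num
  rw [hc]
  simp only [one_pow, Finset.sum_const, Finset.card_univ, Fintype.card_fin, nsmul_eq_mul, mul_one,
    NNReal.coe_natCast]
  congr 1
  field_simp

lemma measure_pi_le_abs_avg_sub_integral (μ : Measure ℝ) [IsProbabilityMeasure μ] {g : ℝ → ℝ}
    (hg : Measurable g) (hb : ∀ x, |g x| ≤ 1) {n : ℕ} (hn : 1 ≤ n) {ε : ℝ} (hε : 0 < ε) :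
    (Measure.pi fun _ : Fin n => μ) {x | ε ≤ |(∑ i, g (x i)) / n - ∫ y, g y ∂μ|} ≤
      ENNReal.ofReal (2 * exp (-(ε ^ 2 / 2) * n)) := by
  have hn0 : (0 : ℝ) < n := by exact_mod_cast hn
  have h1 := measure_pi_le_sum_sub_integral μ hg hb hn hε
  have h2 := measure_pi_le_sum_sub_integral μ (g := fun x => -g x) hg.neg (by simpa using hb) hn hε
  rw [two_mul, ENNReal.ofReal_add (exp_pos _).le (exp_pos _).le]
  refine (measure_mono ?_).trans ((measure_union_le _ _).trans (add_le_add h1 h2))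
  intro x hx
  have h3 : (∑ i, g (x i)) / n - ∫ y, g y ∂μ = (∑ i, (g (x i) - ∫ y, g y ∂μ)) / n := by
    simp only [Finset.sum_sub_distrib, Finset.sum_const, Finset.card_univ, Fintype.card_fin,
      nsmul_eq_mul]
    field_simp
  have h4 : ∑ i, (-g (x i) - ∫ y, -g y ∂μ) = -∑ i, (g (x i) - ∫ y, g y ∂μ) := by
    rw [integral_neg, ← Finset.sum_neg_distrib]
    exact Finset.sum_congr rfl fun i _ => by ring
  change ε ≤ |(∑ i, g (x i)) / n - ∫ y, g y ∂μ| at hx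
  change (n * ε ≤ ∑ i, (g (x i) - ∫ y, g y ∂μ)) ∨
    (n * ε ≤ ∑ i, (-g (x i) - ∫ y, -g y ∂μ))
  rw [h3, abs_div, abs_of_pos hn0, le_div_iff₀ hn0, le_abs] at hx
  rw [h4]
  rcases hx with hx | hx
  · left; linarith
  · right; linarith

lemma ae_tendsto_avg {Ω : Type*} [MeasurableSpace Ω] (P : Measure Ω) (μ : Measure ℝ)
    [IsProbabilityMeasure μ] (V : ∀ n : ℕ, Ω → Fin n → ℝ) {C : ℝ} (hC : 0 ≤ C)
    (hV : ∀ n, 1 ≤ n → ∀ A : Set (Fin n → ℝ), MeasurableSet A →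
      P (V n ⁻¹' A) ≤ ENNReal.ofReal (C * n) * Measure.pi (fun _ : Fin n => μ) A)
    {g : ℝ → ℝ} (hg : Measurable g) (hb : ∀ x, |g x| ≤ 1) :
    ∀ᵐ ω ∂P, Tendsto (fun n : ℕ => (∑ i, g (V n ω i)) / n) atTop (nhds (∫ y, g y ∂μ)) := by
  have key (ε : ℝ) (hε : 0 < ε) :
      ∀ᵐ ω ∂P, ∀ᶠ n : ℕ in atTop, |(∑ i, g (V n ω i)) / n - ∫ y, g y ∂μ| < ε := by
    let A (n : ℕ) : Set (Fin n → ℝ) := {x | ε ≤ |(∑ i, g (x i)) / n - ∫ y, g y ∂μ|}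
    have hA (n : ℕ) : MeasurableSet (A n) :=
      measurableSet_le measurable_const (by fun_prop)
    have hbound (n : ℕ) : P (V (n + 1) ⁻¹' A (n + 1)) ≤
        ENNReal.ofReal (2 * C * (((n + 1 : ℕ) : ℝ) ^ 1 * exp (-(ε ^ 2 / 2) * (n + 1 : ℕ)))) := by
      refine (hV (n + 1) (by simp) _ (hA _)).trans ?_
      refine (mul_le_mul_right (measure_pi_le_abs_avg_sub_integral μ hg hb (by simp) hε) _).trans ?_
      rw [← ENNReal.ofReal_mul (by positivity)]
      exact ENNReal.ofReal_le_ofReal (le_of_eq (by ring))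
    have hsum : Summable fun n : ℕ =>
        2 * C * (((n + 1 : ℕ) : ℝ) ^ 1 * exp (-(ε ^ 2 / 2) * (n + 1 : ℕ))) :=
      ((summable_nat_add_iff 1).2
        (summable_pow_mul_exp_neg_nat_mul 1 (r := ε ^ 2 / 2) (by positivity))).mul_left _
    have hfin : ∑' n, P (V (n + 1) ⁻¹' A (n + 1)) ≠ ⊤ :=
      ne_top_of_le_ne_top hsum.tsum_ofReal_ne_top (ENNReal.tsum_le_tsum hbound)
    filter_upwards [ae_eventually_notMem hfin] with ω hω
    rw [← map_add_atTop_eq_nat 1, eventually_map]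
    filter_upwards [hω] with n hn
    exact not_le.1 hn
  have hall := ae_all_iff.2 fun k : ℕ => key (1 / ((k : ℝ) + 1)) (by positivity)
  filter_upwards [hall] with ω hω
  rw [Metric.tendsto_nhds]
  intro ε hε
  obtain ⟨k, hk⟩ := exists_nat_one_div_lt hε
  filter_upwards [hω k] with n hn
  exact hn.trans hk

lemma card_filter_embedding_map_eq {N m : ℕ} {σ : Finset (Fin N)} (hσ : σ.card = m) :
    (Finset.univ.filter fun p : Fin m ↪ Fin N => Finset.univ.map p = σ).card = m.factorial := by
  have h1 : Fintype.card (Fin m ≃ σ) = m.factorial := by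
    rw [Fintype.card_equiv (Fintype.equivOfCardEq (by simp [hσ])), Fintype.card_fin]
  rw [← h1, ← Finset.card_univ]
  symm
  refine Finset.card_bij (fun e _ => e.toEmbedding.trans (Function.Embedding.subtype _)) ?_ ?_ ?_
  · intro e _
    simp only [Finset.mem_filter, Finset.mem_univ, true_and]
    ext j
    simp only [Finset.mem_map, Finset.mem_univ, true_and, Function.Embedding.trans_apply,
      Equiv.coe_toEmbedding, Function.Embedding.subtype_apply]
    constructor
    · rintro ⟨k, rfl⟩
      exact (e k).2
    · intro hj
      exact ⟨e.symm ⟨j, hj⟩, by simp⟩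
  · intro e _ e' _ h
    ext k
    exact congrArg Fin.val (DFunLike.congr_fun h k)
  · intro p hp
    simp only [Finset.mem_filter, Finset.mem_univ, true_and] at hp
    subst hp
    refine ⟨Equiv.ofBijective (fun k => ⟨p k, by simp⟩) ⟨?_, ?_⟩, Finset.mem_univ _, ?_⟩
    · intro a b h
      exact p.injective (congrArg Subtype.val h)
    · rintro ⟨j, hj⟩
      obtain ⟨k, -, rfl⟩ := Finset.mem_map.1 hj
      exact ⟨k, rfl⟩
    · ext k
      rfl

lemma sum_embedding_eq_factorial_mul_sum_powersetCard {N m : ℕ} (w : Fin N → ℝ) (f : ℝ → ℝ) :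
    ∑ p : Fin m ↪ Fin N, f (∑ k, w (p k)) =
      m.factorial * ∑ σ ∈ Finset.powersetCard m (Finset.univ : Finset (Fin N)),
        f (∑ j ∈ σ, w j) := by
  rw [← Finset.sum_fiberwise_of_maps_to (s := Finset.univ)
    (t := Finset.powersetCard m (Finset.univ : Finset (Fin N)))
    (g := fun p : Fin m ↪ Fin N => Finset.univ.map p) (by simp), Finset.mul_sum]
  refine Finset.sum_congr rfl fun σ hσ => ?_
  rw [Finset.sum_congr rfl (g := fun _ => f (∑ j ∈ σ, w j)), Finset.sum_const,
    card_filter_embedding_map_eq (Finset.mem_powersetCard.1 hσ).2, nsmul_eq_mul]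
  intro p hp
  rw [← (Finset.mem_filter.1 hp).2, Finset.sum_map]

lemma pickSumAvg_eq_sum_embedding {N m : ℕ} (w : Fin N → ℝ) (f : ℝ → ℝ) :
    pickSumAvg N m w f = (N.descFactorial m : ℝ)⁻¹ * ∑ p : Fin m ↪ Fin N, f (∑ k, w (p k)) := by
  rw [pickSumAvg, sum_embedding_eq_factorial_mul_sum_powersetCard,
    Nat.descFactorial_eq_factorial_mul_choose]
  have : (m.factorial : ℝ) ≠ 0 := by exact_mod_cast m.factorial_ne_zero
  push_cast
  field_simp

lemma abs_pickSumAvg_sub_le {N m : ℕ} (hmN : m ≤ N) (w : Fin N → ℝ) {f : ℝ → ℝ} {B : ℝ}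
    (hB : ∀ x, |f x| ≤ B) :
    |pickSumAvg N m w f - ((N : ℝ) ^ m)⁻¹ * ∑ p : Fin m → Fin N, f (∑ k, w (p k))| ≤
      2 * B * (1 - N.descFactorial m / (N : ℝ) ^ m) := by
  classical
  have hD : (0 : ℝ) < N.descFactorial m := by
    exact_mod_cast Nat.pos_of_ne_zero (by simpa [Nat.descFactorial_eq_zero_iff_lt] using hmN)
  have hDM : (N.descFactorial m : ℝ) ≤ (N : ℝ) ^ m := by
    exact_mod_cast Nat.descFactorial_le_pow N m
  have hM : (0 : ℝ) < (N : ℝ) ^ m := hD.trans_le hDM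
  have hinj : ∑ p : Fin m ↪ Fin N, f (∑ k, w (p k)) =
      ∑ p ∈ Finset.univ.filter fun p : Fin m → Fin N => Function.Injective p,
        f (∑ k, w (p k)) := by
    refine Finset.sum_bij (fun p _ => ⇑p) (fun p _ => by simp [p.injective])
      (fun p _ q _ h => DFunLike.coe_injective h) (fun p hp => ?_) fun _ _ => rfl
    exact ⟨⟨p, (Finset.mem_filter.1 hp).2⟩, Finset.mem_univ _, rfl⟩
  have hcard : (Finset.univ.filter fun p : Fin m → Fin N => Function.Injective p).card =
      N.descFactorial m := by
    have := Fintype.card_embedding_eq (α := Fin m) (β := Fin N)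
    rw [Fintype.card_fin, Fintype.card_fin] at this
    rw [← this, ← Finset.card_univ]
    symm
    refine Finset.card_bij (fun p _ => ⇑p) (fun p _ => by simp [p.injective])
      (fun p _ q _ h => DFunLike.coe_injective h) (fun p hp => ?_)
    exact ⟨⟨p, (Finset.mem_filter.1 hp).2⟩, Finset.mem_univ _, rfl⟩
  have hcard' : ((Finset.univ.filter fun p : Fin m → Fin N => ¬ Function.Injective p).card : ℝ) =
      (N : ℝ) ^ m - N.descFactorial m := by
    have := Finset.card_filter_add_card_filter_not (s := Finset.univ)
      (fun p : Fin m → Fin N => Function.Injective p)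
    rw [hcard, Finset.card_univ, Fintype.card_fun, Fintype.card_fin, Fintype.card_fin] at this
    have h2 : (N.descFactorial m : ℝ) +
        (Finset.univ.filter fun p : Fin m → Fin N => ¬ Function.Injective p).card =
        (N : ℝ) ^ m := by
      exact_mod_cast this
    linarith
  set I := ∑ p ∈ Finset.univ.filter fun p : Fin m → Fin N => Function.Injective p,
        f (∑ k, w (p k))
  set J := ∑ p ∈ Finset.univ.filter fun p : Fin m → Fin N => ¬ Function.Injective p,
        f (∑ k, w (p k))
  have hIJ : ∑ p : Fin m → Fin N, f (∑ k, w (p k)) = I + J :=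
    (Finset.sum_filter_add_sum_filter_not _ _ _).symm
  have hI : |I| ≤ N.descFactorial m * B := by
    rw [← hcard, ← nsmul_eq_mul]
    exact (Finset.abs_sum_le_sum_abs _ _).trans (Finset.sum_le_card_nsmul _ _ _ fun p _ => hB _)
  have hJ : |J| ≤ ((N : ℝ) ^ m - N.descFactorial m) * B := by
    rw [← hcard', ← nsmul_eq_mul]
    exact (Finset.abs_sum_le_sum_abs _ _).trans (Finset.sum_le_card_nsmul _ _ _ fun p _ => hB _)
  rw [pickSumAvg_eq_sum_embedding, hinj, hIJ]
  generalize (N.descFactorial m : ℝ) = D at *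
  generalize (N : ℝ) ^ m = M at *
  have h1 : D⁻¹ * I - M⁻¹ * (I + J) = (D⁻¹ - M⁻¹) * I - M⁻¹ * J := by ring
  have h2 : 0 ≤ D⁻¹ - M⁻¹ := sub_nonneg.2 (inv_anti₀ hD hDM)
  calc |D⁻¹ * I - M⁻¹ * (I + J)| ≤ (D⁻¹ - M⁻¹) * |I| + M⁻¹ * |J| := by
        rw [h1]
        refine (abs_sub _ _).trans (le_of_eq ?_)
        rw [abs_mul, abs_mul, abs_of_nonneg h2, abs_of_pos (inv_pos.2 hM)]
    _ ≤ (D⁻¹ - M⁻¹) * (D * B) + M⁻¹ * ((M - D) * B) := by gcongr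
    _ = 2 * B * (1 - D / M) := by field_simp; ring

lemma tendsto_descFactorial_div_pow (m : ℕ) :
    Tendsto (fun N : ℕ => (N.descFactorial m : ℝ) / (N : ℝ) ^ m) atTop (nhds 1) := by
  have hlow : Tendsto (fun N : ℕ => (1 - (m : ℝ) / N) ^ m) atTop (nhds 1) := by
    have := ((tendsto_const_div_atTop_nhds_zero_nat (m : ℝ)).const_sub 1).pow m
    simpa using this
  refine tendsto_of_tendsto_of_tendsto_of_le_of_le' hlow tendsto_const_nhds ?_ ?_
  · filter_upwards [eventually_ge_atTop (m + 1)] with N hN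
    have hN0 : (0 : ℝ) < N := by exact_mod_cast (by omega : 0 < N)
    rw [le_div_iff₀ (by positivity), ← mul_pow, sub_mul, one_mul, div_mul_cancel₀ _ hN0.ne']
    have h := Nat.pow_sub_le_descFactorial N m
    have h2 : ((N - m : ℕ) : ℝ) ^ m ≤ (N.descFactorial m : ℝ) := by
      exact_mod_cast (Nat.pow_le_pow_left (by omega) m).trans h
    rwa [Nat.cast_sub (by omega)] at h2
  · filter_upwards [eventually_ge_atTop 1] with N hN
    have hN0 : (0 : ℝ) < N := by exact_mod_cast hN
    rw [div_le_one (by positivity)]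
    exact_mod_cast Nat.descFactorial_le_pow N m

/-- The law of the sum of `m` independent uniform picks, with replacement, from a finite family. -/
noncomputable def replacementSumLaw (N m : ℕ) (w : Fin N → ℝ) : Measure ℝ :=
  ∑ p : Fin m → Fin N, (((N : NNReal) ^ m)⁻¹) • Measure.dirac (∑ k, w (p k))

lemma isProbabilityMeasure_replacementSumLaw {N : ℕ} (hN : N ≠ 0) (m : ℕ) (w : Fin N → ℝ) :
    IsProbabilityMeasure (replacementSumLaw N m w) := by
  constructor
  have h0 : ((N : NNReal) ^ m) ≠ 0 := pow_ne_zero _ (by exact_mod_cast hN)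
  simp only [replacementSumLaw, Measure.coe_finsetSum, Finset.sum_apply, Measure.smul_apply,
    measure_univ, ENNReal.smul_def, smul_eq_mul, mul_one, Finset.sum_const, Finset.card_univ,
    Fintype.card_fun, Fintype.card_fin, nsmul_eq_mul]
  have : (((N ^ m : ℕ) : NNReal) * ((N : NNReal) ^ m)⁻¹ : NNReal) = 1 := by
    rw [Nat.cast_pow, mul_inv_cancel₀ h0]
  exact_mod_cast this

lemma integral_replacementSumLaw {E : Type*} [NormedAddCommGroup E] [NormedSpace ℝ E]
    [CompleteSpace E] {N m : ℕ} (w : Fin N → ℝ) (f : ℝ → E) :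
    ∫ x, f x ∂(replacementSumLaw N m w) =
      ((N : ℝ) ^ m)⁻¹ • ∑ p : Fin m → Fin N, f (∑ k, w (p k)) := by
  rw [replacementSumLaw, integral_finsetSum_measure, Finset.smul_sum]
  · refine Finset.sum_congr rfl fun p _ => ?_
    rw [integral_smul_nnreal_measure, integral_dirac]
    simp [NNReal.smul_def]
  · intro p _
    exact (integrable_dirac (by finiteness)).smul_measure (by finiteness)

lemma charFun_replacementSumLaw {N m : ℕ} (w : Fin N → ℝ) (t : ℝ) :
    charFun (replacementSumLaw N m w) t =
      ((∑ j, Complex.exp (t * w j * Complex.I)) / N) ^ m := by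
  rw [charFun_apply_real, integral_replacementSumLaw, div_pow, Fintype.sum_pow, Complex.real_smul]
  push_cast
  rw [div_eq_inv_mul]
  congr 1
  refine Finset.sum_congr rfl fun p _ => ?_
  rw [← Complex.exp_sum, Finset.mul_sum, Finset.sum_mul]

lemma tendsto_pickSumAvg_of_tendsto_charFun {m : ℕ} (w : ∀ N : ℕ, Fin N → ℝ) {μ : Measure ℝ}
    [IsProbabilityMeasure μ]
    (h : ∀ t : ℝ, Tendsto (fun N : ℕ => ((∑ j, Complex.exp (t * w N j * Complex.I)) / N) ^ m)
      atTop (nhds (charFun μ t)))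
    {f : ℝ → ℝ} (hf : Continuous f) {B : ℝ} (hB : ∀ x, |f x| ≤ B) :
    Tendsto (fun N => pickSumAvg N m (w N) f) atTop (nhds (∫ x, f x ∂μ)) := by
  have hrep : Tendsto (fun N : ℕ => ∫ x, f x ∂(replacementSumLaw N m (w N))) atTop
      (nhds (∫ x, f x ∂μ)) := by
    rw [← tendsto_add_atTop_iff_nat 1]
    let Q (N : ℕ) : ProbabilityMeasure ℝ := ⟨replacementSumLaw (N + 1) m (w (N + 1)),
      isProbabilityMeasure_replacementSumLaw N.succ_ne_zero m _⟩
    have hQ : Tendsto Q atTop (nhds ⟨μ, inferInstance⟩) := by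
      refine ProbabilityMeasure.tendsto_of_tendsto_charFun fun t => ?_
      have := (tendsto_add_atTop_iff_nat 1).2 (h t)
      simp only [← charFun_replacementSumLaw] at this
      exact this
    exact ProbabilityMeasure.tendsto_iff_forall_integral_tendsto.1 hQ
      (BoundedContinuousFunction.ofNormedAddCommGroup f hf B hB)
  have hdiff : Tendsto (fun N => pickSumAvg N m (w N) f -
      ∫ x, f x ∂(replacementSumLaw N m (w N))) atTop (nhds 0) := by
    have hz : Tendsto (fun N : ℕ => 2 * B * (1 - (N.descFactorial m : ℝ) / (N : ℝ) ^ m)) atTop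
        (nhds 0) := by
      simpa using ((tendsto_descFactorial_div_pow m).const_sub 1).const_mul (2 * B)
    refine squeeze_zero_norm' ?_ hz
    filter_upwards [eventually_ge_atTop m] with N hN
    rw [integral_replacementSumLaw, smul_eq_mul]
    exact abs_pickSumAvg_sub_le hN (w N) hB
  simpa using hdiff.add hrep

lemma lipschitz_avg_cexp {N : ℕ} {w : Fin N → ℝ} (hw : ∀ i, 0 ≤ w i) (hs : ∑ i, w i ≤ N)
    (s t : ℝ) :
    ‖(∑ j, Complex.exp (s * w j * Complex.I)) / N - (∑ j, Complex.exp (t * w j * Complex.I)) / N‖ ≤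
      |s - t| := by
  rcases Nat.eq_zero_or_pos N with rfl | hN
  · simp
  have hN0 : (0 : ℝ) < N := by exact_mod_cast hN
  rw [← sub_div, ← Finset.sum_sub_distrib, norm_div, Complex.norm_natCast, div_le_iff₀ hN0]
  calc ‖∑ j, (Complex.exp (s * w j * Complex.I) - Complex.exp (t * w j * Complex.I))‖
      ≤ ∑ j, |s - t| * w j := by
        refine norm_sum_le_of_le _ fun j _ => ?_
        have h1 : Complex.exp (s * w j * Complex.I) - Complex.exp (t * w j * Complex.I) =
            Complex.exp ((t * w j : ℝ) * Complex.I) *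
              (Complex.exp (Complex.I * ((s - t) * w j : ℝ)) - 1) := by
          rw [mul_sub, ← Complex.exp_add, mul_one]
          push_cast
          ring_nf
        rw [h1, norm_mul, Complex.norm_exp_ofReal_mul_I, one_mul]
        refine (Real.norm_exp_I_mul_ofReal_sub_one_le).trans (le_of_eq ?_)
        rw [Real.norm_eq_abs, abs_mul, abs_of_nonneg (hw j)]
    _ = |s - t| * ∑ j, w j := by rw [Finset.mul_sum]
    _ ≤ |s - t| * N := by gcongr

lemma tendsto_avg_cexp_of_rat {w : ∀ N : ℕ, Fin N → ℝ} (hw : ∀ N i, 0 ≤ w N i)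
    (hs : ∀ N, ∑ i, w N i ≤ N) {φ : ℝ → ℂ} (hφ : Continuous φ)
    (h : ∀ q : ℚ, Tendsto (fun N : ℕ => (∑ j, Complex.exp ((q : ℝ) * w N j * Complex.I)) / N) atTop
      (nhds (φ q))) (t : ℝ) :
    Tendsto (fun N : ℕ => (∑ j, Complex.exp (t * w N j * Complex.I)) / N) atTop
      (nhds (φ t)) := by
  rw [Metric.tendsto_nhds]
  intro ε hε
  have hnear : ∀ᶠ s in nhds t, dist (φ s) (φ t) < ε / 3 ∧ dist s t < ε / 3 :=
    (Metric.tendsto_nhds.1 (hφ.tendsto t) _ (by positivity)).and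
      (Metric.ball_mem_nhds t (by positivity))
  obtain ⟨_, ⟨q, rfl⟩, h1, h2⟩ := Rat.denseRange_cast.inter_nhds_nonempty hnear
  filter_upwards [Metric.tendsto_nhds.1 (h q) (ε / 3) (by positivity)] with N hN
  have h3 := lipschitz_avg_cexp (hw N) (hs N) t q
  rw [← dist_eq_norm, ← Real.dist_eq, dist_comm t] at h3
  calc _ ≤ _ := dist_triangle4 _ _ _ _
    _ < ε / 3 + ε / 3 + ε / 3 := by
      exact add_lt_add (add_lt_add (h3.trans_lt h2) hN) h1
    _ = ε := by ring

lemma ae_simplexEqUniform_mem (ι : Type) [Fintype ι] :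
    ∀ᵐ x ∂(simplexEqUniform ι), x ∈ simplexLe ι := by
  have hS : MeasurableSet (simplexEq ι) := by
    unfold simplexEq
    measurability
  refine Measure.ae_smul_measure ?_ _
  filter_upwards [ae_restrict_mem hS] with x hx
  exact ⟨hx.1, hx.2.le⟩

lemma ae_simplexLeUniform_mem (ι : Type) [Fintype ι] :
    ∀ᵐ x ∂(simplexLeUniform ι), x ∈ simplexLe ι := by
  have hS : MeasurableSet (simplexLe ι) := by
    unfold simplexLe
    measurability
  exact Measure.ae_smul_measure (ae_restrict_mem hS) _

lemma tendsto_avg_of_tendsto_avg_tail {u : ∀ N : ℕ, Fin N → ℝ} (hu : ∀ N i, |u N i| ≤ 1) {l : ℝ}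
    (h : Tendsto (fun n : ℕ => (∑ i : Fin n, u (n + 1) i.succ) / n) atTop (nhds l)) :
    Tendsto (fun N : ℕ => (∑ i, u N i) / N) atTop (nhds l) := by
  rw [← tendsto_add_atTop_iff_nat 1]
  have h0 : Tendsto (fun n : ℕ => u (n + 1) 0 * (1 / ((n : ℝ) + 1))) atTop (nhds 0) :=
    bdd_le_mul_tendsto_zero' 1 (Eventually.of_forall fun n => hu (n + 1) 0)
      tendsto_one_div_add_atTop_nhds_zero_nat
  have h1 := h0.add (h.mul (tendsto_natCast_div_add_atTop (1 : ℝ)))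
  rw [zero_add, mul_one] at h1
  refine h1.congr' ?_
  filter_upwards [eventually_ge_atTop 1] with n hn
  have hn0 : (n : ℝ) ≠ 0 := by positivity
  have hn1 : (n : ℝ) + 1 ≠ 0 := by positivity
  rw [Fin.sum_univ_succ]
  push_cast
  field_simp

lemma charFun_expMeasure_eq_integral (t : ℝ) :
    charFun (expMeasure 1) t =
      (∫ x, cos (t * x) ∂(expMeasure 1) : ℝ) +
        (∫ x, sin (t * x) ∂(expMeasure 1) : ℝ) * Complex.I := by
  have := isProbabilityMeasure_expMeasure zero_lt_one
  have hcos : Integrable (fun x => ((cos (t * x) : ℝ) : ℂ)) (expMeasure 1) :=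
    have h : Integrable (fun x => cos (t * x)) (expMeasure 1) :=
      Integrable.of_bound (by fun_prop) 1 (Eventually.of_forall fun _ => abs_cos_le_one _)
    h.ofReal
  have hsin : Integrable (fun x => ((sin (t * x) : ℝ) : ℂ)) (expMeasure 1) :=
    have h : Integrable (fun x => sin (t * x)) (expMeasure 1) :=
      Integrable.of_bound (by fun_prop) 1 (Eventually.of_forall fun _ => abs_sin_le_one _)
    h.ofReal
  rw [charFun_apply_real, ← integral_complex_ofReal, ← integral_complex_ofReal,
    ← integral_mul_const, ← integral_add hcos (hsin.mul_const _)]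
  congr 1
  ext x
  rw [Complex.exp_mul_I]
  push_cast
  rfl

section

variable {Ω : Type} [MeasurableSpace Ω] {P : Measure Ω}
  {W : ∀ N : ℕ, Ω → EuclideanSpace ℝ (Fin N)}

lemma ae_mem_simplexLe (hmeas : ∀ N, Measurable (W N))
    (hlaw : (∀ N, Measure.map (W N) P = simplexEqUniform (Fin N)) ∨
            (∀ N, Measure.map (W N) P = simplexLeUniform (Fin N))) :
    ∀ᵐ ω ∂P, ∀ N, W N ω ∈ simplexLe (Fin N) := by
  refine ae_all_iff.2 fun N => ae_of_ae_map (hmeas N).aemeasurable ?_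
  rcases hlaw with h | h
  · rw [h N]
    exact ae_simplexEqUniform_mem _
  · rw [h N]
    exact ae_simplexLeUniform_mem _

lemma ae_tendsto_avg_simplex (hmeas : ∀ N, Measurable (W N))
    (hlaw : (∀ N, Measure.map (W N) P = simplexEqUniform (Fin N)) ∨
            (∀ N, Measure.map (W N) P = simplexLeUniform (Fin N)))
    {g : ℝ → ℝ} (hg : Measurable g) (hb : ∀ x, |g x| ≤ 1) :
    ∀ᵐ ω ∂P, Tendsto (fun N : ℕ => (∑ i, g (W N ω i)) / N) atTop
      (nhds (∫ y, g y ∂(expMeasure 1))) := by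
  have := isProbabilityMeasure_expMeasure zero_lt_one
  rcases hlaw with h | h
  · have key := ae_tendsto_avg P (expMeasure 1) (C := exp 2)
      (fun n ω i => W (n + 1) ω (Fin.succ i)) (by positivity) (fun n hn A hA => by
        have hm : Measurable (fun (x : EuclideanSpace ℝ (Fin (n + 1))) i => x (Fin.succ i)) := by
          fun_prop
        have := simplexEqUniform_preimage_tail_le hn hA
        rwa [← h (n + 1), Measure.map_apply (hmeas _) (hm hA)] at this) hg hb
    filter_upwards [key] with ω hω
    exact tendsto_avg_of_tendsto_avg_tail (u := fun N i => g (W N ω i)) (fun _ _ => hb _) hω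
  · refine ae_tendsto_avg P (expMeasure 1) (C := exp 2) (fun n ω i => W n ω i) (by positivity)
      (fun n hn A hA => ?_) hg hb
    have hm : Measurable (fun (x : EuclideanSpace ℝ (Fin n)) i => x i) := by fun_prop
    have := simplexLeUniform_preimage_le hn hA
    rwa [← h n, Measure.map_apply (hmeas _) (hm hA)] at this

lemma ae_tendsto_avg_cexp_simplex (hmeas : ∀ N, Measurable (W N))
    (hlaw : (∀ N, Measure.map (W N) P = simplexEqUniform (Fin N)) ∨
            (∀ N, Measure.map (W N) P = simplexLeUniform (Fin N))) :
    ∀ᵐ ω ∂P, ∀ t : ℝ,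
      Tendsto (fun N : ℕ => (∑ j, Complex.exp (t * W N ω j * Complex.I)) / N) atTop
        (nhds (charFun (expMeasure 1) t)) := by
  have := isProbabilityMeasure_expMeasure zero_lt_one
  have hcos := ae_all_iff.2 fun q : ℚ => ae_tendsto_avg_simplex hmeas hlaw
    (g := fun x => cos (q * x)) (by fun_prop) (fun _ => abs_cos_le_one _)
  have hsin := ae_all_iff.2 fun q : ℚ => ae_tendsto_avg_simplex hmeas hlaw
    (g := fun x => sin (q * x)) (by fun_prop) (fun _ => abs_sin_le_one _)
  filter_upwards [hcos, hsin, ae_mem_simplexLe hmeas hlaw] with ω hc hs hmem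
  refine tendsto_avg_cexp_of_rat (w := fun N i => W N ω i) (fun N => (hmem N).1)
    (fun N => by simpa using (hmem N).2) continuous_charFun fun q => ?_
  rw [charFun_expMeasure_eq_integral]
  refine (((Complex.continuous_ofReal.tendsto _).comp (hc q)).add
    (((Complex.continuous_ofReal.tendsto _).comp (hs q)).mul_const Complex.I)).congr fun N => ?_
  simp only [Function.comp, Complex.exp_mul_I, Finset.sum_add_distrib, ← Finset.sum_mul]
  push_cast
  ring

end

/-- Finitely many uniform picks from the simplex `Δ_{N,=}` (or the solid simplex `Δ_{N,≤}`):
almost surely, the quenched law converges weakly to the Gamma distribution `Γ_{m,1}`. -/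
theorem stmt18
    (Ω : Type) [MeasurableSpace Ω] (P : Measure Ω) [IsProbabilityMeasure P]
    (W : ∀ N : ℕ, Ω → EuclideanSpace ℝ (Fin N))
    (hmeas : ∀ N, Measurable (W N))
    (hlaw : (∀ N, Measure.map (W N) P = simplexEqUniform (Fin N)) ∨
            (∀ N, Measure.map (W N) P = simplexLeUniform (Fin N)))
    (m : ℕ) (hm : 0 < m) :
    ∀ᵐ ω ∂P, ∀ f : ℝ → ℝ, (∃ B, ∀ x, |f x| ≤ B) → LipschitzWith 1 f →
      Tendsto (fun N => pickSumAvg N m (W N ω) f) atTop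
        (nhds (∫ x, f x ∂(gammaMeasure (m : ℝ) 1))) := by
  have := isProbabilityMeasure_gammaMeasure (a := (m : ℝ)) (r := 1) (by positivity) one_pos
  filter_upwards [ae_tendsto_avg_cexp_simplex hmeas hlaw] with ω hω f hB hf
  obtain ⟨B, hB⟩ := hB
  refine tendsto_pickSumAvg_of_tendsto_charFun (fun N i => W N ω i) (fun t => ?_) hf.continuous hB
  rw [charFun_gammaMeasure_natCast hm, ← charFun_expMeasure]
  exact (hω t).pow m
end
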